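/- Every weakly symmetric algebra of tubular type with non-singular Cartan matrix over an algebraically closed field K is τ-tilting-finite; equivalently, each of the sixteen algebras A_1(λ), A_2(λ) (λ ∈ K \ {0,1}), A_3, ..., A_16 in the Białkowski–Skowroński classification of weakly symmetric algebras of tubular type with non-singular Cartan matrix is τ-tilting-finite. -/

import Mathlib

open CategoryTheory CategoryTheory.Limits
universe u v w
noncomputable section
namespace PaperSilting
abbrev ModCat (R : Type) [Ring R] := ModuleCat.{0} R
variable {R : Type} [Ring R]
def IsFGMod {R : Type} [Ring R] (M : ModCat R) : Prop := Module.Finite R M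
def IsIndecMod {R : Type} [Ring R] (M : ModCat R) : Prop :=
  ¬ IsZero M ∧ ∀ A B : ModCat R, Nonempty (M ≅ A ⊞ B) → IsZero A ∨ IsZero B
def MemAddMod {R : Type} [Ring R] (N M : ModCat R) : Prop :=
  ∃ (k : ℕ) (g : N ⟶ ⨁ (fun _ : Fin k => M)) (h : (⨁ (fun _ : Fin k => M)) ⟶ N),
    g ≫ h = 𝟙 N
def IsBasicMod {R : Type} [Ring R] (M : ModCat R) : Prop :=
  ∀ N X : ModCat R, Nonempty (M ≅ (N ⊞ N) ⊞ X) → IsZero N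
def IsTauRigidMod {R : Type} [Ring R] (M : ModCat R) : Prop :=
  ∃ (P₁ P₀ : ModCat R) (f : P₁ ⟶ P₀) (g : P₀ ⟶ M),
    Projective P₁ ∧ Projective P₀ ∧ IsFGMod P₁ ∧ IsFGMod P₀ ∧
    Function.Surjective g ∧ Function.Exact f g ∧
    ∀ h : P₁ ⟶ M, ∃ k : P₀ ⟶ M, f ≫ k = h
def IsTauRigidPairMod {R : Type} [Ring R] (M P : ModCat R) : Prop :=
  IsFGMod M ∧ IsTauRigidMod M ∧ IsFGMod P ∧ Projective P ∧ ∀ f : P ⟶ M, f = 0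
def IsSupportTauTiltingMod {R : Type} [Ring R] (M : ModCat R) : Prop :=
  ∃ P : ModCat R, IsTauRigidPairMod M P ∧
    ∀ N Q : ModCat R, IsTauRigidPairMod (M ⊞ N) (P ⊞ Q) → MemAddMod N M ∧ MemAddMod Q P
def IsTauTiltingFiniteRing (R : Type) [Ring R] : Prop :=
  ∃ (n : ℕ) (f : Fin n → ModCat R),
    ∀ M : ModCat R, IsSupportTauTiltingMod M → IsBasicMod M → ∃ i, Nonempty (M ≅ f i)
def IsRepFiniteRing (R : Type) [Ring R] : Prop :=
  ∃ (n : ℕ) (f : Fin n → ModCat R),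
    ∀ M : ModCat R, IsFGMod M → IsIndecMod M → ∃ i, Nonempty (M ≅ f i)
def SupportTauTiltingCount (R : Type) [Ring R] (n : ℕ) : Prop :=
  ∃ f : Fin n → ModCat R,
    (∀ i, IsSupportTauTiltingMod (f i) ∧ IsBasicMod (f i)) ∧
    (∀ i j, Nonempty (f i ≅ f j) → i = j) ∧
    (∀ M : ModCat R, IsSupportTauTiltingMod M → IsBasicMod M → ∃ i, Nonempty (M ≅ f i))
def IsTauTiltingFinite (Λ : Type) [Ring Λ] : Prop := IsTauTiltingFiniteRing Λᵐᵒᵖ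
def IsRepFinite (Λ : Type) [Ring Λ] : Prop := IsRepFiniteRing Λᵐᵒᵖ
local notation "xf" n:max => FreeAlgebra.ι _ (n : Fin 5)
local notation "xg" n:max => FreeAlgebra.ι _ (n : Fin 6)
local notation "xh" n:max => FreeAlgebra.ι _ (n : Fin 7)
local notation "xi" n:max => FreeAlgebra.ι _ (n : Fin 8)
local notation "xj" n:max => FreeAlgebra.ι _ (n : Fin 9)
local notation "xk" n:max => FreeAlgebra.ι _ (n : Fin 10)
def A1Rel (K : Type) [Field K] (l : K) : FreeAlgebra K (Fin 7) → FreeAlgebra K (Fin 7) → Prop := fun u v =>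
 (u, v) ∈ ([
 (xh 0 * xh 0, xh 0),
 (xh 0 * xh 1, 0),
 (xh 0 * xh 2, 0),
 (xh 1 * xh 0, 0),
 (xh 1 * xh 1, xh 1),
 (xh 1 * xh 2, 0),
 (xh 2 * xh 0, 0),
 (xh 2 * xh 1, 0),
 (xh 2 * xh 2, xh 2),
 (xh 0 + xh 1 + xh 2, 1),
 (xh 3, xh 0 * xh 3 * xh 1),
 (xh 4, xh 1 * xh 4 * xh 0),
 (xh 5, xh 1 * xh 5 * xh 2),
 (xh 6, xh 2 * xh 6 * xh 1),
 (xh 3 * xh 4 * xh 3, xh 3 * xh 5 * xh 6),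
 (xh 6 * xh 4 * xh 3, algebraMap K (FreeAlgebra K (Fin 7)) l * (xh 6 * xh 5 * xh 6)),
 (xh 4 * xh 3 * xh 4, xh 5 * xh 6 * xh 4),
 (xh 4 * xh 3 * xh 5, algebraMap K (FreeAlgebra K (Fin 7)) l * (xh 5 * xh 6 * xh 5))
 ] : List ((FreeAlgebra K (Fin 7)) × (FreeAlgebra K (Fin 7))))
def A1 (K : Type) [Field K] (l : K) : Type := RingQuot (A1Rel K l)
instance (K : Type) [Field K] (l : K) : Ring (A1 K l) :=
 inferInstanceAs (Ring (RingQuot (A1Rel K l)))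
instance (K : Type) [Field K] (l : K) : Algebra K (A1 K l) :=
 inferInstanceAs (Algebra K (RingQuot (A1Rel K l)))
def A2Rel (K : Type) [Field K] (l : K) : FreeAlgebra K (Fin 6) → FreeAlgebra K (Fin 6) → Prop := fun u v =>
 (u, v) ∈ ([
 (xg 0 * xg 0, xg 0),
 (xg 0 * xg 1, 0),
 (xg 1 * xg 0, 0),
 (xg 1 * xg 1, xg 1),
 (xg 0 + xg 1, 1),
 (xg 2, xg 0 * xg 2 * xg 0),
 (xg 3, xg 1 * xg 3 * xg 1),
 (xg 4, xg 0 * xg 4 * xg 1),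
 (xg 5, xg 1 * xg 5 * xg 0),
 (xg 2 * xg 2, xg 4 * xg 5),
 (algebraMap K (FreeAlgebra K (Fin 6)) l * (xg 3 * xg 3), xg 5 * xg 4),
 (xg 5 * xg 2, xg 3 * xg 5),
 (xg 4 * xg 3, xg 2 * xg 4)
 ] : List ((FreeAlgebra K (Fin 6)) × (FreeAlgebra K (Fin 6))))
def A2 (K : Type) [Field K] (l : K) : Type := RingQuot (A2Rel K l)
instance (K : Type) [Field K] (l : K) : Ring (A2 K l) :=
 inferInstanceAs (Ring (RingQuot (A2Rel K l)))
instance (K : Type) [Field K] (l : K) : Algebra K (A2 K l) :=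
 inferInstanceAs (Algebra K (RingQuot (A2Rel K l)))
def A3Rel (K : Type) [Field K] : FreeAlgebra K (Fin 10) → FreeAlgebra K (Fin 10) → Prop := fun u v =>
 (u, v) ∈ ([
 (xk 0 * xk 0, xk 0),
 (xk 0 * xk 1, 0),
 (xk 0 * xk 2, 0),
 (xk 0 * xk 3, 0),
 (xk 1 * xk 0, 0),
 (xk 1 * xk 1, xk 1),
 (xk 1 * xk 2, 0),
 (xk 1 * xk 3, 0),
 (xk 2 * xk 0, 0),
 (xk 2 * xk 1, 0),
 (xk 2 * xk 2, xk 2),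
 (xk 2 * xk 3, 0),
 (xk 3 * xk 0, 0),
 (xk 3 * xk 1, 0),
 (xk 3 * xk 2, 0),
 (xk 3 * xk 3, xk 3),
 (xk 0 + xk 1 + xk 2 + xk 3, 1),
 (xk 4, xk 0 * xk 4 * xk 1),
 (xk 5, xk 1 * xk 5 * xk 0),
 (xk 6, xk 1 * xk 6 * xk 2),
 (xk 7, xk 2 * xk 7 * xk 1),
 (xk 8, xk 1 * xk 8 * xk 3),
 (xk 9, xk 3 * xk 9 * xk 1),
 (xk 5 * xk 4 + xk 6 * xk 7 + xk 8 * xk 9, 0),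
 (xk 4 * xk 5, 0),
 (xk 7 * xk 6, 0),
 (xk 9 * xk 8, 0)
 ] : List ((FreeAlgebra K (Fin 10)) × (FreeAlgebra K (Fin 10))))
def A3 (K : Type) [Field K] : Type := RingQuot (A3Rel K)
instance (K : Type) [Field K] : Ring (A3 K) :=
 inferInstanceAs (Ring (RingQuot (A3Rel K)))
instance (K : Type) [Field K] : Algebra K (A3 K) :=
 inferInstanceAs (Algebra K (RingQuot (A3Rel K)))
def A4Rel (K : Type) [Field K] : FreeAlgebra K (Fin 10) → FreeAlgebra K (Fin 10) → Prop := fun u v =>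
 (u, v) ∈ ([
 (xk 0 * xk 0, xk 0),
 (xk 0 * xk 1, 0),
 (xk 0 * xk 2, 0),
 (xk 0 * xk 3, 0),
 (xk 1 * xk 0, 0),
 (xk 1 * xk 1, xk 1),
 (xk 1 * xk 2, 0),
 (xk 1 * xk 3, 0),
 (xk 2 * xk 0, 0),
 (xk 2 * xk 1, 0),
 (xk 2 * xk 2, xk 2),
 (xk 2 * xk 3, 0),
 (xk 3 * xk 0, 0),
 (xk 3 * xk 1, 0),
 (xk 3 * xk 2, 0),
 (xk 3 * xk 3, xk 3),
 (xk 0 + xk 1 + xk 2 + xk 3, 1),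
 (xk 4, xk 0 * xk 4 * xk 1),
 (xk 5, xk 1 * xk 5 * xk 0),
 (xk 6, xk 1 * xk 6 * xk 2),
 (xk 7, xk 2 * xk 7 * xk 1),
 (xk 8, xk 1 * xk 8 * xk 3),
 (xk 9, xk 3 * xk 9 * xk 1),
 (xk 5 * xk 4 + xk 6 * xk 7 + xk 8 * xk 9, 0),
 (xk 4 * xk 5, 0),
 (xk 7 * xk 8, 0),
 (xk 9 * xk 6, 0)
 ] : List ((FreeAlgebra K (Fin 10)) × (FreeAlgebra K (Fin 10))))
def A4 (K : Type) [Field K] : Type := RingQuot (A4Rel K)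
instance (K : Type) [Field K] : Ring (A4 K) :=
 inferInstanceAs (Ring (RingQuot (A4Rel K)))
instance (K : Type) [Field K] : Algebra K (A4 K) :=
 inferInstanceAs (Algebra K (RingQuot (A4Rel K)))
def A5Rel (K : Type) [Field K] : FreeAlgebra K (Fin 5) → FreeAlgebra K (Fin 5) → Prop := fun u v =>
 (u, v) ∈ ([
 (xf 0 * xf 0, xf 0),
 (xf 0 * xf 1, 0),
 (xf 1 * xf 0, 0),
 (xf 1 * xf 1, xf 1),
 (xf 0 + xf 1, 1),
 (xf 2, xf 0 * xf 2 * xf 0),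
 (xf 3, xf 0 * xf 3 * xf 1),
 (xf 4, xf 1 * xf 4 * xf 0),
 (xf 2 * xf 2, xf 3 * xf 4),
 (xf 4 * xf 2 * xf 3, 0)
 ] : List ((FreeAlgebra K (Fin 5)) × (FreeAlgebra K (Fin 5))))
def A5 (K : Type) [Field K] : Type := RingQuot (A5Rel K)
instance (K : Type) [Field K] : Ring (A5 K) :=
 inferInstanceAs (Ring (RingQuot (A5Rel K)))
instance (K : Type) [Field K] : Algebra K (A5 K) :=
 inferInstanceAs (Algebra K (RingQuot (A5Rel K)))
def A6Rel (K : Type) [Field K] : FreeAlgebra K (Fin 5) → FreeAlgebra K (Fin 5) → Prop := fun u v =>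
 (u, v) ∈ ([
 (xf 0 * xf 0, xf 0),
 (xf 0 * xf 1, 0),
 (xf 1 * xf 0, 0),
 (xf 1 * xf 1, xf 1),
 (xf 0 + xf 1, 1),
 (xf 2, xf 0 * xf 2 * xf 0),
 (xf 3, xf 0 * xf 3 * xf 1),
 (xf 4, xf 1 * xf 4 * xf 0),
 (xf 2 * xf 2 * xf 2, xf 3 * xf 4),
 (xf 4 * xf 3, 0),
 (xf 4 * xf 2 * xf 2, 0),
 (xf 2 * xf 2 * xf 3, 0)
 ] : List ((FreeAlgebra K (Fin 5)) × (FreeAlgebra K (Fin 5))))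
def A6 (K : Type) [Field K] : Type := RingQuot (A6Rel K)
instance (K : Type) [Field K] : Ring (A6 K) :=
 inferInstanceAs (Ring (RingQuot (A6Rel K)))
instance (K : Type) [Field K] : Algebra K (A6 K) :=
 inferInstanceAs (Algebra K (RingQuot (A6Rel K)))
def A7Rel (K : Type) [Field K] : FreeAlgebra K (Fin 10) → FreeAlgebra K (Fin 10) → Prop := fun u v =>
 (u, v) ∈ ([
 (xk 0 * xk 0, xk 0),
 (xk 0 * xk 1, 0),
 (xk 0 * xk 2, 0),
 (xk 0 * xk 3, 0),
 (xk 1 * xk 0, 0),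
 (xk 1 * xk 1, xk 1),
 (xk 1 * xk 2, 0),
 (xk 1 * xk 3, 0),
 (xk 2 * xk 0, 0),
 (xk 2 * xk 1, 0),
 (xk 2 * xk 2, xk 2),
 (xk 2 * xk 3, 0),
 (xk 3 * xk 0, 0),
 (xk 3 * xk 1, 0),
 (xk 3 * xk 2, 0),
 (xk 3 * xk 3, xk 3),
 (xk 0 + xk 1 + xk 2 + xk 3, 1),
 (xk 4, xk 0 * xk 4 * xk 1),
 (xk 5, xk 1 * xk 5 * xk 0),
 (xk 6, xk 1 * xk 6 * xk 2),
 (xk 7, xk 2 * xk 7 * xk 1),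
 (xk 8, xk 2 * xk 8 * xk 3),
 (xk 9, xk 3 * xk 9 * xk 2),
 (xk 5 * xk 4, xk 6 * xk 7),
 (xk 7 * xk 6, xk 8 * xk 9),
 (xk 4 * xk 6 * xk 8, 0),
 (xk 9 * xk 7 * xk 5, 0)
 ] : List ((FreeAlgebra K (Fin 10)) × (FreeAlgebra K (Fin 10))))
def A7 (K : Type) [Field K] : Type := RingQuot (A7Rel K)
instance (K : Type) [Field K] : Ring (A7 K) :=
 inferInstanceAs (Ring (RingQuot (A7Rel K)))
instance (K : Type) [Field K] : Algebra K (A7 K) :=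
 inferInstanceAs (Algebra K (RingQuot (A7Rel K)))
def A8Rel (K : Type) [Field K] : FreeAlgebra K (Fin 10) → FreeAlgebra K (Fin 10) → Prop := fun u v =>
 (u, v) ∈ ([
 (xk 0 * xk 0, xk 0),
 (xk 0 * xk 1, 0),
 (xk 0 * xk 2, 0),
 (xk 0 * xk 3, 0),
 (xk 1 * xk 0, 0),
 (xk 1 * xk 1, xk 1),
 (xk 1 * xk 2, 0),
 (xk 1 * xk 3, 0),
 (xk 2 * xk 0, 0),
 (xk 2 * xk 1, 0),
 (xk 2 * xk 2, xk 2),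
 (xk 2 * xk 3, 0),
 (xk 3 * xk 0, 0),
 (xk 3 * xk 1, 0),
 (xk 3 * xk 2, 0),
 (xk 3 * xk 3, xk 3),
 (xk 0 + xk 1 + xk 2 + xk 3, 1),
 (xk 4, xk 0 * xk 4 * xk 1),
 (xk 5, xk 1 * xk 5 * xk 2),
 (xk 6, xk 2 * xk 6 * xk 3),
 (xk 7, xk 3 * xk 7 * xk 0),
 (xk 8, xk 0 * xk 8 * xk 2),
 (xk 9, xk 2 * xk 9 * xk 0),
 (xk 8 * xk 9 * xk 8, xk 4 * xk 5),
 (xk 9 * xk 8 * xk 9, xk 6 * xk 7),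
 (xk 5 * xk 9 * xk 8, 0),
 (xk 7 * xk 8 * xk 9, 0),
 (xk 9 * xk 8 * xk 6, 0),
 (xk 8 * xk 9 * xk 4, 0),
 (xk 5 * xk 6, 0),
 (xk 7 * xk 4, 0)
 ] : List ((FreeAlgebra K (Fin 10)) × (FreeAlgebra K (Fin 10))))
def A8 (K : Type) [Field K] : Type := RingQuot (A8Rel K)
instance (K : Type) [Field K] : Ring (A8 K) :=
 inferInstanceAs (Ring (RingQuot (A8Rel K)))
instance (K : Type) [Field K] : Algebra K (A8 K) :=
 inferInstanceAs (Algebra K (RingQuot (A8Rel K)))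
def A9Rel (K : Type) [Field K] : FreeAlgebra K (Fin 10) → FreeAlgebra K (Fin 10) → Prop := fun u v =>
 (u, v) ∈ ([
 (xk 0 * xk 0, xk 0),
 (xk 0 * xk 1, 0),
 (xk 0 * xk 2, 0),
 (xk 0 * xk 3, 0),
 (xk 1 * xk 0, 0),
 (xk 1 * xk 1, xk 1),
 (xk 1 * xk 2, 0),
 (xk 1 * xk 3, 0),
 (xk 2 * xk 0, 0),
 (xk 2 * xk 1, 0),
 (xk 2 * xk 2, xk 2),
 (xk 2 * xk 3, 0),
 (xk 3 * xk 0, 0),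
 (xk 3 * xk 1, 0),
 (xk 3 * xk 2, 0),
 (xk 3 * xk 3, xk 3),
 (xk 0 + xk 1 + xk 2 + xk 3, 1),
 (xk 4, xk 0 * xk 4 * xk 1),
 (xk 5, xk 1 * xk 5 * xk 2),
 (xk 6, xk 2 * xk 6 * xk 1),
 (xk 7, xk 2 * xk 7 * xk 3),
 (xk 8, xk 3 * xk 8 * xk 2),
 (xk 9, xk 3 * xk 9 * xk 0),
 (xk 9 * xk 4, xk 8 * xk 6),
 (xk 7 * xk 8, xk 6 * xk 5),
 (xk 4 * xk 5 * xk 6, 0),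
 (xk 8 * xk 7 * xk 9, 0),
 (xk 5 * xk 7 * xk 8 * xk 7, 0)
 ] : List ((FreeAlgebra K (Fin 10)) × (FreeAlgebra K (Fin 10))))
def A9 (K : Type) [Field K] : Type := RingQuot (A9Rel K)
instance (K : Type) [Field K] : Ring (A9 K) :=
 inferInstanceAs (Ring (RingQuot (A9Rel K)))
instance (K : Type) [Field K] : Algebra K (A9 K) :=
 inferInstanceAs (Algebra K (RingQuot (A9Rel K)))
def A10Rel (K : Type) [Field K] : FreeAlgebra K (Fin 9) → FreeAlgebra K (Fin 9) → Prop := fun u v =>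
 (u, v) ∈ ([
 (xj 0 * xj 0, xj 0),
 (xj 0 * xj 1, 0),
 (xj 0 * xj 2, 0),
 (xj 0 * xj 3, 0),
 (xj 1 * xj 0, 0),
 (xj 1 * xj 1, xj 1),
 (xj 1 * xj 2, 0),
 (xj 1 * xj 3, 0),
 (xj 2 * xj 0, 0),
 (xj 2 * xj 1, 0),
 (xj 2 * xj 2, xj 2),
 (xj 2 * xj 3, 0),
 (xj 3 * xj 0, 0),
 (xj 3 * xj 1, 0),
 (xj 3 * xj 2, 0),
 (xj 3 * xj 3, xj 3),
 (xj 0 + xj 1 + xj 2 + xj 3, 1),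
 (xj 4, xj 0 * xj 4 * xj 1),
 (xj 5, xj 1 * xj 5 * xj 0),
 (xj 6, xj 1 * xj 6 * xj 2),
 (xj 7, xj 2 * xj 7 * xj 3),
 (xj 8, xj 3 * xj 8 * xj 1),
 (xj 8 * xj 5 * xj 4, xj 8 * xj 6 * xj 7 * xj 8),
 (xj 5 * xj 4 * xj 6, xj 6 * xj 7 * xj 8 * xj 6),
 (xj 4 * xj 5, 0),
 (xj 7 * xj 8 * xj 6 * xj 7 * xj 8 * xj 6 * xj 7, 0)
 ] : List ((FreeAlgebra K (Fin 9)) × (FreeAlgebra K (Fin 9))))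
def A10 (K : Type) [Field K] : Type := RingQuot (A10Rel K)
instance (K : Type) [Field K] : Ring (A10 K) :=
 inferInstanceAs (Ring (RingQuot (A10Rel K)))
instance (K : Type) [Field K] : Algebra K (A10 K) :=
 inferInstanceAs (Algebra K (RingQuot (A10Rel K)))
def A11Rel (K : Type) [Field K] : FreeAlgebra K (Fin 10) → FreeAlgebra K (Fin 10) → Prop := fun u v =>
 (u, v) ∈ ([
 (xk 0 * xk 0, xk 0),
 (xk 0 * xk 1, 0),
 (xk 0 * xk 2, 0),
 (xk 0 * xk 3, 0),
 (xk 1 * xk 0, 0),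
 (xk 1 * xk 1, xk 1),
 (xk 1 * xk 2, 0),
 (xk 1 * xk 3, 0),
 (xk 2 * xk 0, 0),
 (xk 2 * xk 1, 0),
 (xk 2 * xk 2, xk 2),
 (xk 2 * xk 3, 0),
 (xk 3 * xk 0, 0),
 (xk 3 * xk 1, 0),
 (xk 3 * xk 2, 0),
 (xk 3 * xk 3, xk 3),
 (xk 0 + xk 1 + xk 2 + xk 3, 1),
 (xk 4, xk 0 * xk 4 * xk 1),
 (xk 5, xk 1 * xk 5 * xk 0),
 (xk 6, xk 1 * xk 6 * xk 2),
 (xk 7, xk 2 * xk 7 * xk 1),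
 (xk 8, xk 2 * xk 8 * xk 3),
 (xk 9, xk 3 * xk 9 * xk 2),
 (xk 7 * xk 5 * xk 4, xk 7 * xk 6 * xk 7),
 (xk 5 * xk 4 * xk 6, xk 6 * xk 7 * xk 6),
 (xk 4 * xk 5, 0),
 (xk 9 * xk 7, 0),
 (xk 6 * xk 8, 0),
 (xk 7 * xk 6 * xk 7 * xk 6, xk 8 * xk 9)
 ] : List ((FreeAlgebra K (Fin 10)) × (FreeAlgebra K (Fin 10))))
def A11 (K : Type) [Field K] : Type := RingQuot (A11Rel K)
instance (K : Type) [Field K] : Ring (A11 K) :=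
 inferInstanceAs (Ring (RingQuot (A11Rel K)))
instance (K : Type) [Field K] : Algebra K (A11 K) :=
 inferInstanceAs (Algebra K (RingQuot (A11Rel K)))
def A12Rel (K : Type) [Field K] : FreeAlgebra K (Fin 7) → FreeAlgebra K (Fin 7) → Prop := fun u v =>
 (u, v) ∈ ([
 (xh 0 * xh 0, xh 0),
 (xh 0 * xh 1, 0),
 (xh 0 * xh 2, 0),
 (xh 1 * xh 0, 0),
 (xh 1 * xh 1, xh 1),
 (xh 1 * xh 2, 0),
 (xh 2 * xh 0, 0),
 (xh 2 * xh 1, 0),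
 (xh 2 * xh 2, xh 2),
 (xh 0 + xh 1 + xh 2, 1),
 (xh 3, xh 0 * xh 3 * xh 1),
 (xh 4, xh 1 * xh 4 * xh 2),
 (xh 5, xh 2 * xh 5 * xh 0),
 (xh 6, xh 0 * xh 6 * xh 2),
 (xh 6 * xh 5 * xh 6, xh 3 * xh 4),
 (xh 4 * xh 5 * xh 3, 0),
 (xh 5 * xh 6 * xh 5 * xh 6 * xh 5 * xh 6 * xh 5, 0)
 ] : List ((FreeAlgebra K (Fin 7)) × (FreeAlgebra K (Fin 7))))
def A12 (K : Type) [Field K] : Type := RingQuot (A12Rel K)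
instance (K : Type) [Field K] : Ring (A12 K) :=
 inferInstanceAs (Ring (RingQuot (A12Rel K)))
instance (K : Type) [Field K] : Algebra K (A12 K) :=
 inferInstanceAs (Algebra K (RingQuot (A12Rel K)))
def A13Rel (K : Type) [Field K] : FreeAlgebra K (Fin 8) → FreeAlgebra K (Fin 8) → Prop := fun u v =>
 (u, v) ∈ ([
 (xi 0 * xi 0, xi 0),
 (xi 0 * xi 1, 0),
 (xi 0 * xi 2, 0),
 (xi 1 * xi 0, 0),
 (xi 1 * xi 1, xi 1),
 (xi 1 * xi 2, 0),
 (xi 2 * xi 0, 0),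
 (xi 2 * xi 1, 0),
 (xi 2 * xi 2, xi 2),
 (xi 0 + xi 1 + xi 2, 1),
 (xi 3, xi 1 * xi 3 * xi 1),
 (xi 4, xi 0 * xi 4 * xi 1),
 (xi 5, xi 1 * xi 5 * xi 0),
 (xi 6, xi 1 * xi 6 * xi 2),
 (xi 7, xi 2 * xi 7 * xi 1),
 (xi 3 * xi 3, xi 5 * xi 4),
 (xi 4 * xi 6, 0),
 (xi 4 * xi 5, 0),
 (xi 7 * xi 5, 0),
 (xi 7 * xi 3, 0),
 (xi 3 * xi 6, 0),
 (xi 3 * xi 3 * xi 3, xi 6 * xi 7)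
 ] : List ((FreeAlgebra K (Fin 8)) × (FreeAlgebra K (Fin 8))))
def A13 (K : Type) [Field K] : Type := RingQuot (A13Rel K)
instance (K : Type) [Field K] : Ring (A13 K) :=
 inferInstanceAs (Ring (RingQuot (A13Rel K)))
instance (K : Type) [Field K] : Algebra K (A13 K) :=
 inferInstanceAs (Algebra K (RingQuot (A13Rel K)))
def A14Rel (K : Type) [Field K] : FreeAlgebra K (Fin 7) → FreeAlgebra K (Fin 7) → Prop := fun u v =>
 (u, v) ∈ ([
 (xh 0 * xh 0, xh 0),
 (xh 0 * xh 1, 0),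
 (xh 0 * xh 2, 0),
 (xh 1 * xh 0, 0),
 (xh 1 * xh 1, xh 1),
 (xh 1 * xh 2, 0),
 (xh 2 * xh 0, 0),
 (xh 2 * xh 1, 0),
 (xh 2 * xh 2, xh 2),
 (xh 0 + xh 1 + xh 2, 1),
 (xh 3, xh 0 * xh 3 * xh 1),
 (xh 4, xh 1 * xh 4 * xh 0),
 (xh 5, xh 1 * xh 5 * xh 2),
 (xh 6, xh 2 * xh 6 * xh 1),
 (xh 4 * xh 3, xh 5 * xh 6 * xh 5 * xh 6),
 (xh 3 * xh 5 * xh 6 * xh 5, 0),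
 (xh 6 * xh 5 * xh 6 * xh 4, 0),
 (xh 3 * xh 4, 0)
 ] : List ((FreeAlgebra K (Fin 7)) × (FreeAlgebra K (Fin 7))))
def A14 (K : Type) [Field K] : Type := RingQuot (A14Rel K)
instance (K : Type) [Field K] : Ring (A14 K) :=
 inferInstanceAs (Ring (RingQuot (A14Rel K)))
instance (K : Type) [Field K] : Algebra K (A14 K) :=
 inferInstanceAs (Algebra K (RingQuot (A14Rel K)))
def A15Rel (K : Type) [Field K] : FreeAlgebra K (Fin 8) → FreeAlgebra K (Fin 8) → Prop := fun u v =>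
 (u, v) ∈ ([
 (xi 0 * xi 0, xi 0),
 (xi 0 * xi 1, 0),
 (xi 0 * xi 2, 0),
 (xi 1 * xi 0, 0),
 (xi 1 * xi 1, xi 1),
 (xi 1 * xi 2, 0),
 (xi 2 * xi 0, 0),
 (xi 2 * xi 1, 0),
 (xi 2 * xi 2, xi 2),
 (xi 0 + xi 1 + xi 2, 1),
 (xi 3, xi 0 * xi 3 * xi 0),
 (xi 4, xi 0 * xi 4 * xi 1),
 (xi 5, xi 1 * xi 5 * xi 2),
 (xi 6, xi 2 * xi 6 * xi 0),
 (xi 7, xi 0 * xi 7 * xi 2),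
 (xi 5 * xi 6 * xi 3, 0),
 (xi 3 * xi 3, xi 7 * xi 6),
 (xi 6 * xi 7, 0),
 (xi 3 * xi 4, 0),
 (xi 3 * xi 7, xi 4 * xi 5)
 ] : List ((FreeAlgebra K (Fin 8)) × (FreeAlgebra K (Fin 8))))
def A15 (K : Type) [Field K] : Type := RingQuot (A15Rel K)
instance (K : Type) [Field K] : Ring (A15 K) :=
 inferInstanceAs (Ring (RingQuot (A15Rel K)))
instance (K : Type) [Field K] : Algebra K (A15 K) :=
 inferInstanceAs (Algebra K (RingQuot (A15Rel K)))
def A16Rel (K : Type) [Field K] : FreeAlgebra K (Fin 8) → FreeAlgebra K (Fin 8) → Prop := fun u v =>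
 (u, v) ∈ ([
 (xi 0 * xi 0, xi 0),
 (xi 0 * xi 1, 0),
 (xi 0 * xi 2, 0),
 (xi 1 * xi 0, 0),
 (xi 1 * xi 1, xi 1),
 (xi 1 * xi 2, 0),
 (xi 2 * xi 0, 0),
 (xi 2 * xi 1, 0),
 (xi 2 * xi 2, xi 2),
 (xi 0 + xi 1 + xi 2, 1),
 (xi 3, xi 0 * xi 3 * xi 0),
 (xi 4, xi 1 * xi 4 * xi 0),
 (xi 5, xi 2 * xi 5 * xi 1),
 (xi 6, xi 0 * xi 6 * xi 2),
 (xi 7, xi 2 * xi 7 * xi 0),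
 (xi 3 * xi 6 * xi 5, 0),
 (xi 3 * xi 3, xi 6 * xi 7),
 (xi 7 * xi 6, 0),
 (xi 4 * xi 3, 0),
 (xi 7 * xi 3, xi 5 * xi 4)
 ] : List ((FreeAlgebra K (Fin 8)) × (FreeAlgebra K (Fin 8))))
def A16 (K : Type) [Field K] : Type := RingQuot (A16Rel K)
instance (K : Type) [Field K] : Ring (A16 K) :=
 inferInstanceAs (Ring (RingQuot (A16Rel K)))
instance (K : Type) [Field K] : Algebra K (A16 K) :=
 inferInstanceAs (Algebra K (RingQuot (A16Rel K)))
open LinearMap (range ker)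
local notation "sA" => ![0, 1, 2, 0, 2]
local notation "tA" => ![0, 0, 1, 2, 0]
local notation "sB" => ![1, 0, 2, 1]
local notation "tB" => ![0, 1, 1, 2]
local notation "sC" => ![1, 2, 0, 2]
local notation "tC" => ![0, 1, 2, 0]
local notation "sD" => ![1, 0, 2, 1, 3, 2]
local notation "tD" => ![0, 1, 1, 2, 2, 3]
local notation "sE" => ![0, 2, 1]
local notation "tE" => ![1, 1, 2]
local notation "sF" => ![1, 0, 2, 3, 1]
local notation "tF" => ![0, 1, 1, 2, 3]
local notation "sG" => ![0, 1, 0]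
local notation "tG" => ![0, 0, 1]
local notation "sH" => ![1, 1, 0, 2, 1]
local notation "tH" => ![1, 0, 1, 1, 2]
local notation "sI" => ![1, 0, 2, 1, 3, 1]
local notation "tI" => ![0, 1, 1, 2, 1, 3]
set_option linter.unusedSimpArgs false
section KS
variable {R : Type} [Ring R]
theorem local_sum {Z : Type} [AddCommGroup Z] [Module R Z] [Nontrivial Z]
    (h : ∀ f : Module.End R Z, IsUnit f ∨ IsUnit (1 - f)) {ι : Type} (s : Finset ι)
    (f : ι → Module.End R Z) : IsUnit (∑ i ∈ s, f i) → ∃ i, IsUnit (f i) := by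
  classical
  induction s using Finset.induction_on with
  | empty => intro hs; simp at hs
  | insert a s ha ih =>
    intro hs
    rw [Finset.sum_insert ha] at hs
    obtain ⟨u, hu⟩ := hs
    rcases h (↑u⁻¹ * f a) with h1 | h1
    · exact ⟨a, by simpa using h1⟩
    · refine ih ?_
      have : (1 - ↑u⁻¹ * f a : Module.End R Z) = ↑u⁻¹ * ∑ i ∈ s, f i := by
        rw [← u.inv_mul, hu]; simp [mul_add]
      rw [this] at h1
      simpa using h1
theorem exists_local_summand (M : Type) [AddCommGroup M] [Module R M] [IsArtinian R M]
    [IsNoetherian R M] [Nontrivial M] : ∃ Z W : Submodule R M, IsCompl Z W ∧ Nontrivial Z ∧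
      ∀ f : Module.End R Z, IsUnit f ∨ IsUnit (1 - f) := by
  obtain ⟨Z, ⟨hZ0, W, hZW⟩, hmin⟩ := (wellFounded_lt (α := Submodule R M)).has_min
    {Z : Submodule R M | Z ≠ ⊥ ∧ ∃ W, IsCompl Z W} ⟨⊤, top_ne_bot, ⊥, isCompl_top_bot⟩
  refine ⟨Z, W, hZW, Submodule.nontrivial_iff_ne_bot.mpr hZ0, fun f => ?_⟩
  obtain ⟨n, hn, hn1⟩ := (f.eventually_isCompl_ker_pow_range_pow.and
    (Filter.eventually_ge_atTop 1)).exists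
  set A := (ker (f ^ n)).map Z.subtype with hA
  set B := (range (f ^ n)).map Z.subtype with hB
  have hAB : A ⊔ B = Z := by
    rw [hA, hB, ← Submodule.map_sup, hn.sup_eq_top, Submodule.map_subtype_top]
  have hdis : Disjoint A B := by
    rw [disjoint_iff, hA, hB, ← Submodule.map_inf _ Z.injective_subtype, hn.inf_eq_bot,
      Submodule.map_bot]
  by_cases hb : ker (f ^ n) = ⊥
  · left
    have hinj : Function.Injective f := by
      have h1 : Function.Injective (f ^ n) := LinearMap.ker_eq_bot.mp hb
      obtain ⟨m, rfl⟩ : ∃ m, n = m + 1 := ⟨n - 1, by omega⟩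
      rw [pow_succ] at h1
      exact Function.Injective.of_comp (f := (f ^ m)) h1
    exact (Module.End.isUnit_iff _).mpr (IsArtinian.bijective_of_injective_endomorphism f hinj)
  · right
    have hA0 : A ≠ ⊥ := by
      intro h0
      apply hb
      apply Submodule.map_injective_of_injective Z.injective_subtype
      rw [Submodule.map_bot, ← h0]
    have hc : IsCompl A (B ⊔ W) := by
      constructor
      · exact hdis.disjoint_sup_right_of_disjoint_sup_left (by rw [hAB]; exact hZW.disjoint)
      · rw [codisjoint_iff, ← sup_assoc, hAB]; exact hZW.sup_eq_top
    have hle : A ≤ Z := by rw [← hAB]; exact le_sup_left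
    have hAZ : A = Z := by
      by_contra hne
      exact hmin A ⟨hA0, _, hc⟩ (lt_of_le_of_ne hle hne)
    have hk : ker (f ^ n) = ⊤ := by
      apply Submodule.map_injective_of_injective Z.injective_subtype
      rw [Submodule.map_subtype_top]; exact hAZ
    have : IsNilpotent f := ⟨n, LinearMap.ker_eq_top.mp hk⟩
    exact this.isUnit_one_sub
theorem retract_split {Z C : Type} [AddCommGroup Z] [Module R Z] [AddCommGroup C] [Module R C]
    (u : Z →ₗ[R] C) (v : C →ₗ[R] Z) (h : IsUnit (v ∘ₗ u : Module.End R Z)) :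
    ∃ C' : Submodule R C, Nonempty (C ≃ₗ[R] (Z × C')) := by
  obtain ⟨w, hw⟩ := h
  have hp : ∀ z, v (u ((↑w⁻¹ : Module.End R Z) z)) = z := fun z => by
    have := congrArg (fun f : Module.End R Z => f z) w.mul_inv
    rw [hw] at this; simpa using this
  have h1 : v ∘ₗ (u ∘ₗ (↑w⁻¹ : Module.End R Z)) = LinearMap.id := by ext z; simp [hp]
  have hc := LinearMap.isCompl_of_proj (f := (LinearMap.rangeRestrict (u ∘ₗ (↑w⁻¹ : Module.End R Z))) ∘ₗ v)
    (p := range (u ∘ₗ (↑w⁻¹ : Module.End R Z))) (by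
      rintro ⟨_, z, rfl⟩; ext; simp [hp])
  have hinj : Function.Injective (u ∘ₗ (↑w⁻¹ : Module.End R Z)) := fun a b hab => by
    have := congrArg v hab
    simpa [hp] using this
  exact ⟨_, ⟨(Submodule.prodEquivOfIsCompl _ _ hc).symm.trans
    ((LinearEquiv.ofInjective _ hinj).symm.prodCongr (LinearEquiv.refl R _))⟩⟩
theorem ks_step {M N C M' N' : Type} [AddCommGroup M] [Module R M] [AddCommGroup N] [Module R N]
    [AddCommGroup C] [Module R C] [AddCommGroup M'] [Module R M'] [AddCommGroup N'] [Module R N']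
    [IsArtinian R M'] [IsNoetherian R M'] [Nontrivial M']
    (eM : M ≃ₗ[R] (C × M')) (eN : N ≃ₗ[R] (C × N'))
    (hb : ∀ (Z X : Type) [AddCommGroup Z] [Module R Z] [AddCommGroup X] [Module R X],
      (M ≃ₗ[R] ((Z × Z) × X)) → Subsingleton Z)
    {k : ℕ} (g : M →ₗ[R] (Fin k → N)) (h : (Fin k → N) →ₗ[R] M) (hgh : h ∘ₗ g = LinearMap.id) :
    ∃ (Z W : Submodule R M') (N'' : Submodule R N'), Nontrivial Z ∧ Nonempty (M' ≃ₗ[R] (Z × W)) ∧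
      Nonempty (N' ≃ₗ[R] (Z × N'')) := by
  obtain ⟨Z, W, hZW, hZ, hloc⟩ := exists_local_summand (R := R) M'
  set eZ := (Submodule.prodEquivOfIsCompl _ _ hZW).symm with heZ
  set i : Z →ₗ[R] M := eM.symm.toLinearMap ∘ₗ LinearMap.inr R C M' ∘ₗ eZ.symm.toLinearMap ∘ₗ LinearMap.inl R Z W with hi
  set p : M →ₗ[R] Z := LinearMap.fst R Z W ∘ₗ eZ.toLinearMap ∘ₗ LinearMap.snd R C M' ∘ₗ eM.toLinearMap with hp
  have hpi : ∀ z, p (i z) = z := fun z => by simp [hp, hi]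
  have hgh' : ∀ m, h (g m) = m := fun m => congrArg (fun f : M →ₗ[R] M => f m) hgh
  let T : Fin k ⊕ Fin k → Module.End R Z := Sum.elim
    (fun j => (p ∘ₗ h ∘ₗ LinearMap.single R (fun _ : Fin k => N) j ∘ₗ eN.symm.toLinearMap ∘ₗ LinearMap.inl R C N') ∘ₗ
      (LinearMap.fst R C N' ∘ₗ eN.toLinearMap ∘ₗ LinearMap.proj j ∘ₗ g ∘ₗ i))
    (fun j => (p ∘ₗ h ∘ₗ LinearMap.single R (fun _ : Fin k => N) j ∘ₗ eN.symm.toLinearMap ∘ₗ LinearMap.inr R C N') ∘ₗ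
      (LinearMap.snd R C N' ∘ₗ eN.toLinearMap ∘ₗ LinearMap.proj j ∘ₗ g ∘ₗ i))
  have hsum : ∑ j, T j = 1 := by
    ext1 z
    rw [Fintype.sum_sum_type, ← Finset.sum_add_distrib, LinearMap.sum_apply]
    have : ∀ j : Fin k, (T (Sum.inl j) + T (Sum.inr j)) z = p (h (Pi.single j (g (i z) j))) := by
      intro j
      simp only [T, Sum.elim_inl, Sum.elim_inr, LinearMap.add_apply, LinearMap.comp_apply, ← map_add]
      simp
    simp only [this, ← map_sum]
    rw [Finset.univ_sum_single, hgh', hpi]; rfl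
  obtain ⟨j, hj⟩ := local_sum hloc Finset.univ T (by rw [hsum]; exact isUnit_one)
  rcases j with j | j
  · exfalso
    obtain ⟨C', ⟨e⟩⟩ := retract_split _ _ hj
    have := hb Z (C' × W) (eM.trans ((e.prodCongr eZ).trans (LinearEquiv.prodProdProdComm R Z C' Z W)))
    exact not_subsingleton Z this
  · obtain ⟨N'', ⟨e⟩⟩ := retract_split _ _ hj
    exact ⟨Z, W, N'', hZ, ⟨eZ⟩, ⟨e⟩⟩
theorem ks_iso {M N : Type} [AddCommGroup M] [Module R M] [AddCommGroup N] [Module R N]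
    [IsArtinian R M] [IsNoetherian R M] [IsArtinian R N] [IsNoetherian R N]
    (hbM : ∀ (Z X : Type) [AddCommGroup Z] [Module R Z] [AddCommGroup X] [Module R X],
      (M ≃ₗ[R] ((Z × Z) × X)) → Subsingleton Z)
    (hbN : ∀ (Z X : Type) [AddCommGroup Z] [Module R Z] [AddCommGroup X] [Module R X],
      (N ≃ₗ[R] ((Z × Z) × X)) → Subsingleton Z)
    {k : ℕ} (g : M →ₗ[R] (Fin k → N)) (h : (Fin k → N) →ₗ[R] M) (hgh : h ∘ₗ g = LinearMap.id)
    {l : ℕ} (g' : N →ₗ[R] (Fin l → M)) (h' : (Fin l → M) →ₗ[R] N) (hgh' : h' ∘ₗ g' = LinearMap.id) :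
    Nonempty (M ≃ₗ[R] N) := by
  suffices H : ∀ (n : ℕ) (C M' N' : Type) [AddCommGroup C] [Module R C] [AddCommGroup M']
      [Module R M'] [AddCommGroup N'] [Module R N'], (M ≃ₗ[R] (C × M')) → (N ≃ₗ[R] (C × N')) →
      (Module.length R M').toNat ≤ n → Nonempty (M ≃ₗ[R] N) by
    have z1 : M ≃ₗ[R] (PUnit.{1} × M) := LinearEquiv.symm (LinearEquiv.uniqueProd)
    have z2 : N ≃ₗ[R] (PUnit.{1} × N) := LinearEquiv.symm (LinearEquiv.uniqueProd)
    exact H _ PUnit M N z1 z2 le_rfl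
  have fin : ∀ {A B C : Type} [AddCommGroup A] [Module R A] [AddCommGroup B] [Module R B]
      [AddCommGroup C] [Module R C] [IsArtinian R A] [IsNoetherian R A] (_ : A ≃ₗ[R] (B × C)),
      IsArtinian R C ∧ IsNoetherian R C := by
    intro A B C _ _ _ _ _ _ _ _ e
    have hs : Function.Surjective (LinearMap.snd R B C ∘ₗ e.toLinearMap) :=
      (LinearMap.snd_surjective (R := R) (M := B) (M₂ := C)).comp e.surjective
    exact ⟨isArtinian_of_surjective _ _ hs, isNoetherian_of_surjective _ (LinearMap.range_eq_top.mpr hs)⟩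
  intro n
  induction n with
  | zero =>
    intro C M' N' _ _ _ _ _ _ eM eN hn
    obtain ⟨_, _⟩ := fin eM
    obtain ⟨_, _⟩ := fin eN
    have hM' : Subsingleton M' := by
      by_contra hM
      rw [not_subsingleton_iff_nontrivial] at hM
      have h1 := Module.length_pos (R := R) (M := M')
      have h2 := Module.length_ne_top (R := R) (M := M')
      have := (ENat.toNat_eq_zero.mp (Nat.le_zero.mp hn))
      rcases this with h | h
      · exact h1.ne' h
      · exact h2 h
    have hN' : Subsingleton N' := by
      by_contra hM
      rw [not_subsingleton_iff_nontrivial] at hM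
      obtain ⟨Z, W, N'', hZ, -, ⟨e⟩⟩ := ks_step eN eM hbN g' h' hgh'
      obtain ⟨a, b, hab⟩ := hZ
      apply hab
      have := e.symm.injective (Subsingleton.elim (e.symm (a, 0)) (e.symm (b, 0)))
      exact (Prod.ext_iff.mp this).1
    have : Unique M' := ⟨⟨0⟩, fun _ => Subsingleton.elim _ _⟩
    have : Unique N' := ⟨⟨0⟩, fun _ => Subsingleton.elim _ _⟩
    exact ⟨(eM.trans LinearEquiv.prodUnique).trans (eN.trans LinearEquiv.prodUnique).symm⟩
  | succ n ih =>
    intro C M' N' _ _ _ _ _ _ eM eN hn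
    obtain ⟨_, _⟩ := fin eM
    by_cases hM : Nontrivial M'
    · obtain ⟨Z, W, N'', hZ, ⟨e1⟩, ⟨e2⟩⟩ := ks_step eM eN hbM g h hgh
      refine ih (C × Z) W N'' (eM.trans (((LinearEquiv.refl R C).prodCongr e1).trans (LinearEquiv.prodAssoc R C Z W).symm))
        (eN.trans (((LinearEquiv.refl R C).prodCongr e2).trans (LinearEquiv.prodAssoc R C Z N'').symm)) ?_
      have h1 := Module.length_pos (R := R) (M := Z)
      have h2 := Module.length_ne_top (R := R) (M := M')
      have h3 := e1.length_eq
      rw [Module.length_prod] at h3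
      have h4 : Module.length R Z ≠ ⊤ := fun hh => h2 (by rw [h3, hh, top_add])
      have h5 : Module.length R W ≠ ⊤ := fun hh => h2 (by rw [h3, hh, add_top])
      have h6 := congrArg ENat.toNat h3
      rw [ENat.toNat_add h4 h5] at h6
      have : 0 < (Module.length R Z).toNat := by
        rw [Nat.pos_iff_ne_zero, Ne, ENat.toNat_eq_zero]
        push Not
        exact ⟨h1.ne', h4⟩
      omega
    · rw [not_nontrivial_iff_subsingleton] at hM
      exact ih C M' N' eM eN (by rw [Module.length_eq_zero]; simp)
end KS
section Fac
variable {R : Type} [Ring R]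
def Fac (R : Type) [Ring R] (N X : Type) [AddCommGroup N] [Module R N] [AddCommGroup X] [Module R X] : Prop :=
  ∃ (ι : Type) (_ : Fintype ι) (p : (ι → N) →ₗ[R] X), Function.Surjective p
theorem Fac.surj {N X Y : Type} [AddCommGroup N] [Module R N] [AddCommGroup X] [Module R X]
    [AddCommGroup Y] [Module R Y] (h : Fac R N X) (f : X →ₗ[R] Y) (hf : Function.Surjective f) :
    Fac R N Y := by
  obtain ⟨ι, _, p, hp⟩ := h
  exact ⟨ι, inferInstance, f ∘ₗ p, hf.comp hp⟩
theorem Fac.refl (N : Type) [AddCommGroup N] [Module R N] : Fac R N N :=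
  ⟨Unit, inferInstance, LinearMap.proj (), fun x => ⟨fun _ => x, rfl⟩⟩
theorem Fac.trans {N X Y : Type} [AddCommGroup N] [Module R N] [AddCommGroup X] [Module R X]
    [AddCommGroup Y] [Module R Y] (h : Fac R N X) (h' : Fac R X Y) : Fac R N Y := by
  obtain ⟨ι, _, p, hp⟩ := h
  obtain ⟨κ, _, q, hq⟩ := h'
  refine ⟨κ × ι, inferInstance, q ∘ₗ LinearMap.pi (fun k => p ∘ₗ LinearMap.pi (fun i => LinearMap.proj (k, i))), ?_⟩
  intro y
  obtain ⟨x, rfl⟩ := hq y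
  choose g hg using fun k => hp (x k)
  refine ⟨fun ki => g ki.1 ki.2, ?_⟩
  simp only [LinearMap.comp_apply]
  congr 1
  ext k
  exact hg k
structure TRP (R : Type) [Ring R] (N : Type) [AddCommGroup N] [Module R N] where
  (P₁ P₀ : Type)
  [i1 : AddCommGroup P₁] [i2 : Module R P₁] [i3 : AddCommGroup P₀] [i4 : Module R P₀]
  (f : P₁ →ₗ[R] P₀) (g : P₀ →ₗ[R] N)
  (p1 : Module.Projective R P₁) (p0 : Module.Projective R P₀)
  (f1 : Module.Finite R P₁) (f0 : Module.Finite R P₀)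
  (hg : Function.Surjective g) (ex : Function.Exact f g)
  (ext : ∀ h : P₁ →ₗ[R] N, ∃ k : P₀ →ₗ[R] N, k ∘ₗ f = h)
attribute [instance] TRP.i1 TRP.i2 TRP.i3 TRP.i4 TRP.p1 TRP.p0 TRP.f1 TRP.f0
theorem TRP.ext' {N A : Type} [AddCommGroup N] [Module R N] [AddCommGroup A] [Module R A]
    (T : TRP R N) (h : ∀ u : T.P₁ →ₗ[R] N, ∃ k : T.P₀ →ₗ[R] N, k ∘ₗ T.f = u)
    (hA : Fac R N A) (u : T.P₁ →ₗ[R] A) : ∃ k : T.P₀ →ₗ[R] A, k ∘ₗ T.f = u := by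
  obtain ⟨ι, _, p, hp⟩ := hA
  obtain ⟨v, hv⟩ := Module.projective_lifting_property p u hp
  choose k hk using fun i => h (LinearMap.proj i ∘ₗ v)
  refine ⟨p ∘ₗ LinearMap.pi k, ?_⟩
  rw [← hv]
  ext x
  simp only [LinearMap.comp_apply]
  congr 1
  ext i
  exact congrArg (fun f : T.P₁ →ₗ[R] N => f x) (hk i)
theorem TRP.lift {N Y : Type} [AddCommGroup N] [Module R N] [AddCommGroup Y] [Module R Y]
    (T : TRP R N) (A : Submodule R Y) (hA : Fac R N A) (u : N →ₗ[R] Y ⧸ A) :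
    ∃ v : N →ₗ[R] Y, A.mkQ ∘ₗ v = u := by
  obtain ⟨w, hw⟩ := Module.projective_lifting_property A.mkQ (u ∘ₗ T.g) A.mkQ_surjective
  have hw' : ∀ x, A.mkQ (w x) = u (T.g x) := fun x => congrArg (fun f : T.P₀ →ₗ[R] Y ⧸ A => f x) hw
  have hmem : ∀ x, (w ∘ₗ T.f) x ∈ A := fun x => by
    rw [← Submodule.Quotient.mk_eq_zero]
    have := hw' (T.f x)
    rw [T.ex.apply_apply_eq_zero, map_zero] at this
    exact this
  obtain ⟨k, hk⟩ := T.ext' T.ext hA (LinearMap.codRestrict A (w ∘ₗ T.f) hmem)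
  have hk' : ∀ x, (k (T.f x) : Y) = w (T.f x) := fun x =>
    congrArg (fun f : T.P₁ →ₗ[R] A => (f x : Y)) hk
  let d : T.P₀ →ₗ[R] Y := w - A.subtype ∘ₗ k
  have hker : ker T.g ≤ ker d := by
    intro x hx
    obtain ⟨y, rfl⟩ := (T.ex x).mp hx
    simp [d, hk']
  refine ⟨(ker T.g).liftQ d hker ∘ₗ (T.g.quotKerEquivOfSurjective T.hg).symm.toLinearMap, ?_⟩
  ext n
  obtain ⟨x, rfl⟩ := T.hg n
  have : (T.g.quotKerEquivOfSurjective T.hg).symm (T.g x) = Submodule.Quotient.mk x := by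
    rw [LinearEquiv.symm_apply_eq]; rfl
  simp only [LinearMap.comp_apply, LinearEquiv.coe_coe, this, Submodule.liftQ_apply, d,
    LinearMap.sub_apply, map_sub, hw', Submodule.subtype_apply]
  simp
theorem TRP.fac_ext {N Y : Type} [AddCommGroup N] [Module R N] [AddCommGroup Y] [Module R Y]
    (T : TRP R N) (A : Submodule R Y) (hA : Fac R N A) (hB : Fac R N (Y ⧸ A)) : Fac R N Y := by
  classical
  obtain ⟨ι, _, p, hp⟩ := id hA
  obtain ⟨κ, _, q, hq⟩ := hB
  choose v hv using fun k => T.lift A hA (q ∘ₗ LinearMap.single R (fun _ : κ => N) k)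
  refine ⟨ι ⊕ κ, inferInstance, (A.subtype ∘ₗ p ∘ₗ LinearMap.funLeft R N Sum.inl) +
    (∑ k, v k ∘ₗ LinearMap.proj k) ∘ₗ LinearMap.funLeft R N Sum.inr, fun y => ?_⟩
  obtain ⟨b, hb⟩ := hq (A.mkQ y)
  have h1 : A.mkQ ((∑ k, v k ∘ₗ LinearMap.proj k) b) = A.mkQ y := by
    rw [← hb, LinearMap.sum_apply, map_sum]
    have : ∀ k, A.mkQ ((v k ∘ₗ LinearMap.proj k) b) = q (Pi.single k (b k)) := fun k =>
      congrArg (fun f : N →ₗ[R] Y ⧸ A => f (b k)) (hv k)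
    simp only [this, ← map_sum]
    rw [Finset.univ_sum_single]
  have h2 : y - (∑ k, v k ∘ₗ LinearMap.proj k) b ∈ A := by
    rw [← Submodule.Quotient.mk_eq_zero]
    change A.mkQ _ = 0
    rw [map_sub, h1, sub_self]
  obtain ⟨a, ha⟩ := hp ⟨_, h2⟩
  refine ⟨Sum.elim a b, ?_⟩
  have e1 : LinearMap.funLeft R N Sum.inl (Sum.elim a b) = a := rfl
  have e2 : LinearMap.funLeft R N Sum.inr (Sum.elim a b) = b := rfl
  simp only [LinearMap.add_apply, LinearMap.comp_apply, e1, e2, ha, Submodule.subtype_apply]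
  simp
def BrickMod (R : Type) [Ring R] (Y : Type) [AddCommGroup Y] [Module R Y] : Prop :=
  Nontrivial Y ∧ ∀ φ : Y →ₗ[R] Y, φ ≠ 0 → Function.Injective φ
theorem exists_brick {N X : Type} [AddCommGroup N] [Module R N] [AddCommGroup X] [Module R X]
    [IsNoetherian R X] (T : TRP R N) (hX : ¬ Fac R N X) :
    ∃ U : Submodule R X, BrickMod R (X ⧸ U) ∧ ¬ Fac R N (X ⧸ U) := by
  obtain ⟨U, hU, hmax⟩ := (wellFounded_gt (α := Submodule R X)).has_min
    {U : Submodule R X | ¬ Fac R N (X ⧸ U)} ⟨⊥, fun h => hX (h.surj _ (Submodule.quotEquivOfEqBot ⊥ rfl).surjective)⟩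
  have hq : ∀ V : Submodule R (X ⧸ U), V ≠ ⊥ → Fac R N ((X ⧸ U) ⧸ V) := by
    intro V hV
    by_contra hc
    have hle : U ≤ V.comap U.mkQ := by
      intro x hx
      have : U.mkQ x = 0 := (Submodule.Quotient.mk_eq_zero U).mpr hx
      simp [this]
    refine hmax (V.comap U.mkQ) (fun h => hc ?_) (lt_of_le_of_ne hle ?_)
    · refine h.surj ((V.comap U.mkQ).liftQ (V.mkQ ∘ₗ U.mkQ) ?_) ?_
      · intro x hx
        simpa using hx
      · intro y
        obtain ⟨y, rfl⟩ := V.mkQ_surjective y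
        obtain ⟨y, rfl⟩ := U.mkQ_surjective y
        exact ⟨Submodule.Quotient.mk y, rfl⟩
    · intro he
      apply hV
      rw [eq_bot_iff]
      intro y hy
      obtain ⟨y, rfl⟩ := U.mkQ_surjective y
      have : y ∈ U := by rw [he]; exact hy
      exact (Submodule.Quotient.mk_eq_zero U).mpr this
  refine ⟨U, ⟨?_, ?_⟩, hU⟩
  · by_contra hn
    rw [not_nontrivial_iff_subsingleton] at hn
    exact hU ⟨Unit, inferInstance, 0, fun y => ⟨0, Subsingleton.elim _ _⟩⟩
  · intro φ hφ
    by_contra hinj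
    have hk : ker φ ≠ ⊥ := fun h => hinj (LinearMap.ker_eq_bot.mp h)
    have hr : range φ ≠ ⊥ := fun h => hφ (LinearMap.range_eq_bot.mp h)
    exact hU (T.fac_ext (range φ)
      ((hq _ hk).surj _ φ.quotKerEquivRange.surjective) (hq _ hr))
theorem TRP.sum {M N : Type} [AddCommGroup M] [Module R M] [AddCommGroup N] [Module R N]
    (S : TRP R M) (T : TRP R N) (h1 : Fac R M N) (h2 : Fac R N M) : Nonempty (TRP R (M × N)) := by
  refine ⟨{ P₁ := S.P₁ × T.P₁, P₀ := S.P₀ × T.P₀, f := S.f.prodMap T.f, g := S.g.prodMap T.g,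
            p1 := inferInstance, p0 := inferInstance, f1 := inferInstance, f0 := inferInstance,
            hg := ?_, ex := ?_, ext := ?_ }⟩
  · rintro ⟨x, y⟩
    obtain ⟨a, rfl⟩ := S.hg x
    obtain ⟨b, rfl⟩ := T.hg y
    exact ⟨(a, b), rfl⟩
  · rintro ⟨x, y⟩
    constructor
    · intro h
      simp only [LinearMap.prodMap_apply, Prod.mk_eq_zero] at h
      obtain ⟨a, rfl⟩ := (S.ex x).mp h.1
      obtain ⟨b, rfl⟩ := (T.ex y).mp h.2
      exact ⟨(a, b), rfl⟩
    · rintro ⟨⟨a, b⟩, hab⟩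
      simp only [LinearMap.prodMap_apply, Prod.mk.injEq] at hab
      obtain ⟨rfl, rfl⟩ := hab
      simp [S.ex.apply_apply_eq_zero, T.ex.apply_apply_eq_zero]
  · have key : ∀ {A B : Type} [AddCommGroup A] [Module R A] [AddCommGroup B] [Module R B],
        Fac R M A → Fac R M B → Fac R M (A × B) := by
      intro A B _ _ _ _ ⟨ι, _, p, hp⟩ ⟨κ, _, q, hq⟩
      refine ⟨ι ⊕ κ, inferInstance, (p ∘ₗ LinearMap.funLeft R M Sum.inl).prod (q ∘ₗ LinearMap.funLeft R M Sum.inr), ?_⟩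
      rintro ⟨x, y⟩
      obtain ⟨a, rfl⟩ := hp x
      obtain ⟨b, rfl⟩ := hq y
      exact ⟨Sum.elim a b, rfl⟩
    have hM : Fac R M (M × N) := key (Fac.refl M) h1
    have hN : Fac R N (M × N) := h2.trans hM
    intro h
    obtain ⟨k1, hk1⟩ := S.ext' S.ext hM (h ∘ₗ LinearMap.inl R _ _)
    obtain ⟨k2, hk2⟩ := T.ext' T.ext hN (h ∘ₗ LinearMap.inr R _ _)
    refine ⟨k1.coprod k2, ?_⟩
    apply LinearMap.prod_ext
    · rw [← hk1]; ext x <;> simp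
    · rw [← hk2]; ext x <;> simp
theorem trp_of_rigid {M : ModCat R} (h : IsTauRigidMod M) : Nonempty (TRP R M) := by
  obtain ⟨P₁, P₀, f, g, hp1, hp0, hf1, hf0, hs, he, hx⟩ := h
  refine ⟨{ P₁ := P₁, P₀ := P₀, f := f.hom, g := g.hom, p1 := ?_, p0 := ?_, f1 := hf1, f0 := hf0, hg := hs, ex := he, ext := ?_ }⟩
  · exact (IsProjective.iff_projective P₁).mpr hp1
  · exact (IsProjective.iff_projective P₀).mpr hp0
  · intro h
    obtain ⟨k, hk⟩ := hx (ModuleCat.ofHom h)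
    exact ⟨k.hom, congrArg ModuleCat.Hom.hom hk⟩
theorem rigid_of_trp {M : ModCat R} {M' : Type} [AddCommGroup M'] [Module R M'] (e : M' ≃ₗ[R] M) (T : TRP R M') : IsTauRigidMod M := by
  refine ⟨ModuleCat.of R T.P₁, ModuleCat.of R T.P₀, ModuleCat.ofHom T.f, ModuleCat.ofHom (e.toLinearMap ∘ₗ T.g),
    (IsProjective.iff_projective _).mp T.p1, (IsProjective.iff_projective _).mp T.p0, T.f1, T.f0, ?_, ?_, ?_⟩
  · exact e.surjective.comp T.hg
  · intro x
    exact (e.map_eq_zero_iff (x := T.g x)).trans (T.ex x)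
  · intro h
    obtain ⟨k, hk⟩ := T.ext (e.symm.toLinearMap ∘ₗ h.hom)
    refine ⟨ModuleCat.ofHom (e.toLinearMap ∘ₗ k), ?_⟩
    ext x
    have := congrArg (fun f : T.P₁ →ₗ[R] M' => e (f x)) hk
    simpa using this
theorem mem_add_of_fac {M N : ModCat R} (hM : IsSupportTauTiltingMod M) (hN : IsSupportTauTiltingMod N)
    (h1 : Fac R M N) (h2 : Fac R N M) : MemAddMod N M := by
  obtain ⟨P, ⟨hfM, hrM, hfP, hpP, h0⟩, hmax⟩ := hM
  obtain ⟨_, ⟨hfN, hrN, _⟩, _⟩ := hN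
  obtain ⟨S⟩ := trp_of_rigid hrM
  obtain ⟨T⟩ := trp_of_rigid hrN
  obtain ⟨U⟩ := S.sum T h1 h2
  have e := (ModuleCat.biprodIsoProd M N).toLinearEquiv
  have : Module.Finite R M := hfM
  have : Module.Finite R N := hfN
  have : Module.Finite R P := hfP
  let Q := ModuleCat.of R PUnit.{1}
  have eP := (ModuleCat.biprodIsoProd P Q).toLinearEquiv
  refine (hmax N Q ⟨?_, rigid_of_trp e.symm U, ?_, ?_, ?_⟩).1
  · exact Module.Finite.equiv e.symm
  · exact Module.Finite.equiv eP.symm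
  · have : Projective Q := (IsZero.of_iso (isZero_zero _) (ModuleCat.isZero_of_subsingleton Q).isoZero).projective
    infer_instance
  · intro f
    have hz : ∀ u : P ⟶ N, u = 0 := by
      intro u
      have : Module.Projective R P := (IsProjective.iff_projective P).mpr hpP
      obtain ⟨ι, _, p, hp⟩ := h1
      obtain ⟨v, hv⟩ := Module.projective_lifting_property p u.hom hp
      ext x
      have hv' := congrArg (fun f : P →ₗ[R] N => f x) hv
      have : v x = 0 := by
        ext i
        have := congrArg (fun f : P ⟶ M => f x) (h0 (ModuleCat.ofHom (LinearMap.proj i ∘ₗ v)))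
        simpa using this
      simp only [LinearMap.comp_apply, this, map_zero] at hv'
      rw [← hv']; rfl
    apply biprod.hom_ext'
    · apply biprod.hom_ext
      · rw [h0 ((biprod.inl ≫ f) ≫ biprod.fst)]; simp
      · rw [hz ((biprod.inl ≫ f) ≫ biprod.snd)]; simp
    · exact (ModuleCat.isZero_of_subsingleton Q).eq_of_src _ _
theorem basic_conv {M : ModCat R} (h : IsBasicMod M) (Z X : Type) [AddCommGroup Z] [Module R Z]
    [AddCommGroup X] [Module R X] (e : M ≃ₗ[R] ((Z × Z) × X)) : Subsingleton Z := by
  have i1 := (ModuleCat.biprodIsoProd (ModuleCat.of R Z) (ModuleCat.of R Z)).toLinearEquiv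
  have i2 := (ModuleCat.biprodIsoProd (ModuleCat.of R Z ⊞ ModuleCat.of R Z) (ModuleCat.of R X)).toLinearEquiv
  have := h (ModuleCat.of R Z) (ModuleCat.of R X)
    ⟨(e.trans ((i2.trans (i1.prodCongr (LinearEquiv.refl R X))).symm)).toModuleIso⟩
  exact ModuleCat.subsingleton_of_isZero this
theorem mem_add_conv {N M : ModCat R} (h : MemAddMod N M) : ∃ (k : ℕ) (g : N →ₗ[R] (Fin k → M))
    (h : (Fin k → M) →ₗ[R] N), h ∘ₗ g = LinearMap.id := by
  obtain ⟨k, g, h, hgh⟩ := h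
  have e := (ModuleCat.biproductIsoPi (fun _ : Fin k => M))
  refine ⟨k, (g ≫ e.hom).hom, (e.inv ≫ h).hom, ?_⟩
  have : (g ≫ e.hom) ≫ (e.inv ≫ h) = 𝟙 N := by simp [hgh]
  exact congrArg ModuleCat.Hom.hom this
theorem tau_finite_of_bricks [IsArtinianRing R] [IsNoetherianRing R] (n : ℕ) (B : Fin n → ModCat R)
    (hB : ∀ Y : ModCat R, Module.Finite R Y → BrickMod R Y → ∃ i, Nonempty (Y ≃ₗ[R] B i)) :
    IsTauTiltingFiniteRing R := by
  classical
  have key : ∀ M N : ModCat R, IsSupportTauTiltingMod M → IsSupportTauTiltingMod N →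
      (∀ i, Fac R M (B i) → Fac R N (B i)) → Fac R N M := by
    intro M N hM hN h
    by_contra hc
    obtain ⟨_, ⟨hfM, _⟩, _⟩ := hM
    obtain ⟨_, ⟨_, hrN, _⟩, _⟩ := hN
    obtain ⟨T⟩ := trp_of_rigid hrN
    have : Module.Finite R M := hfM
    obtain ⟨U, hU, hU'⟩ := exists_brick T hc
    obtain ⟨i, ⟨e⟩⟩ := hB (ModuleCat.of R (M ⧸ U)) (inferInstanceAs (Module.Finite R (M ⧸ U))) hU
    have h1 : Fac R M (B i) := ((Fac.refl M).surj U.mkQ U.mkQ_surjective).surj e.toLinearMap e.surjective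
    exact hU' ((h i h1).surj e.symm.toLinearMap e.symm.surjective)
  let P : Set (Fin n) → ModCat R → Prop := fun s M =>
    IsSupportTauTiltingMod M ∧ IsBasicMod M ∧ ∀ i, i ∈ s ↔ Fac R M (B i)
  let F : Set (Fin n) → ModCat R := fun s => if h : ∃ M, P s M then h.choose else ModuleCat.of R PUnit
  obtain ⟨m, ⟨eq⟩⟩ := Finite.exists_equiv_fin (Set (Fin n))
  refine ⟨m, fun j => F (eq.symm j), fun M hM hb => ⟨eq {i | Fac R M (B i)}, ?_⟩⟩
  have hex : ∃ N, P {i | Fac R M (B i)} N := ⟨M, hM, hb, fun i => Iff.rfl⟩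
  have hF : F {i | Fac R M (B i)} = hex.choose := dif_pos hex
  beta_reduce
  rw [Equiv.symm_apply_apply, hF]
  obtain ⟨hN, hbN, hs⟩ := hex.choose_spec
  set N := hex.choose
  have h1 : Fac R N M := key M N hM hN fun i hi => (hs i).mp hi
  have h2 : Fac R M N := key N M hN hM fun i hi => (hs i).mpr hi
  obtain ⟨k, g, h, hgh⟩ := mem_add_conv (mem_add_of_fac hM hN h2 h1)
  obtain ⟨k', g', h', hgh'⟩ := mem_add_conv (mem_add_of_fac hN hM h1 h2)
  have : Module.Finite R M := hM.choose_spec.1.1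
  have : Module.Finite R N := hN.choose_spec.1.1
  obtain ⟨e⟩ := ks_iso (basic_conv hb) (basic_conv hbN) g' h' hgh' g h hgh
  exact ⟨e.toModuleIso⟩
end Fac
open Module
section Reps
variable {K : Type} [Field K] {σ τ : Type}
structure Rep (K : Type) [Field K] (σ : Type) where
  E : Type
  [i1 : AddCommGroup E]
  [i2 : Module K E]
  [i3 : FiniteDimensional K E]
  op : σ → Module.End K E
attribute [instance] Rep.i1 Rep.i2 Rep.i3
abbrev Rep.w (M : Rep K σ) (o : τ → End K M.E) : Rep K τ := ⟨M.E, o⟩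
section
variable {E F G : Type} [AddCommGroup E] [Module K E] [AddCommGroup F] [Module K F] [AddCommGroup G] [Module K G]
def Inter (o : σ → End K E) (o' : σ → End K F) (φ : E →ₗ[K] F) : Prop := ∀ s x, φ (o s x) = o' s (φ x)
def Brick (o : σ → End K E) : Prop :=
  Nontrivial E ∧ ∀ φ : End K E, Inter o o φ → φ ≠ 0 → Function.Injective φ
def RIso (o : σ → End K E) (o' : σ → End K F) : Prop := ∃ φ : E →ₗ[K] F, Inter o o' φ ∧ Function.Bijective φ
theorem RIso.symm {o : σ → End K E} {o' : σ → End K F} (h : RIso o o') : RIso o' o := by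
  obtain ⟨φ, h, hb⟩ := h
  let e := LinearEquiv.ofBijective φ hb
  refine ⟨e.symm.toLinearMap, fun s x => e.injective ?_, e.symm.bijective⟩
  have := h s (e.symm x)
  have h2 : φ (e.symm x) = x := e.apply_symm_apply x
  rw [h2] at this
  exact (e.apply_symm_apply _).trans this.symm
theorem RIso.trans {o : σ → End K E} {o' : σ → End K F} {o'' : σ → End K G} (h : RIso o o') (h' : RIso o' o'') :
    RIso o o'' := by
  obtain ⟨φ, h, hb⟩ := h
  obtain ⟨φ', h', hb'⟩ := h'
  exact ⟨φ' ∘ₗ φ, fun s x => by simp [h s, h' s], hb'.comp hb⟩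
end
def FB (Q : Rep K σ → Prop) : Prop :=
  ∃ L : List (Rep K σ), ∀ M : Rep K σ, Brick M.op → Q M → ∃ N ∈ L, RIso M.op N.op
theorem FB.mono {P Q : Rep K σ → Prop} (h : FB Q) (hh : ∀ M, Brick M.op → P M → Q M) : FB P := by
  obtain ⟨L, hL⟩ := h
  exact ⟨L, fun M hM hP => hL M hM (hh M hM hP)⟩
theorem FB.or {P Q : Rep K σ → Prop} (h : FB P) (h' : FB Q) : FB (fun M => P M ∨ Q M) := by
  obtain ⟨L, hL⟩ := h
  obtain ⟨L', hL'⟩ := h'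
  refine ⟨L ++ L', fun M hM hP => ?_⟩
  rcases hP with hP | hP
  · obtain ⟨N, h, h'⟩ := hL M hM hP
    exact ⟨N, List.mem_append_left _ h, h'⟩
  · obtain ⟨N, h, h'⟩ := hL' M hM hP
    exact ⟨N, List.mem_append_right _ h, h'⟩
theorem FB.union {ι : Type} [Finite ι] {P : ι → Rep K σ → Prop} (h : ∀ i, FB (P i)) : FB (fun M => ∃ i, P i M) := by
  obtain ⟨_⟩ := nonempty_fintype ι
  choose L hL using h
  refine ⟨Finset.univ.toList.flatMap L, fun M hM ⟨i, hP⟩ => ?_⟩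
  obtain ⟨N, h, h'⟩ := hL i M hM hP
  exact ⟨N, List.mem_flatMap.mpr ⟨i, by simp, h⟩, h'⟩
theorem FB.transfer {P : Rep K σ → Prop} {Q : Rep K τ → Prop} (h : FB Q) (W : Rep K σ → Rep K τ → Prop)
    (h1 : ∀ M, Brick M.op → P M → ∃ M', Brick M'.op ∧ Q M' ∧ W M M')
    (h2 : ∀ M N M' N', W M M' → W N N' → RIso M'.op N'.op → RIso M.op N.op) : FB P := by
  classical
  obtain ⟨L, hL⟩ := h
  let G : Rep K τ → Rep K σ := fun N' => if h : ∃ M, ∃ M', W M M' ∧ RIso M'.op N'.op then h.choose else ⟨PUnit, 0⟩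
  refine ⟨L.map G, fun M hM hP => ?_⟩
  obtain ⟨M', hb, hQ, hW⟩ := h1 M hM hP
  obtain ⟨N', hN, hi⟩ := hL M' hb hQ
  refine ⟨G N', List.mem_map_of_mem hN, ?_⟩
  have hex : ∃ M, ∃ M', W M M' ∧ RIso M'.op N'.op := ⟨M, M', hW, hi⟩
  have hG : G N' = hex.choose := dif_pos hex
  rw [hG]
  obtain ⟨M'', hW', hi'⟩ := hex.choose_spec
  exact h2 _ _ _ _ hW hW' (hi.trans hi'.symm)
theorem FB.same {P : Rep K σ → Prop} {Q : Rep K τ → Prop} (h : FB Q) (W : ∀ M : Rep K σ, (τ → End K M.E) → Prop)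
    (h1 : ∀ M, Brick M.op → P M → ∃ o, Q (M.w o) ∧ W M o)
    (h2 : ∀ (M N : Rep K σ) o o' (φ : M.E →ₗ[K] N.E), W M o → W N o' → Inter o o' φ → Inter M.op N.op φ) : FB P := by
  refine h.transfer (fun M M' => ∃ o, W M o ∧ M' = M.w o) (fun M hM hP => ?_) ?_
  · obtain ⟨o, hQ, hW⟩ := h1 M hM hP
    exact ⟨M.w o, ⟨hM.1, fun φ hφ => hM.2 φ (h2 M M o o φ hW hW hφ)⟩, hQ, o, hW, rfl⟩
  · rintro M N _ _ ⟨o, hW, rfl⟩ ⟨o', hW', rfl⟩ ⟨φ, hφ, hb⟩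
    exact ⟨φ, h2 M N o o' φ hW hW' hφ, hb⟩
abbrev tr {E : Type} [AddCommGroup E] [Module K E] (a : End K E) : End K (Dual K E) := LinearMap.dualMap a
theorem dual_key (π : τ → σ) (hπ : Function.Surjective π) (M N : Rep K σ) (ψ : Dual K M.E →ₗ[K] Dual K N.E)
    (hψ : Inter (fun s => tr (M.op (π s))) (fun s => tr (N.op (π s))) ψ) :
    ∃ φ : N.E →ₗ[K] M.E, Inter N.op M.op φ ∧ φ.dualMap = ψ := by
  let eM := evalEquiv K M.E
  let eN := evalEquiv K N.E
  have hφ : ∀ x (f : Dual K M.E), f (eM.symm (ψ.dualMap (eN x))) = ψ f x := fun x f => by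
    rw [apply_evalEquiv_symm_apply]; simp [eN]
  refine ⟨eM.symm.toLinearMap ∘ₗ ψ.dualMap ∘ₗ eN.toLinearMap, fun s x => ?_, ?_⟩
  · obtain ⟨t, rfl⟩ := hπ s
    rw [← sub_eq_zero, ← forall_dual_apply_eq_zero_iff K]
    intro f
    rw [map_sub, sub_eq_zero]
    have := hψ t f
    have h2 := hφ x (f ∘ₗ M.op (π t))
    simp only [LinearMap.comp_apply, LinearEquiv.coe_coe] at h2 ⊢
    rw [h2, hφ]
    exact (LinearMap.congr_fun this x).symm
  · ext f x
    exact hφ x f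
theorem Brick.dual (π : τ → σ) (hπ : Function.Surjective π) {M : Rep K σ} (hM : Brick M.op) :
    Brick (fun s => tr (M.op (π s))) := by
  refine ⟨?_, ?_⟩
  · have := hM.1
    exact inferInstanceAs (Nontrivial (Dual K M.E))
  · intro ψ hψ h0
    obtain ⟨φ, hφ, rfl⟩ := dual_key π hπ M M ψ hψ
    have h0' : φ ≠ 0 := fun h => h0 (by subst h; ext; simp)
    have hi := hM.2 φ hφ h0'
    exact LinearMap.dualMap_injective_of_surjective (LinearMap.injective_iff_surjective.mp hi)
theorem FB.dual {P : Rep K σ → Prop} {Q : Rep K τ → Prop} (h : FB Q) (π : τ → σ) (hπ : Function.Surjective π)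
    (h1 : ∀ M, Brick M.op → P M → Q ⟨Dual K M.E, fun s => tr (M.op (π s))⟩) : FB P := by
  refine h.transfer (fun M M' => M' = ⟨Dual K M.E, fun s => tr (M.op (π s))⟩) (fun M hM hP => ⟨_, hM.dual π hπ, h1 M hM hP, rfl⟩) ?_
  rintro M N _ _ rfl rfl ⟨ψ, hψ, hb⟩
  obtain ⟨φ, hφ, rfl⟩ := dual_key π hπ M N ψ hψ
  exact RIso.symm ⟨φ, hφ, LinearMap.dualMap_bijective_iff.mp hb⟩
theorem FB.one [Finite σ] : FB (fun M : Rep K σ => finrank K M.E = 1 ∧ ∀ s, M.op s = 0 ∨ M.op s = 1) := by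
  classical
  refine FB.mono (FB.union (ι := Set σ) (P := fun S M => finrank K M.E = 1 ∧ ∀ s, M.op s = if s ∈ S then 1 else 0) ?_) ?_
  · intro S
    refine ⟨[⟨K, fun s => if s ∈ S then 1 else 0⟩], fun M _ hM => ⟨_, List.mem_singleton_self _, ?_⟩⟩
    have e := LinearEquiv.ofFinrankEq M.E K (hM.1.trans (finrank_self K).symm)
    refine ⟨e.toLinearMap, fun s x => ?_, e.bijective⟩
    have h1 := hM.2 s
    by_cases hs : s ∈ S
    · rw [if_pos hs] at h1; rw [h1]
      exact (LinearMap.congr_fun (if_pos hs : (if s ∈ S then (1 : End K K) else 0) = 1) (e x)).symm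
    · rw [if_neg hs] at h1; rw [h1]
      exact (map_zero e).trans (LinearMap.congr_fun (if_neg hs : (if s ∈ S then (1 : End K K) else 0) = 0) (e x)).symm
  · intro M hM h
    refine ⟨{s | M.op s = 1}, h.1, fun s => ?_⟩
    rcases h.2 s with h | h
    · by_cases h' : M.op s = 1 <;> simp [h', h]
    · simp [h]
theorem rank_one {E : Type} [AddCommGroup E] [Module K E] [FiniteDimensional K E] {o : σ → End K E} (hb : Brick o)
    (f : Dual K E) (hf : f ≠ 0) (v : E) (hv : v ≠ 0)
    (h : ∀ s x, f (o s x) • v = f x • o s v) : finrank K E = 1 := by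
  have h1 : (f.smulRight v : End K E) ≠ 0 := by
    obtain ⟨x, hx⟩ : ∃ x, f x ≠ 0 := by
      by_contra hc; push Not at hc
      exact hf (LinearMap.ext hc)
    intro h0
    have := LinearMap.congr_fun h0 x
    simp [hx, hv] at this
  have h2 := hb.2 (f.smulRight v) (fun s x => by simpa using h s x) h1
  apply finrank_eq_one_iff_of_nonzero' v hv |>.mpr
  intro w
  have h3 : (f.smulRight v : End K E) ((f v) • w) = (f.smulRight v) ((f w) • v) := by
    simp [smul_smul, mul_comm]
  have h4 : f v • w = f w • v := h2 h3
  have h5 : f v ≠ 0 := by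
    intro h0
    apply hv
    apply h2
    simp [h0]
  exact ⟨(f v)⁻¹ * f w, by rw [mul_smul, ← h4, smul_smul, inv_mul_cancel₀ h5, one_smul]⟩
theorem exists_dual {E : Type} [AddCommGroup E] [Module K E] (U : Submodule K E) (x : E) (hx : x ∉ U) :
    ∃ f : Dual K E, f x ≠ 0 ∧ ∀ u ∈ U, f u = 0 := by
  obtain ⟨f, h, h'⟩ := Submodule.exists_le_ker_of_notMem hx
  exact ⟨f, h, fun u hu => h' hu⟩
theorem factor {E F G : Type} [AddCommGroup E] [Module K E] [AddCommGroup F] [Module K F] [AddCommGroup G] [Module K G]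
    (f : E →ₗ[K] F) (g : E →ₗ[K] G) (h : ∀ x, f x = 0 → g x = 0) : ∃ k : F →ₗ[K] G, ∀ x, k (f x) = g x := by
  obtain ⟨k, hk⟩ := LinearMap.exists_extend ((f.ker.liftQ g (fun x hx => h x hx)) ∘ₗ f.quotKerEquivRange.symm.toLinearMap)
  refine ⟨k, fun x => ?_⟩
  have := LinearMap.congr_fun hk ⟨f x, x, rfl⟩
  simp only [LinearMap.comp_apply, Submodule.subtype_apply] at this
  rw [this]
  have h2 : f.quotKerEquivRange.symm ⟨f x, x, rfl⟩ = f.ker.mkQ x := by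
    rw [LinearEquiv.symm_apply_eq]; rfl
  rw [LinearEquiv.coe_coe, h2]; rfl
end Reps
local notation "Rp" k:max n:max m:max => Rep k (Fin n ⊕ Fin m)
open Module
section Pi
variable {K : Type} [Field K] {ι : Type} [Fintype ι] [DecidableEq ι]
structure PiC (adj : ι → ι → Prop) (M : Rep K (Option ι)) : Prop where
  ee : ∀ a b x, M.op (some a) (M.op (some b) x) = if a = b then M.op (some a) x else 0
  s : ∀ x, ∑ a, M.op (some a) x = x
  na : ∀ a b x, ¬ adj a b → M.op (some a) (M.op none (M.op (some b) x)) = 0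
  rel : ∀ a x, M.op (some a) (M.op none (M.op none (M.op (some a) x))) = 0
def TT (i : ι) (M : Rep K (Option ι)) : Prop := ∀ x, ∃ w, M.op (some i) x = M.op (some i) (M.op none w)
def SS (i : ι) (M : Rep K (Option ι)) : Prop := ∀ x, M.op none (M.op (some i) x) = 0 → M.op (some i) x = 0
set_option linter.unusedSectionVars false
variable {adj : ι → ι → Prop} [DecidableRel adj]
def nb (adj : ι → ι → Prop) [DecidableRel adj] (M : Rep K (Option ι)) (i : ι) : End K M.E :=
  ∑ j with adj i j, M.op (some j)
theorem PiC.nb_e {M : Rep K (Option ι)} (h : PiC adj M) (i j : ι) (x : M.E) :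
    M.op (some j) (nb adj M i x) = if adj i j then M.op (some j) x else 0 := by
  simp only [nb, LinearMap.sum_apply, map_sum, h.ee]
  split_ifs with hj
  · rw [Finset.sum_ite_eq]; simp [hj]
  · rw [Finset.sum_ite_eq]; simp [hj]
theorem PiC.Xn {M : Rep K (Option ι)} (h : PiC adj M) (i : ι) (x : M.E) :
    M.op (some i) (M.op none (nb adj M i x)) = M.op (some i) (M.op none x) := by
  conv_rhs => rw [← h.s x]
  simp only [nb, LinearMap.sum_apply, map_sum]
  rw [Finset.sum_filter]
  refine Finset.sum_congr rfl fun a _ => ?_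
  split_ifs with ha
  · rfl
  · exact (h.na i a x ha).symm
theorem PiC.ext {M : Rep K (Option ι)} (h : PiC adj M) {x y : M.E} (hh : ∀ j, M.op (some j) x = M.op (some j) y) : x = y := by
  rw [← h.s x, ← h.s y]
  exact Finset.sum_congr rfl fun a _ => hh a
theorem PiC.nX {M : Rep K (Option ι)} (h : PiC adj M) (hs : ∀ a b, adj a b → adj b a) (i : ι) (x : M.E) :
    nb adj M i (M.op none (M.op (some i) x)) = M.op none (M.op (some i) x) := by
  refine h.ext fun j => ?_
  rw [h.nb_e]
  split_ifs with hj
  · rfl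
  · exact (h.na j i x fun h => hj (hs _ _ h)).symm
structure Refl (adj : ι → ι → Prop) [DecidableRel adj] (i : ι) (M M' : Rep K (Option ι)) (y k : M'.E →ₗ[K] M.E) : Prop where
  inj : ∀ z, y z = 0 → k z = 0 → z = 0
  ex : ∀ u v, M.op (some i) u = 0 → nb adj M i v = v → M.op (some i) (M.op none v) = 0 → ∃ z, y z = u ∧ k z = v
  py : ∀ z, M.op (some i) (y z) = 0
  nk : ∀ z, nb adj M i (k z) = k z
  pk : ∀ z, M.op (some i) (M.op none (k z)) = 0
  ye : ∀ j z, y (M'.op (some j) z) = M.op (some j) (y z)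
  ke : ∀ j z, k (M'.op (some j) z) = if j = i then k z else 0
  yX : ∀ z, y (M'.op none z) = M.op none (y z) - M.op (some i) (M.op none (y z)) + k z
  kX : ∀ z, k (M'.op none z) = M.op none (M.op (some i) (M.op none (y z)))
theorem Refl.exists {M : Rep K (Option ι)} (h : PiC adj M) (hs : ∀ a b, adj a b → adj b a) (hi : ∀ a, ¬ adj a a) (i : ι) :
    ∃ M' y k, Refl adj i M M' y k := by
  let p := M.op (some i)
  let X := M.op none
  have hpn : ∀ v, p (nb adj M i v) = 0 := fun v => by
    show M.op (some i) _ = 0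
    rw [h.nb_e, if_neg (hi i)]
  let S : Submodule K (M.E × M.E) := 
    { carrier := {z | p z.1 = 0 ∧ nb adj M i z.2 = z.2 ∧ p (X z.2) = 0}
      add_mem' := by
        rintro a b ⟨h1, h2, h3⟩ ⟨h1', h2', h3'⟩
        simp only [Set.mem_ofPred_eq, Prod.fst_add, Prod.snd_add, map_add, h1, h2, h3, h1', h2', h3', add_zero, and_self]
      zero_mem' := by simp
      smul_mem' := by
        rintro c a ⟨h1, h2, h3⟩
        simp only [Set.mem_ofPred_eq, Prod.smul_fst, Prod.smul_snd, map_smul, h1, h2, h3, smul_zero, and_self] }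
  let f1 := LinearMap.fst K M.E M.E
  let f2 := LinearMap.snd K M.E M.E
  let oe : ι → End K S := fun j => LinearMap.restrict ((M.op (some j) ∘ₗ f1).prod (if j = i then f2 else 0)) (p := S) (q := S) (by
    rintro ⟨u, v⟩ ⟨h1, h2, h3⟩
    refine ⟨?_, ?_, ?_⟩
    · show M.op (some i) (M.op (some j) u) = 0
      rw [h.ee]; split_ifs
      · exact h1
      · rfl
    · by_cases hj : j = i <;> simp [hj, f2]
      exact h2
    · by_cases hj : j = i <;> simp [hj, f2]
      exact h3)
  let oX : End K S := LinearMap.restrict (((X - p * X) ∘ₗ f1 + f2).prod ((X * p * X) ∘ₗ f1)) (p := S) (q := S) (by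
    rintro ⟨u, v⟩ ⟨h1, h2, h3⟩
    refine ⟨?_, ?_, ?_⟩
    · show p (X u - p (X u) + v) = 0
      have h4 : p v = 0 := by have := hpn v; rwa [show nb adj M i v = v from h2] at this
      have h5 : p (p (X u)) = p (X u) := by show M.op (some i) (M.op (some i) _) = _; rw [h.ee, if_pos rfl]
      rw [map_add, map_sub, h4, h5]; simp
    · exact h.nX hs i (X u)
    · exact h.rel i (X u))
  refine ⟨⟨S, fun s => s.elim oX oe⟩, f1 ∘ₗ S.subtype, f2 ∘ₗ S.subtype, ?_, ?_, ?_, ?_, ?_, ?_, ?_, ?_, ?_⟩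
  · rintro ⟨⟨u, v⟩, hz⟩ h1 h2
    exact Subtype.ext (Prod.ext h1 h2)
  · intro u v h1 h2 h3
    exact ⟨⟨(u, v), h1, h2, h3⟩, rfl, rfl⟩
  · exact fun z => z.2.1
  · exact fun z => z.2.2.1
  · exact fun z => z.2.2.2
  · exact fun j z => rfl
  · intro j z
    by_cases hj : j = i <;> simp [hj, oe, f2, f1]
  · exact fun z => rfl
  · exact fun z => rfl
section
variable {i : ι} {M M' : Rep K (Option ι)} {y k : M'.E →ₗ[K] M.E}
theorem Refl.eq (R : Refl adj i M M' y k) {z w : M'.E} (h1 : y z = y w) (h2 : k z = k w) : z = w := by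
  rw [← sub_eq_zero]
  exact R.inj _ (by rw [map_sub, h1, sub_self]) (by rw [map_sub, h2, sub_self])
theorem Refl.pi (R : Refl adj i M M' y k) (h : PiC adj M) (hs : ∀ a b, adj a b → adj b a) : PiC adj M' := by
  refine ⟨?_, ?_, ?_, ?_⟩
  · intro a b x
    apply R.eq
    · rw [R.ye, R.ye, h.ee, apply_ite y, R.ye, map_zero]
    · rw [R.ke, R.ke, apply_ite k, R.ke, map_zero]
      grind
  · intro x
    apply R.eq
    · simp only [map_sum, R.ye, h.s]
    · simp [map_sum, R.ke]
  · intro a b x hab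
    apply R.eq
    · rw [R.ye, R.yX, R.ye, R.ke, map_add, map_sub, h.na _ _ _ hab, h.ee]
      have h1 : (if a = i then M.op (some a) (M.op none (M.op (some b) (y x))) else 0) = 0 := by
        split_ifs
        · exact h.na _ _ _ hab
        · rfl
      have h2 : M.op (some a) (if b = i then k x else 0) = 0 := by
        split_ifs with hb
        · subst hb
          rw [← R.nk, h.nb_e, if_neg fun h => hab (hs _ _ h)]
        · simp
      rw [h1, h2]; simp
    · rw [R.ke, R.kX, R.ye]
      split_ifs with h1
      · subst h1
        rw [h.na _ _ _ hab]; simp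
      · simp
  · intro a x
    by_cases ha : a = i
    · subst ha
      apply R.eq
      · rw [R.ye, R.py]; simp
      · rw [R.ke, if_pos rfl, R.kX, R.yX, R.ye, R.py, R.ke, if_pos rfl]
        simp [R.pk]
    · apply R.eq
      · rw [R.ye, R.yX, R.kX, R.yX, R.ye, R.ke, if_neg ha, map_add, map_sub, h.ee, if_neg ha]
        simp [h.rel]
      · rw [R.ke, if_neg ha]; simp
variable {N N' : Rep K (Option ι)} {y' k' : N'.E →ₗ[K] N.E}
theorem Refl.surj (R : Refl adj i M M' y k) (h : PiC adj M) (hi : ∀ a, ¬ adj a a) (hT : TT i M) (x : M.E) :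
    ∃ z w, x = y z + M.op (some i) (M.op none (y w)) := by
  have key : ∀ x, ∃ z, y z = x - M.op (some i) x := fun x => by
    obtain ⟨z, hz, _⟩ := R.ex (x - M.op (some i) x) 0 (by rw [map_sub, h.ee]; simp) (by simp) (by simp)
    exact ⟨z, hz⟩
  obtain ⟨w, hw⟩ := hT x
  obtain ⟨z, hz⟩ := key x
  obtain ⟨w', hw'⟩ := key w
  exact ⟨z, w', by rw [hz, hw', map_sub, map_sub, h.na _ _ _ (hi i), hw]; simp⟩
theorem Refl.hom (R : Refl adj i M M' y k) (h : PiC adj M) (hi : ∀ a, ¬ adj a a) (hT : TT i M)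
    (R' : Refl adj i N N' y' k') (h' : PiC adj N) (φ : M'.E →ₗ[K] N'.E) (hφ : Inter M'.op N'.op φ) :
    ∃ ψ : M.E →ₗ[K] N.E, Inter M.op N.op ψ ∧ (∀ z, ψ (y z) = y' (φ z)) ∧
      ∀ z, ψ (M.op (some i) (M.op none (y z))) = N.op (some i) (N.op none (y' (φ z))) := by
  have hk : ∀ z, y z = 0 → y' (φ z) = 0 := fun z hz => by
    have h1 : z = M'.op (some i) z := R.eq (by rw [R.ye, hz]; simp) (by rw [R.ke, if_pos rfl])
    rw [h1, hφ, R'.ye, R'.py]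
  have hk2 : ∀ w, M.op (some i) (M.op none (y w)) = 0 → N.op (some i) (N.op none (y' (φ w))) = 0 := fun w hw => by
    obtain ⟨u, hu1, hu2⟩ := R.ex 0 (nb adj M i (y w)) (by simp) (h.ext fun j => by rw [h.nb_e, h.nb_e]; split_ifs <;> rfl)
      (by rw [h.Xn, hw])
    have e1 : nb adj M' i w = M'.op none u := by
      apply R.eq
      · rw [R.yX, hu1, hu2]; simp [nb, R.ye]
      · rw [R.kX, hu1]
        simp only [nb, LinearMap.sum_apply, map_sum, R.ke]
        simp [hi]
    have e2 : nb adj N' i (φ w) = N'.op none (φ u) := by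
      rw [← hφ, ← e1]; simp [nb, hφ _ _]
    have e3 := congrArg y' e2
    rw [R'.yX, hk u hu1] at e3
    have e4 : y' (nb adj N' i (φ w)) = nb adj N i (y' (φ w)) := by simp [nb, R'.ye]
    rw [e4] at e3
    rw [← h'.Xn, e3]; simp [R'.pk]
  obtain ⟨ψ, hψ⟩ := factor (y.coprod ((M.op (some i) * M.op none) ∘ₗ y))
    ((y' ∘ₗ φ).coprod ((N.op (some i) * N.op none) ∘ₗ y' ∘ₗ φ)) (by
      rintro ⟨z, w⟩ hz
      simp only [LinearMap.coprod_apply, LinearMap.comp_apply, Module.End.mul_apply] at hz ⊢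
      have h1 : M.op (some i) (M.op none (y w)) = 0 := by
        have := congrArg (M.op (some i)) hz
        rw [map_add, R.py, h.ee] at this
        simpa using this
      rw [h1, add_zero] at hz
      rw [hk z hz, hk2 w h1, add_zero])
  have hψ' : ∀ z w, ψ (y z + M.op (some i) (M.op none (y w))) = y' (φ z) + N.op (some i) (N.op none (y' (φ w))) :=
    fun z w => hψ (z, w)
  have a1 : ∀ z, ψ (y z) = y' (φ z) := fun z => by simpa using hψ' z 0
  have a2 : ∀ z, ψ (M.op (some i) (M.op none (y z))) = N.op (some i) (N.op none (y' (φ z))) := fun z => by simpa using hψ' 0 z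
  refine ⟨ψ, fun s x => ?_, a1, a2⟩
  obtain ⟨z, w, rfl⟩ := R.surj h hi hT x
  rcases s with _ | j
  · have b1 : M.op none (y z) = y (M'.op none (z - M'.op (some i) z)) + M.op (some i) (M.op none (y z)) := by
      rw [R.yX, map_sub, R.ye, R.py, map_sub, map_sub k, R.ke, if_pos rfl]; simp
    have b1' : N.op none (y' (φ z)) = y' (N'.op none (φ z - N'.op (some i) (φ z))) + N.op (some i) (N.op none (y' (φ z))) := by
      rw [R'.yX, map_sub, R'.ye, R'.py, map_sub, map_sub k', R'.ke, if_pos rfl]; simp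
    have b2 : M.op none (M.op (some i) (M.op none (y w))) = y (M'.op none (M'.op (some i) (M'.op none w))) := by
      rw [R.yX, R.ye, R.py, R.ke, if_pos rfl, R.kX]; simp
    have b2' : N.op none (N.op (some i) (N.op none (y' (φ w)))) = y' (N'.op none (N'.op (some i) (N'.op none (φ w)))) := by
      rw [R'.yX, R'.ye, R'.py, R'.ke, if_pos rfl, R'.kX]; simp
    rw [map_add (M.op none), b1, b2, map_add ψ, map_add ψ, a1, a2, a1, map_add ψ, a1, a2, map_add (N.op none), b2', hφ, map_sub φ, hφ, hφ, hφ, hφ, ← b1']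
  · rw [map_add, ← R.ye, h.ee, map_add, a1, map_add, a1, a2, map_add, h'.ee, hφ, R'.ye]
    split_ifs with hj
    · subst hj; rw [a2]
    · simp
theorem Refl.iso (R : Refl adj i M M' y k) (h : PiC adj M) (hi : ∀ a, ¬ adj a a) (hT : TT i M)
    (R' : Refl adj i N N' y' k') (h' : PiC adj N) (hT' : TT i N) (hh : RIso M'.op N'.op) : RIso M.op N.op := by
  obtain ⟨φ, hφ, hb⟩ := hh
  let e := LinearEquiv.ofBijective φ hb
  have he : ∀ x, φ (e.symm x) = x := e.apply_symm_apply
  have he' : ∀ x, e.symm (φ x) = x := e.symm_apply_apply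
  have hχ : Inter N'.op M'.op e.symm.toLinearMap := fun s x => e.injective (by
    show φ (e.symm (N'.op s x)) = φ (M'.op s (e.symm x))
    rw [he, hφ, he])
  obtain ⟨ψ, hψ, a1, a2⟩ := R.hom h hi hT R' h' φ hφ
  obtain ⟨χ, hχ, b1, b2⟩ := R'.hom h' hi hT' R h _ hχ
  refine ⟨ψ, hψ, Function.bijective_iff_has_inverse.mpr ⟨χ, fun x => ?_, fun x => ?_⟩⟩
  · obtain ⟨z, w, rfl⟩ := R.surj h hi hT x
    rw [map_add, a1, a2, map_add, b1, b2]; simp [he']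
  · obtain ⟨z, w, rfl⟩ := R'.surj h' hi hT' x
    rw [map_add, b1, b2, map_add, a1, a2]; simp [he]
theorem Refl.brick (R : Refl adj i M M' y k) (h : PiC adj M) (hi : ∀ a, ¬ adj a a) (hT : TT i M) (hb : Brick M.op) :
    Brick M'.op := by
  refine ⟨?_, fun φ hφ h0 => ?_⟩
  · by_contra hc
    rw [not_nontrivial_iff_subsingleton] at hc
    have := hb.1
    obtain ⟨x, hx⟩ := exists_ne (0 : M.E)
    obtain ⟨z, w, rfl⟩ := R.surj h hi hT x
    simp [Subsingleton.elim z 0, Subsingleton.elim w 0] at hx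
  · obtain ⟨ψ, hψ, a1, a2⟩ := R.hom h hi hT R h φ hφ
    have hz : ∀ z, y z = 0 → y (M'.op none z) = k z := fun z hz => by rw [R.yX, hz]; simp
    have h1 : ψ ≠ 0 := by
      rintro rfl
      apply h0
      ext z
      have c1 : ∀ z, y (φ z) = 0 := fun z => (a1 z).symm
      exact R.inj _ (c1 z) (by rw [← hz _ (c1 z), ← hφ, c1])
    have h2 := hb.2 ψ hψ h1
    have h3 : ∀ z, φ z = 0 → y z = 0 := fun z hz => h2 (by rw [a1, hz]; simp)
    rw [injective_iff_map_eq_zero]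
    intro z hz'
    exact R.inj _ (h3 z hz') (by rw [← hz _ (h3 z hz'), h3]; rw [hφ, hz', map_zero])
end
end Pi
open Module
section Dim
set_option linter.unusedSectionVars false
variable {K : Type} [Field K] {ι : Type} [Fintype ι] [DecidableEq ι] {adj : ι → ι → Prop} [DecidableRel adj]
theorem rn {E F : Type} [AddCommGroup E] [Module K E] [AddCommGroup F] [Module K F] [FiniteDimensional K E]
    (U W : Submodule K E) (V : Submodule K F) (f : E →ₗ[K] F) (h1 : ∀ u ∈ U, f u ∈ V) (h2 : ∀ v ∈ V, ∃ u ∈ U, f u = v)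
    (h3 : ∀ u, u ∈ W ↔ u ∈ U ∧ f u = 0) : finrank K U = finrank K V + finrank K W := by
  have e1 := LinearMap.finrank_range_add_finrank_ker (f.domRestrict U)
  have e2 : (f.domRestrict U).range = V := by
    ext v
    constructor
    · rintro ⟨u, rfl⟩; exact h1 _ u.2
    · intro hv
      obtain ⟨u, hu, rfl⟩ := h2 v hv
      exact ⟨⟨u, hu⟩, rfl⟩
  have e3 : (f.domRestrict U).ker.map U.subtype = W := by
    ext u
    rw [h3]
    constructor
    · rintro ⟨⟨u, hu⟩, hk, rfl⟩; exact ⟨hu, hk⟩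
    · rintro ⟨hu, hk⟩; exact ⟨⟨u, hu⟩, hk, rfl⟩
  rw [← e1, e2, ← e3, LinearEquiv.finrank_eq (Submodule.equivMapOfInjective U.subtype U.injective_subtype _)]
noncomputable def dv (M : Rep K (Option ι)) (a : ι) : ℕ := finrank K (M.op (some a)).range
theorem PiC.mem {M : Rep K (Option ι)} (h : PiC adj M) (a : ι) (x : M.E) :
    x ∈ (M.op (some a)).range ↔ M.op (some a) x = x := by
  constructor
  · rintro ⟨u, rfl⟩; rw [h.ee, if_pos rfl]
  · exact fun h => ⟨x, h⟩
theorem PiC.dim_sum {M : Rep K (Option ι)} (h : PiC adj M) (S : Finset ι) :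
    finrank K (∑ j ∈ S, M.op (some j)).range = ∑ j ∈ S, dv M j := by
  induction S using Finset.induction_on with
  | empty => rw [Finset.sum_empty, Finset.sum_empty, LinearMap.range_zero, finrank_bot]
  | insert a S ha ih =>
    rw [Finset.sum_insert ha, Finset.sum_insert ha, ← ih, dv]
    have k1 : ∀ x, M.op (some a) ((∑ j ∈ S, M.op (some j)) x) = 0 := fun x => by
      simp only [LinearMap.sum_apply, map_sum, h.ee]
      rw [Finset.sum_ite_eq]; simp [ha]
    have k2 : ∀ x, (∑ j ∈ S, M.op (some j)) (M.op (some a) x) = 0 := fun x => by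
      simp only [LinearMap.sum_apply, h.ee]
      refine Finset.sum_eq_zero fun j hj => if_neg ?_
      rintro rfl; exact ha hj
    have k3 : ∀ x, (∑ j ∈ S, M.op (some j)) ((∑ j ∈ S, M.op (some j)) x) = (∑ j ∈ S, M.op (some j)) x := fun x => by
      simp only [LinearMap.sum_apply, map_sum, h.ee]
      refine Finset.sum_congr rfl fun i hi => ?_
      rw [Finset.sum_ite_eq']; simp [hi]
    refine rn _ _ _ (M.op (some a)) (fun u _ => ⟨u, rfl⟩) ?_ ?_
    · rintro _ ⟨x, rfl⟩
      refine ⟨M.op (some a) x, ⟨M.op (some a) x, ?_⟩, ?_⟩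
      · rw [LinearMap.add_apply, k2, h.ee]; simp
      · rw [h.ee]; simp
    · intro u
      constructor
      · rintro ⟨x, rfl⟩
        exact ⟨⟨_, by rw [LinearMap.add_apply, k1, k3, zero_add]⟩, k1 x⟩
      · rintro ⟨⟨x, rfl⟩, hx⟩
        rw [LinearMap.add_apply, map_add, k1, h.ee, if_pos rfl, add_zero] at hx
        exact ⟨x, by rw [LinearMap.add_apply, hx, zero_add]⟩
theorem PiC.dim {M : Rep K (Option ι)} (h : PiC adj M) : finrank K M.E = ∑ j, dv M j := by
  rw [← h.dim_sum]
  have : (∑ j, M.op (some j)).range = ⊤ := by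
    rw [LinearMap.range_eq_top]
    intro x
    exact ⟨x, by rw [LinearMap.sum_apply]; exact h.s x⟩
  rw [this, finrank_top]
theorem Refl.dv_ne {i : ι} {M M' : Rep K (Option ι)} {y k : M'.E →ₗ[K] M.E} (R : Refl adj i M M' y k)
    (h : PiC adj M) {j : ι} (hj : j ≠ i) : dv M' j = dv M j := by
  rw [dv, dv, rn (M'.op (some j)).range ⊥ (M.op (some j)).range y]
  · simp
  · rintro _ ⟨u, rfl⟩; exact ⟨y u, (R.ye _ _).symm⟩
  · rintro _ ⟨u, rfl⟩
    obtain ⟨z, hz, _⟩ := R.ex (M.op (some j) u) 0 (by rw [h.ee, if_neg hj.symm]) (by simp) (by simp)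
    refine ⟨_, ⟨z, rfl⟩, ?_⟩
    rw [R.ye, hz, h.ee]; simp
  · intro u
    constructor
    · rintro rfl; simp
    · rintro ⟨⟨z, rfl⟩, hu⟩
      exact R.inj _ hu (by rw [R.ke, if_neg hj])
theorem Refl.dv_eq {i : ι} {M M' : Rep K (Option ι)} {y k : M'.E →ₗ[K] M.E} (R : Refl adj i M M' y k)
    (h : PiC adj M) (hT : TT i M) : dv M i + dv M' i = ∑ j with adj i j, dv M j := by
  rw [← h.dim_sum, dv, dv]
  have hnn : ∀ z, nb adj M i (nb adj M i z) = nb adj M i z := fun z => h.ext fun j => by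
    rw [h.nb_e, h.nb_e]; split_ifs <;> rfl
  let W : Submodule K M.E := (M'.op (some i)).range.map k
  have e1 : finrank K (M'.op (some i)).range = finrank K W := by
    rw [rn (M'.op (some i)).range ⊥ W k]
    · simp
    · exact fun u hu => ⟨u, hu, rfl⟩
    · rintro _ ⟨u, hu, rfl⟩; exact ⟨u, hu, rfl⟩
    · intro u
      constructor
      · rintro rfl; simp
      · rintro ⟨⟨z, rfl⟩, hu⟩
        exact R.inj _ (by rw [R.ye, R.py]) hu
  rw [e1]
  symm
  refine rn (nb adj M i).range W _ (M.op (some i) * M.op none) ?_ ?_ ?_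
  · exact fun u _ => ⟨_, rfl⟩
  · rintro _ ⟨x, rfl⟩
    obtain ⟨w, hw⟩ := hT x
    exact ⟨_, ⟨w, rfl⟩, by rw [hw]; exact h.Xn i w⟩
  · intro u
    constructor
    · rintro ⟨_, ⟨z, rfl⟩, rfl⟩
      exact ⟨⟨_, R.nk _⟩, R.pk _⟩
    · rintro ⟨⟨x, rfl⟩, hx⟩
      obtain ⟨z, h1, h2⟩ := R.ex 0 (nb adj M i x) (by simp) (hnn x) hx
      exact ⟨_, ⟨z, rfl⟩, by rw [R.ke, if_pos rfl, h2]⟩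
theorem PiC.dual {M : Rep K (Option ι)} (h : PiC adj M) (hs : ∀ a b, adj a b → adj b a) :
    PiC adj ⟨Dual K M.E, fun s => tr (M.op s)⟩ := by
  refine ⟨?_, ?_, ?_, ?_⟩
  · intro a b f
    ext x
    show f (M.op (some b) (M.op (some a) x)) = _
    rw [h.ee]
    by_cases hab : a = b
    · subst hab; simp
    · simp [hab, Ne.symm hab]
  · intro f
    ext x
    conv_rhs => rw [← h.s x]
    simp [LinearMap.sum_apply, map_sum]
  · intro a b f hab
    ext x
    show f (M.op (some b) (M.op none (M.op (some a) x))) = _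
    rw [h.na b a x fun h => hab (hs _ _ h)]; simp
  · intro a f
    ext x
    show f (M.op (some a) (M.op none (M.op none (M.op (some a) x)))) = _
    rw [h.rel]; simp
theorem PiC.dvdual {M : Rep K (Option ι)} (a : ι) :
    dv ⟨Dual K M.E, fun s => tr (M.op s)⟩ a = dv M a :=
  LinearMap.finrank_range_dualMap_eq_finrank_range _
theorem SS.dual {i : ι} {M : Rep K (Option ι)} (hS : SS i M) : TT i ⟨Dual K M.E, fun s => tr (M.op s)⟩ := by
  intro f
  obtain ⟨g, hg⟩ := factor (M.op none * M.op (some i)) (f ∘ₗ M.op (some i)) (fun x hx => by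
    have := hS x hx
    rw [LinearMap.comp_apply, this, map_zero])
  refine ⟨g, ?_⟩
  ext x
  exact (hg x).symm
theorem PiC.dich {M : Rep K (Option ι)} (h : PiC adj M) (hb : Brick M.op) (i : ι)
    (h1 : finrank K M.E ≠ 1) : TT i M ∨ SS i M := by
  by_contra hc
  rw [not_or] at hc
  obtain ⟨hT, hS⟩ := hc
  simp only [TT, SS, not_forall, not_exists] at hT hS
  obtain ⟨x, hx⟩ := hT
  obtain ⟨v, hv, hv'⟩ := hS
  obtain ⟨f, hf, hf'⟩ := exists_dual (M.op (some i) * M.op none).range (M.op (some i) x) (by rintro ⟨w, hw⟩; exact hx w hw.symm)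
  refine h1 (rank_one hb (f ∘ₗ M.op (some i)) (fun h0 => hf (LinearMap.congr_fun h0 x)) (M.op (some i) v) hv' ?_)
  rintro (_ | j) z
  · rw [hv, smul_zero, LinearMap.comp_apply, show f (M.op (some i) (M.op none z)) = 0 from hf' _ ⟨z, rfl⟩, zero_smul]
  · rw [LinearMap.comp_apply, h.ee, h.ee]
    by_cases hij : i = j
    · subst hij; simp
    · simp [hij, Ne.symm hij]
theorem PiC.one {M : Rep K (Option ι)} (h : PiC adj M) (hi : ∀ a, ¬ adj a a) (h1 : finrank K M.E = 1) :
    ∀ s, M.op s = 0 ∨ M.op s = 1 := by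
  obtain ⟨v, hv, hs⟩ := finrank_eq_one_iff'.mp h1
  have hop : ∀ s, ∃ c : K, ∀ x, M.op s x = c • x := fun s => by
    obtain ⟨c, hc⟩ := hs (M.op s v)
    refine ⟨c, fun x => ?_⟩
    obtain ⟨d, rfl⟩ := hs x
    rw [map_smul, ← hc, smul_comm]
  have hid : ∀ j, M.op (some j) = 0 ∨ M.op (some j) = 1 := fun j => by
    obtain ⟨c, hc⟩ := hop (some j)
    have := h.ee j j v
    rw [if_pos rfl, hc, hc, smul_smul, ← sub_eq_zero, ← sub_smul, smul_eq_zero] at this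
    have h2 : c * (c - 1) = 0 := by linear_combination this.resolve_right hv
    rcases mul_eq_zero.mp h2 with h3 | h3
    · left; ext x; rw [hc, h3]; simp
    · right; ext x; rw [hc, sub_eq_zero.mp h3]; simp
  rintro (_ | j)
  · left
    obtain ⟨j, hj⟩ : ∃ j, M.op (some j) = 1 := by
      by_contra hc
      push Not at hc
      apply hv
      rw [← h.s v]
      exact Finset.sum_eq_zero fun j _ => by rw [(hid j).resolve_right (hc j)]; simp
    ext x
    have := h.na j j x (hi j)
    rw [hj] at this
    exact this
  · exact hid j
theorem pi_step (hs : ∀ a b, adj a b → adj b a) (hi : ∀ a, ¬ adj a a) (d d' : ι → ℕ) (i : ι)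
    (hd : ∀ j, j ≠ i → d' j = d j) (hdi : d i + d' i = ∑ j with adj i j, d j)
    (h : FB (fun M : Rep K (Option ι) => PiC adj M ∧ dv M = d')) : FB (fun M : Rep K (Option ι) => PiC adj M ∧ dv M = d) := by
  have key : ∀ (M M' : Rep K (Option ι)) y k, Refl adj i M M' y k → PiC adj M → TT i M → dv M = d → dv M' = d' := by
    intro M M' y k R hP hT hdv
    subst hdv
    funext j
    by_cases hj : j = i
    · subst hj
      have := R.dv_eq hP hT
      omega
    · rw [R.dv_ne hP hj, hd j hj]
  have hTT : FB (fun M : Rep K (Option ι) => PiC adj M ∧ dv M = d ∧ TT i M) := by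
    refine h.transfer (fun M M' => PiC adj M ∧ TT i M ∧ ∃ y k, Refl adj i M M' y k) ?_ ?_
    · rintro M hb ⟨hP, hdv, hT⟩
      obtain ⟨M', y, k, R⟩ := Refl.exists hP hs hi i
      exact ⟨M', R.brick hP hi hT hb, ⟨R.pi hP hs, key M M' y k R hP hT hdv⟩, hP, hT, y, k, R⟩
    · rintro M N M' N' ⟨hP, hT, y, k, R⟩ ⟨hP', hT', y', k', R'⟩ hh
      exact R.iso hP hi hT R' hP' hT' hh
  have hSS : FB (fun M : Rep K (Option ι) => PiC adj M ∧ dv M = d ∧ SS i M) := by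
    refine hTT.dual id Function.surjective_id ?_
    rintro M hb ⟨hP, hdv, hS⟩
    exact ⟨hP.dual hs, by rw [← hdv]; funext a; exact PiC.dvdual a, hS.dual⟩
  refine ((FB.one.or hTT).or hSS).mono ?_
  rintro M hb ⟨hP, hdv⟩
  by_cases h1 : finrank K M.E = 1
  · exact Or.inl (Or.inl ⟨h1, hP.one hi h1⟩)
  · rcases hP.dich hb i h1 with h2 | h2
    · exact Or.inl (Or.inr ⟨hP, hdv, h2⟩)
    · exact Or.inr ⟨hP, hdv, h2⟩
theorem pi_dim (hs : ∀ a b, adj a b → adj b a) (hi : ∀ a, ¬ adj a a) (i : ι) (M : Rep K (Option ι)) (hP : PiC adj M) (hb : Brick M.op)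
    (h1 : finrank K M.E ≠ 1) : ∃ M' : Rep K (Option ι), PiC adj M' ∧ Brick M'.op ∧ (∀ j, j ≠ i → dv M' j = dv M j) ∧
      dv M i + dv M' i = ∑ j with adj i j, dv M j := by
  have key : ∀ M : Rep K (Option ι), PiC adj M → Brick M.op → TT i M → ∃ M' : Rep K (Option ι), PiC adj M' ∧ Brick M'.op ∧ (∀ j, j ≠ i → dv M' j = dv M j) ∧
      dv M i + dv M' i = ∑ j with adj i j, dv M j := by
    intro M hP hb hT
    obtain ⟨M', y, k, R⟩ := Refl.exists hP hs hi i
    exact ⟨M', R.pi hP hs, R.brick hP hi hT hb, fun j hj => R.dv_ne hP hj, R.dv_eq hP hT⟩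
  rcases hP.dich hb i h1 with h2 | h2
  · exact key M hP hb h2
  · have := key ⟨Dual K M.E, fun s => tr (M.op s)⟩ (hP.dual hs) (hb.dual id Function.surjective_id) (h2.dual)
    simpa only [PiC.dvdual] using this
end Dim
section D6
variable {K : Type} [Field K]
def adj6 (a b : Fin 6) : Prop :=
  (a, b) ∈ [((0 : Fin 6), (1 : Fin 6)), (1, 0), (1, 2), (2, 1), (2, 3), (3, 2), (3, 4), (4, 3), (3, 5), (5, 3)]
instance : DecidableRel adj6 := fun a b => inferInstanceAs (Decidable ((a, b) ∈ _))
def nbs (d : Fin 6 → ℕ) : Fin 6 → ℕ := ![d 1, d 0 + d 2, d 1 + d 3, d 2 + d 4 + d 5, d 3, d 3]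
theorem sum_adj6 (d : Fin 6 → ℕ) (i : Fin 6) : ∑ j with adj6 i j, d j = nbs d i := by
  have : ∀ i : Fin 6, (Finset.univ.filter (adj6 i)) = (![{1}, {0, 2}, {1, 3}, {2, 4, 5}, {3}, {3}] : Fin 6 → Finset (Fin 6)) i := by decide
  rw [this]
  fin_cases i <;> simp [nbs, add_assoc]
def qf (d : Fin 6 → ℕ) : ℤ := (d 0 : ℤ) ^ 2 + (d 0 - d 1 : ℤ) ^ 2 + (d 1 - d 2 : ℤ) ^ 2 + (d 2 - d 3 : ℤ) ^ 2 +
  (d 3 - d 4 - d 5 : ℤ) ^ 2 + (d 4 - d 5 : ℤ) ^ 2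
theorem qf_refl (d d' : Fin 6 → ℕ) (i : Fin 6) (h : ∀ j, j ≠ i → d' j = d j) (h2 : d i + d' i = nbs d i) : qf d' = qf d := by
  have h3 : (d' i : ℤ) = nbs d i - d i := by omega
  have h4 : ∀ j, j ≠ i → (d' j : ℤ) = d j := fun j hj => by rw [h j hj]
  unfold qf
  fin_cases i <;> simp only [Fin.forall_fin_succ, nbs] at h3 h4 <;> simp at h3 h4 <;> simp only [h3, h4] <;> ring
theorem exists_pos (d : Fin 6 → ℕ) (hd : ∃ i, d i ≠ 0) : ∃ i, nbs d i < 2 * d i := by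
  by_contra hc
  push Not at hc
  simp only [Fin.forall_fin_succ, nbs] at hc
  simp at hc
  obtain ⟨h0, h1, h2, h3, h4, h5⟩ := hc
  obtain ⟨i, hi⟩ := hd
  apply hi
  fin_cases i <;> simp <;> omega
theorem dv_ne {M : Rep K (Option (Fin 6))} (hP : PiC adj6 M) (hb : Brick M.op) : ∃ i, dv M i ≠ 0 := by
  by_contra hc
  push Not at hc
  have h1 := hP.dim
  rw [Finset.sum_eq_zero fun j _ => hc j] at h1
  have := hb.1
  exact absurd h1 (finrank_pos).ne'
theorem adj6_symm : ∀ a b, adj6 a b → adj6 b a := by decide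
theorem adj6_irr : ∀ a, ¬ adj6 a a := by decide
theorem qf_two (n : ℕ) : ∀ (M : Rep K (Option (Fin 6))), PiC adj6 M → Brick M.op → ∑ j, dv M j = n → qf (dv M) = 2 := by
  induction n using Nat.strong_induction_on with
  | _ n ih =>
    intro M hP hb hn
    by_cases h1 : finrank K M.E = 1
    · have h2 := hP.dim
      rw [h1] at h2
      unfold qf
      simp only [Fin.sum_univ_six] at h2
      generalize dv M 0 = a at *
      generalize dv M 1 = b at *
      generalize dv M 2 = c at *
      generalize dv M 3 = d at *
      generalize dv M 4 = e at *
      generalize dv M 5 = f at *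
      obtain h | h | h | h | h | h : (a = 1 ∧ b = 0 ∧ c = 0 ∧ d = 0 ∧ e = 0 ∧ f = 0) ∨ (a = 0 ∧ b = 1 ∧ c = 0 ∧ d = 0 ∧ e = 0 ∧ f = 0) ∨
        (a = 0 ∧ b = 0 ∧ c = 1 ∧ d = 0 ∧ e = 0 ∧ f = 0) ∨ (a = 0 ∧ b = 0 ∧ c = 0 ∧ d = 1 ∧ e = 0 ∧ f = 0) ∨
        (a = 0 ∧ b = 0 ∧ c = 0 ∧ d = 0 ∧ e = 1 ∧ f = 0) ∨ (a = 0 ∧ b = 0 ∧ c = 0 ∧ d = 0 ∧ e = 0 ∧ f = 1) := by omega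
      all_goals
        obtain ⟨rfl, rfl, rfl, rfl, rfl, rfl⟩ := h
        norm_num
    · obtain ⟨i, hi⟩ := exists_pos (dv M) (dv_ne hP hb)
      obtain ⟨M', hP', hb', e1, e2⟩ := pi_dim adj6_symm adj6_irr i M hP hb h1
      rw [sum_adj6] at e2
      rw [← qf_refl _ _ i e1 e2]
      refine ih _ ?_ M' hP' hb' rfl
      rw [← hn]
      refine Finset.sum_lt_sum (fun j _ => ?_) ⟨i, Finset.mem_univ _, by omega⟩
      by_cases hj : j = i
      · subst hj; omega
      · exact (e1 j hj).le
theorem FB_dv (n : ℕ) : ∀ d : Fin 6 → ℕ, ∑ j, d j = n → FB (fun M : Rep K (Option (Fin 6)) => PiC adj6 M ∧ dv M = d) := by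
  induction n using Nat.strong_induction_on with
  | _ n ih =>
    intro d hn
    by_cases hd : ∃ i, d i ≠ 0
    · obtain ⟨i, hi⟩ := exists_pos d hd
      by_cases hle : d i ≤ nbs d i
      · refine pi_step adj6_symm adj6_irr d (Function.update d i (nbs d i - d i)) i ?_ ?_ (ih _ ?_ _ rfl)
        · intro j hj; simp [hj]
        · rw [sum_adj6]; simp; omega
        · rw [← hn]
          refine Finset.sum_lt_sum (fun j _ => ?_) ⟨i, Finset.mem_univ _, by simp; omega⟩
          by_cases hj : j = i
          · subst hj; simp; omega
          · simp [hj]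
      · refine FB.one.mono ?_
        rintro M hb ⟨hP, rfl⟩
        suffices h1 : finrank K M.E = 1 from ⟨h1, hP.one adj6_irr h1⟩
        by_contra h1
        obtain ⟨M', hP', hb', e1, e2⟩ := pi_dim adj6_symm adj6_irr i M hP hb h1
        rw [sum_adj6] at e2
        omega
    · refine ⟨[], ?_⟩
      rintro M hb ⟨hP, rfl⟩
      exact absurd (dv_ne hP hb) hd
theorem FB_D6 : FB (fun M : Rep K (Option (Fin 6)) => PiC adj6 M) := by
  refine (FB.union (ι := Fin 6 → Fin 12) fun f => FB_dv _ (fun j => (f j : ℕ)) rfl).mono ?_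
  intro M hb hP
  have hq := qf_two _ M hP hb rfl
  have hb : ∀ j, dv M j < 12 := by
    unfold qf at hq
    have h0 := sq_nonneg (dv M 0 : ℤ)
    have h1 := sq_nonneg (dv M 0 - dv M 1 : ℤ)
    have h2 := sq_nonneg (dv M 1 - dv M 2 : ℤ)
    have h3 := sq_nonneg (dv M 2 - dv M 3 : ℤ)
    have h4 := sq_nonneg (dv M 3 - dv M 4 - dv M 5 : ℤ)
    have h5 := sq_nonneg (dv M 4 - dv M 5 : ℤ)
    have aux : ∀ x : ℤ, x ^ 2 ≤ 2 → -1 ≤ x ∧ x ≤ 1 := fun x hx => ⟨by nlinarith, by nlinarith⟩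
    have a0 := aux _ (by linarith : (dv M 0 : ℤ) ^ 2 ≤ 2)
    have a1 := aux _ (by linarith : (dv M 0 - dv M 1 : ℤ) ^ 2 ≤ 2)
    have a2 := aux _ (by linarith : (dv M 1 - dv M 2 : ℤ) ^ 2 ≤ 2)
    have a3 := aux _ (by linarith : (dv M 2 - dv M 3 : ℤ) ^ 2 ≤ 2)
    have a4 := aux _ (by linarith : (dv M 3 - dv M 4 - dv M 5 : ℤ) ^ 2 ≤ 2)
    have a5 := aux _ (by linarith : (dv M 4 - dv M 5 : ℤ) ^ 2 ≤ 2)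
    intro j
    fin_cases j <;> simp <;> omega
  exact ⟨fun j => ⟨dv M j, hb j⟩, hP, rfl⟩
end D6
open Module
section QC
variable {K : Type} [Field K] {n m n' m' : ℕ}
abbrev Rep.e (M : Rp K n m) (i : Fin n) : End K M.E := M.op (Sum.inl i)
abbrev Rep.a (M : Rp K n m) (k : Fin m) : End K M.E := M.op (Sum.inr k)
structure QC (s t : Fin m → Fin n) (M : Rp K n m) : Prop where
  ee : ∀ a b, M.e a * M.e b = if a = b then M.e a else 0
  sm : ∑ a, M.e a = 1
  ar : ∀ k, M.e (t k) * M.a k * M.e (s k) = M.a k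
variable {s t : Fin m → Fin n} {M : Rp K n m}
theorem QC.te (h : QC s t M) (k : Fin m) : M.e (t k) * M.a k = M.a k := by
  rw [← h.ar k, ← mul_assoc, ← mul_assoc, h.ee, if_pos rfl]
theorem QC.se (h : QC s t M) (k : Fin m) : M.a k * M.e (s k) = M.a k := by
  rw [← h.ar k, mul_assoc, h.ee, if_pos rfl]
theorem QC.ea (h : QC s t M) (i k) : M.e i * M.a k = if i = t k then M.a k else 0 := by
  rw [← h.te k, ← mul_assoc, h.ee]; split_ifs with hi
  · rw [hi]
  · simp
theorem QC.ae (h : QC s t M) (i k) : M.a k * M.e i = if i = s k then M.a k else 0 := by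
  rw [← h.se k, mul_assoc, h.ee]
  by_cases hi : i = s k
  · simp [hi]
  · simp [hi, Ne.symm hi]
theorem QC.z (h : QC s t M) (k l) (hk : s k ≠ t l) : M.a k * M.a l = 0 := by
  rw [← h.se k, mul_assoc, h.ea, if_neg hk, mul_zero]
theorem QC.e_x (h : QC s t M) (i j x) : M.e i (M.e j x) = if i = j then M.e i x else 0 := by
  have := LinearMap.congr_fun (h.ee i j) x
  rw [Module.End.mul_apply] at this; rw [this]; split_ifs <;> rfl
theorem QC.ea_x (h : QC s t M) (i k x) : M.e i (M.a k x) = if i = t k then M.a k x else 0 := by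
  have := LinearMap.congr_fun (h.ea i k) x
  rw [Module.End.mul_apply] at this; rw [this]; split_ifs <;> rfl
theorem QC.ae_x (h : QC s t M) (i k x) : M.a k (M.e i x) = if i = s k then M.a k x else 0 := by
  have := LinearMap.congr_fun (h.ae i k) x
  rw [Module.End.mul_apply] at this; rw [this]; split_ifs <;> rfl
theorem QC.dual (h : QC s t M) (P : Fin n → Fin n) (hP : Function.Bijective P) (A : Fin m' → Fin m) (s' t' : Fin m' → Fin n)
    (hs : ∀ k, P (t' k) = s (A k)) (ht : ∀ k, P (s' k) = t (A k)) :
    QC s' t' ⟨Dual K M.E, fun x => tr (M.op (Sum.map P A x))⟩ := by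
  refine ⟨fun a b => ?_, ?_, fun k => ?_⟩
  · have := h.ee (P b) (P a)
    refine LinearMap.ext fun f => LinearMap.ext fun x => ?_
    show f ((M.e (P b) * M.e (P a)) x) = _
    rw [this]
    by_cases hab : a = b
    · subst hab; rw [if_pos rfl, if_pos rfl]; rfl
    · rw [if_neg hab, if_neg fun h => hab (hP.1 h).symm]; exact map_zero f
  · refine LinearMap.ext fun f => LinearMap.ext fun x => ?_
    have := LinearMap.congr_fun h.sm x
    rw [← Function.Bijective.sum_comp hP, LinearMap.sum_apply] at this
    have h2 : f (∑ d, M.e (P d) x) = f x := congrArg f this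
    rw [LinearMap.sum_apply]
    refine (LinearMap.sum_apply _ _ _).trans (Eq.trans ?_ h2)
    rw [map_sum]; rfl
  · refine LinearMap.ext fun f => LinearMap.ext fun x => ?_
    show f ((M.e (P (s' k)) * M.a (A k) * M.e (P (t' k))) x) = _
    rw [hs, ht, h.ar]; rfl
theorem QC.r1 (h : QC s t M) (hb : Brick M.op) (h1 : finrank K M.E ≠ 1) (i : Fin n) (v : M.E) (hv : M.e i v = v) (hv0 : v ≠ 0)
    (hv' : ∀ k, s k = i → M.a k v = 0) (U : Submodule K M.E) (hU : ∀ k, t k = i → ∀ x, M.a k x ∈ U) (x : M.E) : M.e i x ∈ U := by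
  by_contra hc
  obtain ⟨f, hf, hf'⟩ := exists_dual U _ hc
  refine h1 (rank_one hb (f ∘ₗ M.e i) (fun h0 => hf (LinearMap.congr_fun h0 x)) v hv0 ?_)
  rintro (j | k) z
  · rw [LinearMap.comp_apply, h.e_x, ← hv, h.e_x]
    by_cases hij : i = j
    · subst hij; simp [hv]
    · simp [hij, Ne.symm hij]
  · rw [LinearMap.comp_apply, h.ea_x]
    have e1 : f (if i = t k then M.a k z else 0) = 0 := by
      split_ifs with hk
      · exact hf' _ (hU k hk.symm z)
      · simp
    have e2 : M.a k v = 0 := by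
      by_cases hk : s k = i
      · exact hv' k hk
      · rw [← hv, h.ae_x, if_neg fun h => hk h.symm]
    rw [e1, e2]; simp
def Tt (t : Fin m → Fin n) (M : Rp K n m) (i : Fin n) : Prop :=
  ∀ U : Submodule K M.E, (∀ k, t k = i → ∀ x, M.a k x ∈ U) → ∀ x, M.e i x ∈ U
def Ss (s : Fin m → Fin n) (M : Rp K n m) (i : Fin n) : Prop :=
  ∀ v, M.e i v = v → (∀ k, s k = i → M.a k v = 0) → v = 0
theorem QC.TS (h : QC s t M) (hb : Brick M.op) (h1 : finrank K M.E ≠ 1) (i : Fin n) : Tt t M i ∨ Ss s M i := by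
  by_cases hS : Ss s M i
  · exact Or.inr hS
  · left
    simp only [Ss, not_forall] at hS
    obtain ⟨v, hv, hv', hv0⟩ := hS
    exact fun U hU => h.r1 hb h1 i v hv hv0 hv' U hU
theorem FB_one (s t : Fin m → Fin n) : FB (fun M : Rp K n m => QC s t M ∧ (∀ k, s k = t k → IsNilpotent (M.a k)) ∧ finrank K M.E = 1) := by
  refine FB.one.mono ?_
  rintro M hb ⟨h, hnil, h1⟩
  refine ⟨h1, ?_⟩
  obtain ⟨v, hv, hs⟩ := finrank_eq_one_iff'.mp h1
  have hop : ∀ s, ∃ c : K, M.op s = c • 1 := fun s => by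
    obtain ⟨c, hc⟩ := hs (M.op s v)
    refine ⟨c, LinearMap.ext fun x => ?_⟩
    obtain ⟨d, rfl⟩ := hs x
    rw [map_smul, ← hc]; exact smul_comm d c v
  have hn := hb.1
  rintro (j | k)
  · obtain ⟨c, hc⟩ := hop (Sum.inl j)
    have := h.ee j j
    rw [if_pos rfl, Rep.e, hc] at this
    have h2 : c * (c - 1) = 0 := by
      have h3 : (c * (c - 1)) • (1 : End K M.E) = 0 := by
        rw [mul_sub, sub_smul, mul_one, mul_smul, sub_eq_zero]
        simpa using this
      exact (smul_eq_zero.mp h3).resolve_right one_ne_zero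
    rcases mul_eq_zero.mp h2 with h3 | h3
    · left; rw [hc, h3, zero_smul]
    · right; rw [hc, sub_eq_zero.mp h3, one_smul]
  · left
    by_cases hk : s k = t k
    · obtain ⟨r, hr⟩ := hnil k hk
      obtain ⟨c, hc⟩ := hop (Sum.inr k)
      rw [Rep.a, hc, smul_pow, one_pow] at hr
      have h3 : c ^ r = 0 := (smul_eq_zero.mp hr).resolve_right one_ne_zero
      rw [hc, eq_zero_of_pow_eq_zero h3, zero_smul]
    · obtain ⟨c, hc⟩ := hop (Sum.inl (s k))
      have h2 := h.ar k
      have h3 := h.ee (t k) (s k)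
      rw [if_neg (Ne.symm hk), Rep.e, Rep.e, hc] at h3
      rw [Rep.e, Rep.e, hc] at h2
      show M.a k = 0
      rw [← h2]
      rw [mul_smul_comm, mul_one] at h3 ⊢
      rw [← smul_mul_assoc, h3, zero_mul]
def Rep.sub (M : Rp K n m) (pv : Fin n' → Option (Fin n)) (pa : Fin m' → Option (Fin m)) : Rep K (Fin n' ⊕ Fin m') :=
  ⟨M.E, Sum.elim (fun j => (pv j).elim 0 M.e) (fun k => (pa k).elim 0 M.a)⟩
theorem QC.sub (h : QC s t M) (pv : Fin n' → Option (Fin n)) (pa : Fin m' → Option (Fin m)) (s' t' : Fin m' → Fin n')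
    (hv : ∀ i, ∃ j, ∀ j', pv j' = some i ↔ j' = j) (ha : ∀ k l, pa k = some l → pv (s' k) = some (s l) ∧ pv (t' k) = some (t l)) :
    QC s' t' (M.sub pv pa) := by
  refine ⟨fun a b => ?_, ?_, fun k => ?_⟩
  · show (pv a).elim 0 M.e * (pv b).elim 0 M.e = if a = b then (pv a).elim 0 M.e else 0
    by_cases hab : a = b
    · subst hab
      rw [if_pos rfl]
      rcases pv a with _ | i
      · simp
      · simp [h.ee]
    · rw [if_neg hab]
      rcases hA : pv a with _ | i
      · simp
      · rcases hB : pv b with _ | i'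
        · simp
        · have : i ≠ i' := by
            rintro rfl
            obtain ⟨j, hj⟩ := hv i
            exact hab (((hj a).mp hA).trans ((hj b).mp hB).symm)
          simp [h.ee, this]
  · show ∑ j, (pv j).elim 0 M.e = 1
    rw [← h.sm]
    choose f hf using hv
    have hff : ∀ i, pv (f i) = some i := fun i => (hf i _).mpr rfl
    have hinj : Function.Injective f := fun i i' hi => by
      have := hff i
      rw [hi, hff i'] at this
      exact (Option.some.inj this).symm
    rw [← Finset.sum_subset (Finset.subset_univ (Finset.univ.image f)), Finset.sum_image fun a _ b _ h => hinj h]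
    · simp [hff]
    · intro j _ hj
      rcases hA : pv j with _ | i
      · rfl
      · exact absurd (Finset.mem_image.mpr ⟨i, Finset.mem_univ _, ((hf i j).mp hA).symm⟩) hj
  · show (pv (t' k)).elim 0 M.e * (pa k).elim 0 M.a * (pv (s' k)).elim 0 M.e = (pa k).elim 0 M.a
    rcases hA : pa k with _ | l
    · simp
    · obtain ⟨h1, h2⟩ := ha k l hA
      rw [h1, h2]
      exact h.ar l
theorem FB_sub (s t : Fin m → Fin n) {s' t' : Fin m' → Fin n'} {P : Rp K n m → Prop} {Q : Rep K (Fin n' ⊕ Fin m') → Prop}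
    (h : FB (fun M => QC s' t' M ∧ Q M)) (pv : Fin n' → Option (Fin n)) (pa : Fin m' → Option (Fin m))
    (hv : ∀ i, ∃ j, ∀ j', pv j' = some i ↔ j' = j) (ha : ∀ k l, pa k = some l → pv (s' k) = some (s l) ∧ pv (t' k) = some (t l))
    (hP : ∀ M, P M → QC s t M ∧ Q (M.sub pv pa) ∧ ∀ l, (∃ k, pa k = some l) ∨ M.a l = 0) : FB P := by
  refine h.same (fun M o => (∀ l, (∃ k, pa k = some l) ∨ M.a l = 0) ∧ o = (M.sub pv pa).op) ?_ ?_
  · intro M hb hM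
    obtain ⟨h1, h2, h3⟩ := hP M hM
    exact ⟨_, ⟨h1.sub pv pa s' t' hv ha, h2⟩, h3, rfl⟩
  · rintro M N o o' φ ⟨h, rfl⟩ ⟨h', rfl⟩ hφ (j | l) x
    · obtain ⟨i, hi⟩ := hv j
      have := hφ (Sum.inl i) x
      have hi' := (hi i).mpr rfl
      simpa [Rep.sub, hi'] using this
    · by_cases hl : ∃ k, pa k = some l
      · obtain ⟨k, hk⟩ := hl
        have := hφ (Sum.inr k) x
        simpa [Rep.sub, hk] using this
      · have h1 := (h l).resolve_left hl
        have h2 := (h' l).resolve_left hl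
        show φ (M.a l x) = N.a l (φ x)
        rw [h1, h2]; simp
def s6 : Fin 10 → Fin 6 := ![0, 1, 1, 2, 2, 3, 3, 4, 3, 5]
def t6 : Fin 10 → Fin 6 := ![1, 0, 2, 1, 3, 2, 4, 3, 5, 3]
def Rel6 (M : Rep K (Fin 6 ⊕ Fin 10)) : Prop :=
  M.a 1 * M.a 0 = 0 ∧ M.a 0 * M.a 1 + M.a 3 * M.a 2 = 0 ∧ M.a 2 * M.a 3 + M.a 5 * M.a 4 = 0 ∧
  M.a 4 * M.a 5 + M.a 7 * M.a 6 + M.a 9 * M.a 8 = 0 ∧ M.a 6 * M.a 7 = 0 ∧ M.a 8 * M.a 9 = 0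
theorem FB6 : FB (fun M : Rep K (Fin 6 ⊕ Fin 10) => QC s6 t6 M ∧ Rel6 M) := by
  refine FB_D6.same (fun M o => QC s6 t6 M ∧ o = fun x => x.elim (∑ k, M.a k) M.e) ?_ ?_
  · rintro M hb ⟨h, hr⟩
    refine ⟨_, ⟨?_, ?_, ?_, ?_⟩, h, rfl⟩
    · exact fun a b x => h.e_x a b x
    · exact fun x => by simpa using LinearMap.congr_fun h.sm x
    · intro a b x hab
      show M.e a ((∑ k, M.a k) (M.e b x)) = 0
      simp only [LinearMap.sum_apply, map_sum, h.ae_x]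
      refine Finset.sum_eq_zero fun k _ => ?_
      split_ifs with hk
      · rw [h.ea_x, if_neg]
        rintro rfl
        subst hk
        revert k
        decide
      · simp
    · intro a x
      show M.e a ((∑ k, M.a k) ((∑ k, M.a k) (M.e a x))) = 0
      obtain ⟨r0, r1, r2, r3, r4, r5⟩ := hr
      have key : M.e a * (∑ k, M.a k) * (∑ k, M.a k) * M.e a = 0 := by
        have e1 : M.e a * (∑ k, M.a k) * (∑ k, M.a k) * M.e a = ∑ k, ∑ l, M.e a * M.a k * (M.a l * M.e a) := by
          simp only [Finset.mul_sum, Finset.sum_mul, mul_assoc]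
          exact Finset.sum_comm
        rw [e1]
        simp only [h.ea, h.ae]
        fin_cases a <;> simp [Fin.sum_univ_succ, s6, t6, Fin.ext_iff]
        all_goals try simp only [h.z 0 2 (by decide), h.z 3 1 (by decide), h.z 2 4 (by decide), h.z 5 3 (by decide), h.z 4 6 (by decide), h.z 4 8 (by decide), h.z 7 5 (by decide), h.z 7 8 (by decide), h.z 9 5 (by decide), h.z 9 6 (by decide), add_zero, zero_add]
        all_goals first | assumption | (rw [← add_assoc]; assumption)
      exact LinearMap.congr_fun key x
  · rintro M N o o' φ ⟨h, rfl⟩ ⟨h', rfl⟩ hφ (j | k) x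
    · exact hφ (some j) x
    · have key : ∀ {M : Rep K (Fin 6 ⊕ Fin 10)}, QC s6 t6 M → ∀ k x, M.a k x = M.e (t6 k) ((∑ k, M.a k) (M.e (s6 k) x)) := by
        intro M h k x
        simp only [LinearMap.sum_apply, map_sum, h.ae_x]
        rw [Finset.sum_eq_single k]
        · rw [if_pos rfl, h.ea_x, if_pos rfl]
        · intro l _ hl
          split_ifs with h1
          · rw [h.ea_x, if_neg]
            revert k l; decide
          · simp
        · simp
      show φ (M.a k x) = N.a k (φ x)
      rw [key h, key h']
      have e1 := hφ (some (t6 k)) ((∑ k, M.a k) (M.e (s6 k) x))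
      have e2 := hφ none (M.e (s6 k) x)
      have e3 := hφ (some (s6 k)) x
      simp only [Option.elim] at e1 e2 e3
      rw [e1, e2, e3]
theorem Brick.central {σ : Type} {M : Rep K σ} (hb : Brick M.op) (z : End K M.E) (hz : ∀ s, z * M.op s = M.op s * z) (hn : IsNilpotent z) : z = 0 := by
  by_contra h0
  have h1 := hb.2 z (fun s x => LinearMap.congr_fun (hz s) x) h0
  obtain ⟨r, hr⟩ := hn
  have h2 : Function.Injective (z ^ r) := by
    rw [Module.End.coe_pow]; exact h1.iterate r
  have := hb.1
  obtain ⟨x, hx⟩ := exists_ne (0 : M.E)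
  exact hx (h2 (by rw [hr]; simp))
end QC
open Module
section Bridge
variable {K : Type} [Field K] {n m : ℕ}
structure PA (s t : Fin m → Fin n) {B : Type} [Ring B] (e : Fin n → B) (a : Fin m → B) : Prop where
  ee : ∀ i j, e i * e j = if i = j then e i else 0
  sm : ∑ i, e i = 1
  ar : ∀ k, e (t k) * a k * e (s k) = a k
def NN {B : Type} [Ring B] (a : Fin m → B) : ℕ → B → Prop
  | 0, x => x = 0
  | L + 1, x => ∀ k, NN a L (x * a k)
theorem NN.zero {B : Type} [Ring B] (a : Fin m → B) (L : ℕ) : NN a L 0 ↔ True := by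
  refine iff_true_intro ?_
  induction L with
  | zero => rfl
  | succ L ih => intro k; rw [zero_mul]; exact ih
section
variable {s t : Fin m → Fin n} {B : Type} [Ring B] [Algebra K B] {e : Fin n → B} {a : Fin m → B}
theorem PA.ea (h : PA s t e a) (p : B) (i k) : p * e i * a k = if i = t k then p * a k else 0 := by
  rw [← h.ar k, mul_assoc, mul_assoc, ← mul_assoc (e i), h.ee]
  split_ifs with hi
  · rw [hi]
  · rw [zero_mul, mul_zero]
theorem PA.ae (h : PA s t e a) (p : B) (i k) : p * a k * e i = if i = s k then p * a k else 0 := by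
  rw [← h.ar k, mul_assoc, mul_assoc _ (e (s k)), h.ee]
  by_cases hi : i = s k
  · simp [hi]
  · simp [hi, Ne.symm hi]
theorem PA.z (h : PA s t e a) (p : B) (k l) (hk : s k ≠ t l) : p * a k * a l = 0 := by
  rw [← h.ar k, ← mul_assoc, ← mul_assoc, h.ea, if_neg hk]
theorem fin_of_NN (h : PA s t e a) (hg : ∀ V : Submodule K B, 1 ∈ V → (∀ x ∈ V, ∀ i, x * e i ∈ V) → (∀ x ∈ V, ∀ i, x * a i ∈ V) → V = ⊤)
    (L : ℕ) (x : B) (hL : NN a L x) : (LinearMap.mulLeft K x).range.FG := by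
  induction L generalizing x with
  | zero =>
    have : x = 0 := hL
    subst this
    rw [LinearMap.mulLeft_zero_eq_zero, LinearMap.range_zero]; exact Submodule.fg_bot
  | succ L ih =>
    let U : Submodule K B := Submodule.span K (Set.range fun i => x * e i) ⊔ ⨆ k, (LinearMap.mulLeft K (x * a k)).range
    have hU : U.FG := (Submodule.fg_span (Set.finite_range _)).sup (Submodule.fg_iSup _ fun k => ih _ (hL k))
    have h1 : ∀ k b, x * a k * b ∈ U := fun k b => Submodule.mem_sup_right (Submodule.mem_iSup_of_mem k ⟨b, rfl⟩)
    have h2 : ∀ i, x * e i ∈ U := fun i => Submodule.mem_sup_left (Submodule.subset_span ⟨i, rfl⟩)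
    have h3 : ∀ y ∈ U, (∀ i, y * e i ∈ U) ∧ ∀ k, y * a k ∈ U := by
      intro y hy
      have hc : ∀ g, (∀ i, x * e i * g ∈ U) → ∀ y ∈ U, y * g ∈ U := by
        intro g hg'
        have : U ≤ U.comap (LinearMap.mulRight K g) := by
          refine sup_le (Submodule.span_le.mpr ?_) (iSup_le fun k => ?_)
          · rintro _ ⟨i, rfl⟩; exact hg' i
          · rintro _ ⟨b, rfl⟩
            show x * a k * b * g ∈ U
            rw [mul_assoc]; exact h1 _ _
        exact fun y hy => this hy
      refine ⟨fun i => hc _ (fun j => ?_) y hy, fun k => hc _ (fun j => ?_) y hy⟩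
      · rw [mul_assoc, h.ee]
        split_ifs
        · exact h2 j
        · rw [mul_zero]; exact U.zero_mem
      · rw [h.ea]
        split_ifs
        · have := h1 k 1; rwa [mul_one] at this
        · exact U.zero_mem
    have h4 : U.comap (LinearMap.mulLeft K x) = ⊤ := by
      refine hg _ ?_ (fun y hy i => ?_) (fun y hy i => ?_)
      · show x * 1 ∈ U
        rw [← h.sm, Finset.mul_sum]; exact Submodule.sum_mem _ fun i _ => h2 i
      · have := (h3 _ hy).1 i
        show x * (y * e i) ∈ U
        rw [← mul_assoc]; exact this
      · have := (h3 _ hy).2 i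
        show x * (y * a i) ∈ U
        rw [← mul_assoc]; exact this
    have h5 : (LinearMap.mulLeft K x).range = U := by
      refine le_antisymm (by rw [LinearMap.range_eq_map, Submodule.map_le_iff_le_comap, h4]) (sup_le (Submodule.span_le.mpr ?_) (iSup_le fun k => ?_))
      · rintro _ ⟨i, rfl⟩; exact ⟨e i, rfl⟩
      · rintro _ ⟨b, rfl⟩; exact ⟨a k * b, (mul_assoc _ _ _).symm⟩
    rw [h5]; exact hU
end
theorem bridge {r : FreeAlgebra K (Fin (n + m)) → FreeAlgebra K (Fin (n + m)) → Prop} (s t : Fin m → Fin n)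
    (Q : ∀ (B : Type) [Ring B] [Algebra K B], (Fin m → B) → Prop)
    (hr : ∀ (B : Type) [Ring B] [Algebra K B] (g : Fin (n + m) → B), (∀ u v, r u v → FreeAlgebra.lift K g u = FreeAlgebra.lift K g v) →
      PA s t (fun i => g (Fin.castAdd m i)) (fun k => g (Fin.natAdd n k)) ∧ Q B (fun k => g (Fin.natAdd n k)))
    (L : ℕ) (hN : ∀ (B : Type) [Ring B] [Algebra K B] (e : Fin n → B) (a : Fin m → B), PA s t e a → Q B a → ∀ p, NN a L p)
    (hFB : FB (fun M : Rp K n m => QC s t M ∧ Q (End K M.E) M.a)) : IsTauTiltingFinite (RingQuot r) := by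
  let mk := RingQuot.mkAlgHom K r
  let gg : Fin (n + m) → RingQuot r := fun i => mk (FreeAlgebra.ι K i)
  have hmk : FreeAlgebra.lift K gg = mk := by ext i; simp [gg]
  have hsurj : Function.Surjective mk := RingQuot.mkAlgHom_surjective K r
  obtain ⟨pa, q⟩ := hr (RingQuot r) gg (fun u v h => by rw [hmk]; exact RingQuot.mkAlgHom_rel K h)
  have hgen : ∀ V : Submodule K (RingQuot r), 1 ∈ V → (∀ x ∈ V, ∀ i, x * gg i ∈ V) → V = ⊤ := by
    intro V h1 h2
    rw [eq_top_iff]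
    rintro y -
    obtain ⟨u, rfl⟩ := hsurj y
    have : ∀ x ∈ V, x * mk u ∈ V := by
      induction u using FreeAlgebra.induction with
      | grade0 c => intro x hx; rw [AlgHom.commutes, ← Algebra.commutes, ← Algebra.smul_def]; exact V.smul_mem _ hx
      | grade1 i => intro x hx; exact h2 x hx i
      | mul a b ha hb => intro x hx; rw [map_mul, ← mul_assoc]; exact hb _ (ha _ hx)
      | add a b ha hb => intro x hx; rw [map_add, mul_add]; exact V.add_mem (ha _ hx) (hb _ hx)
    simpa using this 1 h1
  have hfin : Module.Finite K (RingQuot r) := by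
    have := fin_of_NN (K := K) pa (fun V h1 h2 h3 => hgen V h1 fun x hx i => by
      refine Fin.addCases (fun i => ?_) (fun i => ?_) i
      · exact h2 x hx i
      · exact h3 x hx i) L 1 (hN _ _ _ pa q 1)
    rw [LinearMap.mulLeft_one, LinearMap.range_id] at this
    exact ⟨this⟩
  have hfin' : Module.Finite K (RingQuot r)ᵐᵒᵖ := Module.Finite.equiv (MulOpposite.opLinearEquiv K)
  have : IsArtinianRing (RingQuot r)ᵐᵒᵖ := IsArtinianRing.of_finite K _
  have : IsNoetherianRing (RingQuot r)ᵐᵒᵖ := IsNoetherianRing.of_finite K _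
  have tf : FB (fun M : Rep K (Fin (n + m)) => ∀ u v, r u v →
      FreeAlgebra.lift K (fun i => tr (M.op i)) u = FreeAlgebra.lift K (fun i => tr (M.op i)) v) := by
    refine hFB.dual (Sum.elim (Fin.castAdd m) (Fin.natAdd n)) (fun i => ?_) ?_
    · refine Fin.addCases (fun i => ⟨Sum.inl i, rfl⟩) (fun i => ⟨Sum.inr i, rfl⟩) i
    · intro M hb h
      obtain ⟨h1, h2⟩ := hr (End K (Dual K M.E)) (fun i => tr (M.op i)) h
      exact ⟨⟨h1.ee, h1.sm, h1.ar⟩, h2⟩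
  obtain ⟨Ls, hLs⟩ := tf
  classical
  let AM : ∀ Y : ModCat (RingQuot r)ᵐᵒᵖ, Module K Y := fun Y => Module.compHom Y (algebraMap K (RingQuot r)ᵐᵒᵖ)
  let ρ : ∀ Y : ModCat (RingQuot r)ᵐᵒᵖ, RingQuot r → @End K Y _ _ (AM Y) := fun Y x =>
    letI := AM Y
    { toFun := fun y => MulOpposite.op x • y
      map_add' := fun y z => smul_add _ y z
      map_smul' := fun c y => by
        show MulOpposite.op x • (algebraMap K (RingQuot r)ᵐᵒᵖ c • y) = algebraMap K (RingQuot r)ᵐᵒᵖ c • (MulOpposite.op x • y)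
        rw [← mul_smul, ← mul_smul, Algebra.commutes] }
  let RM : ∀ Y : ModCat (RingQuot r)ᵐᵒᵖ, Module.Finite (RingQuot r)ᵐᵒᵖ Y → Rep K (Fin (n + m)) := fun Y hY =>
    letI := AM Y
    haveI : IsScalarTower K (RingQuot r)ᵐᵒᵖ Y := ⟨fun c x y => by
      rw [Algebra.smul_def, mul_smul]; rfl⟩
    haveI : Module.Finite K Y := Module.Finite.trans (RingQuot r)ᵐᵒᵖ Y
    ⟨Y, fun i => ρ Y (gg i)⟩
  have key : ∀ (Y Z : ModCat (RingQuot r)ᵐᵒᵖ) hY hZ (φ : (RM Y hY).E →ₗ[K] (RM Z hZ).E), Inter (RM Y hY).op (RM Z hZ).op φ →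
      ∀ (x : RingQuot r) (y : Y), φ (ρ Y x y) = ρ Z x (φ y) := by
    intro Y Z hY hZ φ hφ x
    obtain ⟨u, rfl⟩ := hsurj x
    induction u using FreeAlgebra.induction with
    | grade0 c =>
      intro y
      rw [AlgHom.commutes]
      exact φ.map_smul c y
    | grade1 i => exact fun y => hφ i y
    | mul a b ha hb =>
      intro y
      have e : ∀ (W : ModCat (RingQuot r)ᵐᵒᵖ) (w : W), ρ W (mk (a * b)) w = ρ W (mk b) (ρ W (mk a) w) := fun W w => by
        rw [map_mul]; exact mul_smul (MulOpposite.op (mk b)) (MulOpposite.op (mk a)) w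
      rw [e]
      refine (hb _).trans ?_
      rw [ha]; exact (e _ _).symm
    | add a b ha hb =>
      intro y
      have e : ∀ (W : ModCat (RingQuot r)ᵐᵒᵖ) (w : W), ρ W (mk (a + b)) w = ρ W (mk a) w + ρ W (mk b) w := fun W w => by
        rw [map_add]; exact add_smul (MulOpposite.op (mk a)) (MulOpposite.op (mk b)) w
      rw [e]
      refine (φ.map_add _ _).trans ?_
      rw [ha, hb]; exact (e _ _).symm
  have hrel : ∀ Y hY u v, r u v → FreeAlgebra.lift K (fun i => tr ((RM Y hY).op i)) u = FreeAlgebra.lift K (fun i => tr ((RM Y hY).op i)) v := by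
    intro Y hY u v huv
    have e : ∀ u, FreeAlgebra.lift K (fun i => tr ((RM Y hY).op i)) u = tr (E := (RM Y hY).E) (ρ Y (mk u)) := by
      intro u
      induction u using FreeAlgebra.induction with
      | grade0 c =>
        refine LinearMap.ext fun f => LinearMap.ext fun x => ?_
        rw [AlgHom.commutes, AlgHom.commutes, Algebra.algebraMap_eq_smul_one]
        exact (f.map_smul c x).symm
      | grade1 i => rw [FreeAlgebra.lift_ι_apply]
      | mul a b ha hb =>
        rw [map_mul, ha, hb]
        refine LinearMap.ext fun f => LinearMap.ext fun x => congrArg f ?_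
        rw [map_mul]; exact (mul_smul (MulOpposite.op (mk b)) (MulOpposite.op (mk a)) x).symm
      | add a b ha hb =>
        rw [map_add, ha, hb]
        refine LinearMap.ext fun f => LinearMap.ext fun x => ?_
        refine (f.map_add _ _).symm.trans (congrArg f ?_)
        rw [map_add]; exact (add_smul (MulOpposite.op (mk a)) (MulOpposite.op (mk b)) x).symm
    rw [e, e, RingQuot.mkAlgHom_rel K huv]
  refine tau_finite_of_bricks Ls.length (fun i => if h : ∃ Y, ∃ hY, RIso (RM Y hY).op (Ls.get i).op then h.choose else ModuleCat.of _ PUnit) ?_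
  intro Y hY hB
  have key2 : ∀ (Y Z : ModCat (RingQuot r)ᵐᵒᵖ) hY hZ (φ : (RM Y hY).E →ₗ[K] (RM Z hZ).E), Inter (RM Y hY).op (RM Z hZ).op φ →
      ∃ ψ : Y →ₗ[(RingQuot r)ᵐᵒᵖ] Z, ∀ y, ψ y = φ y := fun Y Z hY hZ φ hφ =>
    ⟨{ toFun := φ, map_add' := φ.map_add, map_smul' := fun x y => key Y Z hY hZ φ hφ x.unop y }, fun y => rfl⟩
  have hb : Brick (RM Y hY).op := by
    refine ⟨hB.1, fun φ hφ h0 => ?_⟩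
    obtain ⟨ψ, hψ⟩ := key2 Y Y hY hY φ hφ
    have := hB.2 ψ (fun h => h0 (LinearMap.ext fun x => (hψ x).symm.trans (by rw [h]; rfl)))
    exact fun x y hxy => this ((hψ x).trans (hxy.trans (hψ y).symm))
  obtain ⟨N, hN, hi⟩ := hLs _ hb (hrel Y hY)
  obtain ⟨i, rfl⟩ := List.get_of_mem hN
  refine ⟨i, ?_⟩
  have hex : ∃ Y, ∃ hY, RIso (RM Y hY).op (Ls.get i).op := ⟨Y, hY, hi⟩
  rw [dif_pos hex]
  obtain ⟨hZ, hj⟩ := hex.choose_spec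
  obtain ⟨φ, hφ, hbij⟩ := hi.trans hj.symm
  obtain ⟨ψ, hψ⟩ := key2 Y _ hY hZ φ hφ
  exact ⟨LinearEquiv.ofBijective ψ ⟨fun x y h => hbij.1 ((hψ x).symm.trans (h.trans (hψ y))), fun z => (hbij.2 z).imp fun x hx => (hψ x).trans hx⟩⟩
end Bridge
open Module
section Alg
variable {K : Type} [Field K] {n m : ℕ}
section
variable {B : Type} [Ring B]
theorem NN3 (a : Fin 3 → B) (L x) : NN a (L + 1) x ↔ NN a L (x * a 0) ∧ NN a L (x * a 1) ∧ NN a L (x * a 2) := by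
  rw [NN]; exact ⟨fun h => ⟨h _, h _, h _⟩, fun h k => by fin_cases k; exacts [h.1, h.2.1, h.2.2]⟩
theorem NN4 (a : Fin 4 → B) (L x) : NN a (L + 1) x ↔ NN a L (x * a 0) ∧ NN a L (x * a 1) ∧ NN a L (x * a 2) ∧ NN a L (x * a 3) := by
  rw [NN]; exact ⟨fun h => ⟨h _, h _, h _, h _⟩, fun h k => by fin_cases k; exacts [h.1, h.2.1, h.2.2.1, h.2.2.2]⟩
theorem NN5 (a : Fin 5 → B) (L x) : NN a (L + 1) x ↔ NN a L (x * a 0) ∧ NN a L (x * a 1) ∧ NN a L (x * a 2) ∧ NN a L (x * a 3) ∧ NN a L (x * a 4) := by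
  rw [NN]; exact ⟨fun h => ⟨h _, h _, h _, h _, h _⟩, fun h k => by fin_cases k; exacts [h.1, h.2.1, h.2.2.1, h.2.2.2.1, h.2.2.2.2]⟩
theorem NN6 (a : Fin 6 → B) (L x) : NN a (L + 1) x ↔ NN a L (x * a 0) ∧ NN a L (x * a 1) ∧ NN a L (x * a 2) ∧ NN a L (x * a 3) ∧ NN a L (x * a 4) ∧ NN a L (x * a 5) := by
  rw [NN]; exact ⟨fun h => ⟨h _, h _, h _, h _, h _, h _⟩, fun h k => by fin_cases k; exacts [h.1, h.2.1, h.2.2.1, h.2.2.2.1, h.2.2.2.2.1, h.2.2.2.2.2]⟩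
theorem NN0 (a : Fin m → B) (x) : NN a 0 x ↔ x = 0 := Iff.rfl
theorem pf {x y : B} (h : x = y) (p : B) : p * x = p * y := by rw [h]
end
theorem QC.pa {s t : Fin m → Fin n} {M : Rp K n m} (h : QC s t M) : PA s t M.e M.a := ⟨h.ee, h.sm, h.ar⟩
theorem NN.pow {B : Type} [Ring B] {a : Fin m → B} (k : Fin m) : ∀ (L : ℕ) (p : B), NN a L p → p * a k ^ L = 0
  | 0, p, h => by rw [pow_zero, mul_one]; exact h
  | L + 1, p, h => by rw [pow_succ', ← mul_assoc]; exact NN.pow k L _ (h k)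
theorem fa2 (P : Fin 2 → Prop) : (∀ k, P k) ↔ P 0 ∧ P 1 := Fin.forall_fin_two
theorem fa3 (P : Fin 3 → Prop) : (∀ k, P k) ↔ P 0 ∧ P 1 ∧ P 2 := by simp [Fin.forall_fin_succ]
theorem fa4 (P : Fin 4 → Prop) : (∀ k, P k) ↔ P 0 ∧ P 1 ∧ P 2 ∧ P 3 := by simp [Fin.forall_fin_succ]
theorem fa5 (P : Fin 5 → Prop) : (∀ k, P k) ↔ P 0 ∧ P 1 ∧ P 2 ∧ P 3 ∧ P 4 := by simp [Fin.forall_fin_succ]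
theorem fa6 (P : Fin 6 → Prop) : (∀ k, P k) ↔ P 0 ∧ P 1 ∧ P 2 ∧ P 3 ∧ P 4 ∧ P 5 := by simp [Fin.forall_fin_succ]
def CN {B : Type} [Ring B] (e : Fin n → B) (a : Fin m → B) (z : B) : Prop :=
  ∀ p, (∀ i, p * z * e i = p * e i * z) ∧ (∀ k, p * z * a k = p * a k * z) ∧ p * z * z * z * z * z = 0
theorem bridge2 {r : FreeAlgebra K (Fin (n + m)) → FreeAlgebra K (Fin (n + m)) → Prop} (s t : Fin m → Fin n)
    (Q₀ Q Q' : ∀ (B : Type) [Ring B] [Algebra K B], (Fin m → B) → Prop) (Z : ∀ (B : Type) [Ring B] [Algebra K B], (Fin m → B) → List B)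
    (hr : ∀ (B : Type) [Ring B] [Algebra K B] (g : Fin (n + m) → B), (∀ u v, r u v → FreeAlgebra.lift K g u = FreeAlgebra.lift K g v) →
      PA s t (fun i => g (Fin.castAdd m i)) (fun k => g (Fin.natAdd n k)) ∧ Q₀ B (fun k => g (Fin.natAdd n k)))
    (hq : ∀ (B : Type) [Ring B] [Algebra K B] (e : Fin n → B) (a : Fin m → B), PA s t e a → Q₀ B a → Q B a)
    (L : ℕ) (hN : ∀ (B : Type) [Ring B] [Algebra K B] (e : Fin n → B) (a : Fin m → B), PA s t e a → Q B a → (∀ p, NN a L p) ∧ ∀ z ∈ Z B a, CN e a z)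
    (hz : ∀ (B : Type) [Ring B] [Algebra K B] (e : Fin n → B) (a : Fin m → B), PA s t e a → Q₀ B a → Q B a → (∀ z ∈ Z B a, z = 0) → Q' B a)
    (hFB : FB (fun M : Rp K n m => QC s t M ∧ Q' (End K M.E) M.a ∧ finrank K M.E ≠ 1)) :
    IsTauTiltingFinite (RingQuot r) := by
  refine bridge s t (fun B _ _ a => Q₀ B a ∧ Q B a) (fun B _ _ g H => ⟨(hr B g H).1, (hr B g H).2, hq B _ _ (hr B g H).1 (hr B g H).2⟩) L (fun B _ _ e a h q => (hN B e a h q.2).1) ((hFB.or (FB_one s t)).mono ?_)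
  rintro M hb ⟨h, q₀, q⟩
  by_cases h1 : finrank K M.E = 1
  · exact Or.inr ⟨h, fun k _ => ⟨L, by simpa using NN.pow k L 1 ((hN _ _ _ h.pa q).1 1)⟩, h1⟩
  · refine Or.inl ⟨h, hz _ _ _ h.pa q₀ q fun z hz => ?_, h1⟩
    have := (hN _ _ _ h.pa q).2 z hz 1
    simp only [one_mul] at this
    refine hb.central z ?_ ⟨5, by simpa [pow_succ] using this.2.2⟩
    rintro (i | k)
    exacts [this.1 i, this.2.1 k]
theorem PA.ea0 {B : Type} [Ring B] {s t : Fin m → Fin n} {e : Fin n → B} {a : Fin m → B} (h : PA s t e a) (i k) : e i * a k = if i = t k then a k else 0 := by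
  simpa using h.ea 1 i k
section
variable {s t : Fin m → Fin n} {M : Rp K n m}
theorem QC.r2 (h : QC s t M) (hb : Brick M.op) (h1 : finrank K M.E ≠ 1) (i : Fin n) (f g : End K M.E)
    (hf : ∀ k, t k = i → f * M.a k = 0) (hg : ∀ k, s k = i → M.a k * g = 0) : f * M.e i = 0 ∨ M.e i * g = 0 := by
  by_contra! hc
  obtain ⟨x, hx⟩ := DFunLike.ne_iff.mp hc.2
  refine hc.1 (LinearMap.ext fun y => ?_)
  refine h.r1 hb h1 i (M.e i (g x)) (by rw [h.e_x, if_pos rfl]) hx (fun k hk => ?_) (ker f) (fun k hk z => ?_) y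
  · rw [h.ae_x, if_pos hk.symm]; exact LinearMap.congr_fun (hg k hk) x
  · exact LinearMap.congr_fun (hf k hk) z
theorem Tt.zero {i} (h : Tt t M i) (g : End K M.E) (hg : ∀ k, t k = i → g * M.a k = 0) : g * M.e i = 0 :=
  LinearMap.ext fun y => h (ker g) (fun k hk x => LinearMap.congr_fun (hg k hk) x) y
theorem Ss.zero {i} (h : Ss s M i) (hq : QC s t M) (g : End K M.E) (hg : ∀ k, s k = i → M.a k * g = 0) : M.e i * g = 0 :=
  LinearMap.ext fun y => h _ (hq.e_x i i _ |>.trans (if_pos rfl)) fun k hk => by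
    rw [Module.End.mul_apply, hq.ae_x, if_pos hk.symm]; exact LinearMap.congr_fun (hg k hk) y
theorem QC.zx (h : QC s t M) (k l) (x : M.E) (hk : decide (s k = t l) = false) : M.a k (M.a l x) = 0 := LinearMap.congr_fun (h.z k l (of_decide_eq_false hk)) x
theorem QC.dich (h : QC s t M) (hb : Brick M.op) (h1 : finrank K M.E ≠ 1) (i : Fin n) (k l : Fin m) (hk : ∀ j, s j = i → j = k) (hl : ∀ j, t j = i → j = l)
    (hkl : M.a k * M.a l = 0) (sk : s k = i) (tl : t l = i) : M.a k = 0 ∨ M.a l = 0 := by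
  rcases h.r2 hb h1 i (M.a k) (M.a l) (fun j hj => by rw [hl j hj, hkl]) (fun j hj => by rw [hk j hj, hkl]) with h2 | h2
  · left; rw [← h.se, sk, h2]
  · right; rw [← h.te, tl, h2]
end
theorem FB_gen {P : Rp K n m → Prop} {N : ℕ} (ι : Fin N → Fin 6) (pv : Fin N → Fin n) (arr : Fin m → Finset (Fin N × Fin N))
    (hι : ∀ j j', ι j = ι j' → j = j')
    (hc1 : ∀ k, ∀ x ∈ arr k, adj6 (ι x.1) (ι x.2)) (hc2 : ∀ k, ∀ x ∈ arr k, ∀ k', ∀ y ∈ arr k', y ≠ (x.2, x.1) ∧ (y = x → k' = k))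
    (hP : ∀ M, Brick M.op → P M → ∃ f : Fin N → End K M.E, (∀ a b, f a * f b = if a = b then f a else 0) ∧ ∑ a, f a = 1 ∧
      (∀ i, M.e i = ∑ j with pv j = i, f j) ∧ ∀ k, M.a k = ∑ x ∈ arr k, f x.1 * M.a k * f x.2) : FB P := by
  have hι' : Function.Injective ι := fun j j' => hι j j'
  have hc : ∀ k, ∀ x ∈ arr k, adj6 (ι x.1) (ι x.2) ∧ ∀ k', ∀ y ∈ arr k', y ≠ (x.2, x.1) ∧ (y = x → k' = k) := fun k x hx => ⟨hc1 k x hx, hc2 k x hx⟩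
  have zz : ∀ (M : Rp K n m) (f : Fin N → End K M.E), (∀ a b, f a * f b = if a = b then f a else 0) →
      (∀ k, M.a k = ∑ x ∈ arr k, f x.1 * M.a k * f x.2) → ∀ k j j', (j, j') ∉ arr k → f j * M.a k * f j' = 0 := by
    intro M f ff fa k j j' hj
    rw [fa k, Finset.mul_sum, Finset.sum_mul]
    refine Finset.sum_eq_zero fun x hx => ?_
    have : f j * (f x.1 * M.a k * f x.2) * f j' = (f j * f x.1) * M.a k * (f x.2 * f j') := by simp only [mul_assoc]
    rw [this, ff, ff]
    by_cases h1 : j = x.1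
    · by_cases h2 : x.2 = j'
      · exact absurd (by rw [h1, ← h2]; exact hx) hj
      · rw [if_neg h2, mul_zero]
    · rw [if_neg h1, zero_mul, zero_mul]
  refine FB_D6.same (fun M o => ∃ f : Fin N → End K M.E, (∀ a b, f a * f b = if a = b then f a else 0) ∧
      (∀ i, M.e i = ∑ j with pv j = i, f j) ∧ (∀ k, M.a k = ∑ x ∈ arr k, f x.1 * M.a k * f x.2) ∧
      o = fun x => x.elim (∑ k, M.a k) (fun j' => ∑ j, if ι j = j' then f j else 0)) ?_ ?_
  · intro M hb hM
    obtain ⟨f, ff, f1, fe, fa⟩ := hP M hb hM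
    refine ⟨_, ?_, f, ff, fe, fa, rfl⟩
    have g1 : ∀ j' : Fin 6, (∃ j, ι j = j' ∧ (∑ j, if ι j = j' then f j else 0) = f j) ∨ ((∀ j, ι j ≠ j') ∧ (∑ j, if ι j = j' then f j else 0) = 0) := by
      intro j'
      by_cases hj : ∃ j, ι j = j'
      · obtain ⟨j, rfl⟩ := hj
        refine Or.inl ⟨j, rfl, ?_⟩
        simp [hι'.eq_iff]
      · push Not at hj
        exact Or.inr ⟨hj, Finset.sum_eq_zero fun j _ => if_neg (hj j)⟩
    have key : ∀ j j', f j * (∑ k, M.a k) * f j' ≠ 0 → ∃ k, (j, j') ∈ arr k := by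
      intro j j' h0
      by_contra! hc
      refine h0 ?_
      rw [Finset.mul_sum, Finset.sum_mul]
      exact Finset.sum_eq_zero fun k _ => zz M f ff fa k j j' (hc k)
    refine ⟨fun a b x => ?_, fun x => ?_, fun a b x hab => ?_, fun a x => ?_⟩
    · show (∑ j, if ι j = a then f j else 0) ((∑ j, if ι j = b then f j else 0) x) = if a = b then (∑ j, if ι j = a then f j else 0) x else 0
      rcases g1 a with ⟨j, rfl, h1⟩ | ⟨h0, h1⟩ <;> rcases g1 b with ⟨j', rfl, h2⟩ | ⟨h0', h2⟩ <;> rw [h1, h2]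
      · have := LinearMap.congr_fun (ff j j') x
        rw [Module.End.mul_apply] at this
        rw [this]
        by_cases h3 : j = j'
        · simp [h3]
        · simp [h3, hι'.eq_iff]
      · simp [h0' j]
      · simp
      · simp
    · show ∑ a, (∑ j, if ι j = a then f j else 0) x = x
      rw [← LinearMap.sum_apply, Finset.sum_comm]
      simp [f1]
    · show (∑ j, if ι j = a then f j else 0) ((∑ k, M.a k) ((∑ j, if ι j = b then f j else 0) x)) = 0
      rcases g1 a with ⟨j, rfl, h1⟩ | ⟨h0, h1⟩ <;> rcases g1 b with ⟨j', rfl, h2⟩ | ⟨h0', h2⟩ <;> rw [h1, h2]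
      · by_contra h3
        obtain ⟨k, hk⟩ := key j j' fun h4 => h3 (LinearMap.congr_fun h4 x)
        exact hab (hc k _ hk).1
      all_goals simp
    · show (∑ j, if ι j = a then f j else 0) ((∑ k, M.a k) ((∑ k, M.a k) ((∑ j, if ι j = a then f j else 0) x))) = 0
      rcases g1 a with ⟨j, rfl, h1⟩ | ⟨h0, h1⟩ <;> rw [h1]
      · have e1 : f j * (∑ k, M.a k) * (∑ k, M.a k) * f j = ∑ i, (f j * (∑ k, M.a k) * f i) * (f i * (∑ k, M.a k) * f j) := by
          have e2 : ∀ i, (f j * (∑ k, M.a k) * f i) * (f i * (∑ k, M.a k) * f j) = (f j * (∑ k, M.a k)) * f i * ((∑ k, M.a k) * f j) := by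
            intro i
            have := ff i i
            rw [if_pos rfl] at this
            rw [mul_assoc _ (f i), mul_assoc (f i), ← mul_assoc (f i) (f i), this]
            simp only [mul_assoc]
          simp only [e2]
          rw [← Finset.sum_mul, ← Finset.mul_sum, f1]
          simp only [mul_assoc, one_mul]
        have e3 : f j * (∑ k, M.a k) * (∑ k, M.a k) * f j = 0 := by
          rw [e1]
          refine Finset.sum_eq_zero fun i _ => ?_
          by_contra h3
          obtain ⟨k, hk⟩ := key j i fun h4 => h3 (by rw [h4, zero_mul])
          obtain ⟨k', hk'⟩ := key i j fun h4 => h3 (by rw [h4, mul_zero])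
          exact ((hc k _ hk).2 k' _ hk').1 rfl
        exact LinearMap.congr_fun e3 x
      · simp
  · rintro M N' o o' φ ⟨f, ff, fe, fa, rfl⟩ ⟨f', ff', fe', fa', rfl⟩ hφ
    have p1 : ∀ j x, φ (f j x) = f' j (φ x) := fun j x => by
      simpa [hι'.eq_iff] using hφ (some (ι j)) x
    have p2 : ∀ x, φ ((∑ k, M.a k) x) = (∑ k, N'.a k) (φ x) := fun x => hφ none x
    have key : ∀ (M : Rp K n m) (f : Fin N → End K M.E), (∀ a b, f a * f b = if a = b then f a else 0) →
      (∀ k, M.a k = ∑ x ∈ arr k, f x.1 * M.a k * f x.2) → ∀ k, M.a k = ∑ x ∈ arr k, f x.1 * (∑ k, M.a k) * f x.2 := by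
      intro M f ff fa k
      conv_lhs => rw [fa k]
      refine Finset.sum_congr rfl fun x hx => ?_
      rw [Finset.mul_sum, Finset.sum_mul, Finset.sum_eq_single k]
      · exact fun k' _ hk' => zz M f ff fa k' _ _ fun h => hk' (((hc k x hx).2 k' _ h).2 rfl)
      · simp
    rintro (i | k) x
    · show φ (M.e i x) = N'.e i (φ x)
      rw [fe, fe', LinearMap.sum_apply, LinearMap.sum_apply, map_sum]
      exact Finset.sum_congr rfl fun j _ => p1 j x
    · show φ (M.a k x) = N'.a k (φ x)
      rw [key M f ff fa, key N' f' ff' fa', LinearMap.sum_apply, LinearMap.sum_apply, map_sum]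
      refine Finset.sum_congr rfl fun y _ => ?_
      simp only [Module.End.mul_apply]
      rw [p1, p2, p1]
theorem FB_sub6 (s t : Fin m → Fin n) {P : Rp K n m → Prop} (pv : Fin 6 → Option (Fin n)) (pa : Fin 10 → Option (Fin m))
    (hv : ∀ i, ∃ j, ∀ j', pv j' = some i ↔ j' = j) (ha : ∀ k l, pa k = some l → pv (s6 k) = some (s l) ∧ pv (t6 k) = some (t l))
    (hP : ∀ M, Brick M.op → P M → QC s t M ∧ (∀ b : Fin 10 → End K M.E, (∀ k, b k = (pa k).elim 0 M.a) →
      b 1 * b 0 = 0 ∧ b 0 * b 1 + b 3 * b 2 = 0 ∧ b 2 * b 3 + b 5 * b 4 = 0 ∧ b 4 * b 5 + b 7 * b 6 + b 9 * b 8 = 0 ∧ b 6 * b 7 = 0 ∧ b 8 * b 9 = 0) ∧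
      ∀ l, (∃ k, pa k = some l) ∨ M.a l = 0) : FB P :=
  (FB_sub s t (P := fun M => QC s t M ∧ Rel6 (M.sub pv pa) ∧ ∀ l, (∃ k, pa k = some l) ∨ M.a l = 0) FB6 pv pa hv ha fun _ h => h).mono
    fun M hb h => ⟨(hP M hb h).1, (hP M hb h).2.1 (fun k => (pa k).elim 0 M.a) fun _ => rfl, (hP M hb h).2.2⟩
def Dec {E : Type} [AddCommGroup E] [Module K E] (f : Fin n → End K E) : Prop := (∀ a b, f a * f b = if a = b then f a else 0) ∧ ∑ a, f a = 1
theorem Dec.split {E : Type} [AddCommGroup E] [Module K E] {f : Fin n → End K E} (h : Dec f) (i : Fin n) (A B : Submodule K E)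
    (hA : ∀ x ∈ A, f i x = x) (hB : ∀ x ∈ B, f i x = x) (hAB : ∀ x ∈ A, x ∈ B → x = 0) (hS : ∀ x, f i x ∈ A ⊔ B) :
    ∃ p q : End K E, (∀ x, p x ∈ A) ∧ (∀ x ∈ A, p x = x) ∧ (∀ x ∈ B, p x = 0) ∧ (∀ x, q x ∈ B) ∧ (∀ x ∈ B, q x = x) ∧ (∀ x ∈ A, q x = 0) ∧
      p + q = f i ∧ Dec (Fin.snoc (α := fun _ => End K E) (Function.update f i p) q) := by
  have hf : ∀ x, f i (f i x) = f i x := fun x => by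
    have := LinearMap.congr_fun (h.1 i i) x
    rwa [if_pos rfl] at this
  have hc : IsCompl A (B ⊔ ker (f i)) := by
    constructor
    · rw [Submodule.disjoint_def]
      intro x hx hx'
      obtain ⟨b, hb, k, hk, rfl⟩ := Submodule.mem_sup.mp hx'
      have h1 := hA _ hx
      rw [map_add, hB b hb, LinearMap.mem_ker.mp hk, add_zero] at h1
      rw [← h1] at hx ⊢
      exact hAB b hx hb
    · rw [codisjoint_iff, eq_top_iff]
      intro x _
      have h1 : x = f i x + (x - f i x) := by abel
      rw [h1, ← sup_assoc]
      exact Submodule.add_mem_sup (hS x) (by rw [LinearMap.mem_ker, map_sub, hf, sub_self])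
  set p : End K E := Submodule.projection _ _ hc with hp
  have pA : ∀ x, p x ∈ A := fun x => Submodule.projection_apply_mem hc x
  have pA' : ∀ x ∈ A, p x = x := fun x hx => (Submodule.projection_apply_left hc ⟨x, hx⟩)
  have p0 : ∀ x ∈ B ⊔ ker (f i), p x = 0 := fun x hx => (Submodule.projection_apply_eq_zero_iff hc).mpr hx
  have pB : ∀ x ∈ B, p x = 0 := fun x hx => p0 x (Submodule.mem_sup_left hx)
  have pf : ∀ x, p (f i x) = p x := fun x => by
    have h1 : p (x - f i x) = 0 := p0 _ (Submodule.mem_sup_right (by rw [LinearMap.mem_ker, map_sub, hf, sub_self]))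
    rw [map_sub, sub_eq_zero] at h1
    exact h1.symm
  have qB : ∀ x, (f i - p) x ∈ B := fun x => by
    obtain ⟨a, ha, b, hb, hab⟩ := Submodule.mem_sup.mp (hS x)
    rw [LinearMap.sub_apply, ← pf, ← hab, map_add, pA' a ha, pB b hb, add_zero, add_sub_cancel_left]
    exact hb
  have fp : f i * p = p := LinearMap.ext fun x => hA _ (pA x)
  have pf' : p * f i = p := LinearMap.ext fun x => pf x
  have pp : p * p = p := LinearMap.ext fun x => pA' _ (pA x)
  have ff : f i * f i = f i := LinearMap.ext fun x => hf x
  have z1 : ∀ j, j ≠ i → f j * p = 0 := fun j hj => by rw [← fp, ← mul_assoc, h.1, if_neg hj, zero_mul]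
  have z2 : ∀ j, j ≠ i → p * f j = 0 := fun j hj => by rw [← pf', mul_assoc, h.1, if_neg hj.symm, mul_zero]
  refine ⟨p, f i - p, pA, pA', pB, qB, fun x hx => by rw [LinearMap.sub_apply, hB x hx, pB x hx, sub_zero],
    fun x hx => by rw [LinearMap.sub_apply, hA x hx, pA' x hx, sub_self], by abel, ?_, ?_⟩
  · intro a b
    refine Fin.lastCases ?_ (fun a => ?_) a <;> refine Fin.lastCases ?_ (fun b => ?_) b
    · rw [Fin.snoc_last, if_pos rfl, mul_sub, sub_mul, sub_mul, ff, fp, pf', pp]; abel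
    · rw [Fin.snoc_last, Fin.snoc_castSucc, if_neg (Fin.castSucc_lt_last b).ne']
      by_cases hbi : b = i
      · subst hbi; rw [Function.update_self, sub_mul, fp, pp, sub_self]
      · rw [Function.update_of_ne hbi, sub_mul, h.1, if_neg (Ne.symm hbi), z2 b hbi, sub_zero]
    · rw [Fin.snoc_last, Fin.snoc_castSucc, if_neg (Fin.castSucc_lt_last a).ne]
      by_cases hbi : a = i
      · subst hbi; rw [Function.update_self, mul_sub, pf', pp, sub_self]
      · rw [Function.update_of_ne hbi, mul_sub, h.1, if_neg hbi, z1 a hbi, sub_zero]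
    · rw [Fin.snoc_castSucc, Fin.snoc_castSucc]
      simp only [Fin.castSucc_inj]
      by_cases hai : a = i <;> by_cases hbi : b = i
      · subst hai; subst hbi; simpa using pp
      · subst hai; rw [Function.update_self, Function.update_of_ne hbi, if_neg (Ne.symm hbi), z2 b hbi]
      · subst hbi; rw [Function.update_self, Function.update_of_ne hai, if_neg hai, z1 a hai]
      · rw [Function.update_of_ne hbi, Function.update_of_ne hai, h.1]
  · rw [Fin.sum_univ_castSucc]
    simp only [Fin.snoc_castSucc, Fin.snoc_last]
    rw [Finset.sum_update_of_mem (Finset.mem_univ i), ← h.2, ← Finset.add_sum_erase _ f (Finset.mem_univ i), Finset.erase_eq]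
    abel
end Alg
open Module
section A1
variable {K : Type} [Field K]
theorem FB.split {σ : Type} {P A B : Rep K σ → Prop} (h : ∀ M, Brick M.op → P M → A M ∨ B M) (ha : FB (fun M => P M ∧ A M)) (hb : FB (fun M => P M ∧ B M)) : FB P :=
  (ha.or hb).mono fun M h1 h2 => (h M h1 h2).imp (And.intro h2) (And.intro h2)
theorem rk {n m : ℕ} {M : Rp K n m} (hb : Brick M.op) (z : End K M.E)
    (he : ∀ i x, z (M.e i x) = M.e i (z x)) (ha : ∀ k x, z (M.a k x) = M.a k (z x)) (v : M.E) (hv : v ≠ 0) (hz : z v = 0) (x : M.E) : z x = 0 := by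
  by_contra h0
  refine hv (hb.2 z ?_ (fun h => h0 (by rw [h]; rfl)) (hz.trans (map_zero z).symm))
  rintro (i | k)
  exacts [he i, ha k]
theorem L13 : FB (fun M : Rp K 3 3 => QC ![1, 0, 2] ![1, 1, 1] M ∧ (M.a 0 * M.a 0 = 0 ∧ M.a 0 * M.a 2 = 0) ∧ finrank K M.E ≠ 1) := by
  refine FB.split (A := fun M => M.a 0 = 0) (B := fun M => M.a 0 ≠ 0) (fun M _ _ => em _) ?_ ?_
  · refine FB_sub6 ![1, 0, 2] ![1, 1, 1] ![some 0, some 1, some 2, none, none, none] ![some 1, none, none, some 2, none, none, none, none, none, none] (by decide) (by decide) ?_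
    rintro M hb ⟨⟨h, -⟩, h0⟩
    exact ⟨h, fun b hb => by simp [hb], fun l => by fin_cases l; exacts [Or.inr h0, Or.inl ⟨0, rfl⟩, Or.inl ⟨3, rfl⟩]⟩
  · refine FB_gen ![0, 1, 3, 2] ![0, 1, 2, 1] ![{(3, 1)}, {(1, 0)}, {(3, 2)}] (by decide) (by decide) (by decide) ?_
    rintro M hb ⟨⟨h, ⟨r1, r2⟩, h1⟩, h0⟩
    have r1' := fun x => LinearMap.congr_fun r1 x
    have r2' := fun x => LinearMap.congr_fun r2 x
    simp only [Module.End.mul_apply, LinearMap.zero_apply] at r1' r2'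
    have T := (h.TS hb h1 1).resolve_right fun S => h0 (by
      rw [← h.te 0]; exact S.zero h _ fun k hk => by fin_cases k <;> simp_all)
    have m0 : ∀ x, M.a 0 x ∈ ker (M.a 0) ⊓ range (M.e 1) := fun x => ⟨r1' x, M.a 0 x, by rw [h.ea_x]; rfl⟩
    have m2 : ∀ x, M.a 2 x ∈ ker (M.a 0) ⊓ range (M.e 1) := fun x => ⟨r2' x, M.a 2 x, by rw [h.ea_x]; rfl⟩
    obtain ⟨y, hy⟩ := DFunLike.ne_iff.mp h0
    obtain ⟨p, q, pA, pA', pB, qB, qB', qA, hpq, hD⟩ := Dec.split ⟨h.ee, h.sm⟩ 1 (range (M.a 1)) (ker (M.a 0) ⊓ range (M.e 1))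
      (by rintro _ ⟨x, rfl⟩; rw [h.ea_x]; rfl) (by rintro _ ⟨-, x, rfl⟩; rw [h.e_x]; rfl) (by
        rintro _ ⟨w, rfl⟩ ⟨hw, -⟩
        by_contra hv
        obtain ⟨f, hf, hf'⟩ := exists_dual (ker (M.a 0)) y hy
        simp only [LinearMap.mem_ker, SetLike.mem_coe] at hf' hw
        have f1 : ∀ x, f (M.e 1 x) = f x := fun x => by
          rw [← sub_eq_zero, ← map_sub]; exact hf' _ (by rw [map_sub, h.ae_x]; simp)
        have := rk hb (f.smulRight (M.a 1 w) + f.smulRight (M.e 0 w) * M.a 1)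
          (fun i x => by fin_cases i <;> simp [h.ea_x, h.ae_x, h.e_x, f1, hf']) (fun i x => by fin_cases i <;> simp [h.ea_x, h.ae_x, h.e_x, f1, hf', hw, r1', r2', h.zx]) _ hv
           (by simp [h.ea_x, h.ae_x, h.e_x, f1, hf', hw, r1', r2', h.zx])
        have := congrArg (M.e 1) (this y)
        simp [h.ea_x, h.e_x, hf, hv] at this) (T _ fun k hk x => by
        fin_cases k
        exacts [Submodule.mem_sup_right (m0 x), Submodule.mem_sup_left ⟨x, rfl⟩, Submodule.mem_sup_right (m2 x)])
    have hf : Fin.snoc (α := fun _ => End K M.E) (Function.update M.e 1 p) q = ![M.e 0, p, M.e 2, q] := by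
      funext i; fin_cases i <;> rfl
    rw [hf] at hD
    refine ⟨_, hD.1, hD.2, ?_, ?_⟩
    · rw [fa3]; simp [Finset.sum_filter, Fin.sum_univ_succ, ← hpq]
    · rw [fa3]; simp
      refine ⟨LinearMap.ext fun x => ?_, LinearMap.ext fun x => ?_, LinearMap.ext fun x => ?_⟩
      · have := (h.ae_x 1 0 x).symm.trans (LinearMap.congr_fun (congrArg (M.a 0 * ·) hpq.symm) x)
        simpa [LinearMap.mem_ker.mp (qB x).1, qB' _ (m0 _)] using this
      · simp [pA', h.ae_x]
      · simp [qB' _ (m2 _), h.ae_x]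
theorem FB_dual {n m m' : ℕ} {s t : Fin m → Fin n} {s' t' : Fin m' → Fin n} {Q : Rep K (Fin n ⊕ Fin m') → Prop} {Q' : Rp K n m → Prop}
    (h : FB (fun M => QC s' t' M ∧ Q M ∧ finrank K M.E ≠ 1)) (P : Fin n → Fin n) (A : Fin m' → Fin m) (hP : Function.Bijective P) (hA : Function.Surjective A)
    (hs : ∀ k, P (t' k) = s (A k)) (ht : ∀ k, P (s' k) = t (A k)) (hQ : ∀ M, Q' M → Q ⟨Dual K M.E, fun x => tr (M.op (Sum.map P A x))⟩) :
    FB (fun M => QC s t M ∧ Q' M ∧ finrank K M.E ≠ 1) :=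
  h.dual (Sum.map P A) (Sum.map_surjective.mpr ⟨hP.2, hA⟩) fun M _ hM => ⟨hM.1.dual P hP A s' t' hs ht, hQ M hM.2.1, by
    show finrank K (Dual K M.E) ≠ 1
    rw [Subspace.dual_finrank_eq]; exact hM.2.2⟩
theorem tr_z {E : Type} [AddCommGroup E] [Module K E] {a b : End K E} (h : a * b = 0) : tr b * tr a = 0 := by
  change tr (a * b) = 0
  rw [h]; exact LinearMap.ext fun f => LinearMap.comp_zero f
theorem L13' : FB (fun M : Rp K 3 3 => QC ![1, 1, 1] ![1, 0, 2] M ∧ (M.a 0 * M.a 0 = 0 ∧ M.a 2 * M.a 0 = 0) ∧ finrank K M.E ≠ 1) :=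
  FB_dual L13 id id Function.bijective_id Function.surjective_id (by decide) (by decide) fun _ h => ⟨tr_z h.1, tr_z h.2⟩
def Rep.drop {n m : ℕ} (M : Rp K n m) (k : Fin m) : Rp K n m := M.w (Sum.elim M.e (Function.update M.a k 0))
theorem QC.drop {n m : ℕ} {s t : Fin m → Fin n} {M : Rp K n m} (h : QC s t M) (k : Fin m) : QC s t (M.drop k) :=
  ⟨h.ee, h.sm, fun l => by
    show M.e (t l) * Function.update M.a k 0 l * M.e (s l) = Function.update M.a k 0 l
    by_cases hl : l = k
    · subst hl; simp
    · rw [Function.update_of_ne hl]; exact h.ar l⟩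
theorem FB_drop {n m : ℕ} {P : Rp K n m → Prop} (k : Fin m)
    (h2 : ∀ (M N : Rp K n m) (φ : M.E →ₗ[K] N.E), P M → P N → (∀ i x, φ (M.e i x) = N.e i (φ x)) → (∀ l, l ≠ k → ∀ x, φ (M.a l x) = N.a l (φ x)) →
      ∀ x, φ (M.a k x) = N.a k (φ x)) {Q : Rp K n m → Prop} (h1 : ∀ M, P M → Q (M.drop k)) (h : FB Q) : FB P := by
  refine h.same (fun M o => P M ∧ o = (M.drop k).op) (fun M _ hM => ⟨_, h1 M hM, hM, rfl⟩) ?_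
  rintro M N _ _ φ ⟨hM, rfl⟩ ⟨hN, rfl⟩ hφ
  have e1 : ∀ l, l ≠ k → ∀ x, φ (M.a l x) = N.a l (φ x) := fun l hl x => by
    have := hφ (Sum.inr l) x
    simpa [Rep.drop, Rep.w, hl] using this
  rintro (i | l) x
  · exact hφ (Sum.inl i) x
  · by_cases hl : l = k
    · subst hl; exact h2 M N φ hM hN (fun i => hφ (Sum.inl i)) e1 x
    · exact e1 l hl x
theorem FB56 : FB (fun M : Rp K 2 3 => QC sG tG M ∧ (M.a 0 * M.a 0 = 0 ∧ M.a 1 * M.a 2 = 0 ∧ M.a 2 * M.a 1 = 0 ∧ M.a 2 * M.a 0 * M.a 1 = 0) ∧ finrank K M.E ≠ 1) := by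
  refine FB.split (A := fun M => M.a 1 = 0) (B := fun M => M.a 2 = 0) (fun M hb h => h.1.dich hb h.2.2 1 1 2 (by decide) (by decide) h.2.1.2.1 rfl rfl) ?_ ?_
  · refine FB_sub sG tG L13' ![some 1, some 0, none] ![some 0, some 2, none] (by decide) (by decide) fun M h => ⟨h.1.1, ⟨⟨h.1.2.1.1, zero_mul _⟩, h.1.2.2⟩, fun l => ?_⟩
    fin_cases l
    exacts [Or.inl ⟨0, rfl⟩, Or.inr h.2, Or.inl ⟨1, rfl⟩]
  · refine FB_sub sG tG L13 ![some 1, some 0, none] ![some 0, some 1, none] (by decide) (by decide) fun M h => ⟨h.1.1, ⟨⟨h.1.2.1.1, mul_zero _⟩, h.1.2.2⟩, fun l => ?_⟩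
    fin_cases l
    exacts [Or.inl ⟨0, rfl⟩, Or.inl ⟨1, rfl⟩, Or.inr h.2]
theorem bridge4 {n m : ℕ} {r : FreeAlgebra K (Fin (n + m)) → FreeAlgebra K (Fin (n + m)) → Prop} (s t : Fin m → Fin n)
    (Q₀ Q' : ∀ (B : Type) [Ring B] [Algebra K B], (Fin m → B) → Prop) (Z : ∀ (B : Type) [Ring B] [Algebra K B], (Fin m → B) → List B) (L : ℕ)
    (hq : ∀ (B : Type) [Ring B] [Algebra K B] (e : Fin n → B) (a : Fin m → B), PA s t e a → Q₀ B a → ((∀ p, NN a L p) ∧ ∀ z ∈ Z B a, CN e a z) ∧ ((∀ z ∈ Z B a, z = 0) → Q' B a))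
    (hFB : FB (fun M : Rp K n m => QC s t M ∧ Q' (End K M.E) M.a ∧ finrank K M.E ≠ 1))
    (hr : ∀ (B : Type) [Ring B] [Algebra K B] (g : Fin (n + m) → B), (∀ u v, r u v → FreeAlgebra.lift K g u = FreeAlgebra.lift K g v) →
      PA s t (fun i => g (Fin.castAdd m i)) (fun k => g (Fin.natAdd n k)) ∧ Q₀ B (fun k => g (Fin.natAdd n k)) := by
        intro B _ _ g H
        have H' := fun p : _ × _ => H p.1 p.2
        simp only [A3Rel, A4Rel, A5Rel, A6Rel, A7Rel, A8Rel, A9Rel, A10Rel, A11Rel, A12Rel, A13Rel, A14Rel, A15Rel, A16Rel, List.forall_mem_cons, map_mul, FreeAlgebra.lift_ι_apply, map_add, map_one, map_zero] at H'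
        refine ⟨⟨?_, ?_, ?_⟩, ?_⟩
        all_goals simp [Fin.forall_fin_succ, Fin.sum_univ_succ]
        all_goals grind) :
    IsTauTiltingFinite (RingQuot r) :=
  bridge2 s t Q₀ (fun B _ _ a => ∀ e, PA s t e a → ((∀ p, NN a L p) ∧ ∀ z ∈ Z B a, CN e a z) ∧ ((∀ z ∈ Z B a, z = 0) → Q' B a)) Q' Z hr (fun B _ _ _ a _ q e h => hq B e a h q) L
    (fun _ _ _ e _ h q => (q e h).1) (fun _ _ _ e _ h _ q => (q e h).2) hFB
theorem bq {n m L : ℕ} {s t : Fin m → Fin n} {B : Type} [Ring B] {e : Fin n → B} {a : Fin m → B} {Q Q' : Prop} {Z : List B} (h : PA s t e a) (q : Q) (hz : (∀ z ∈ Z, z = 0) → Q')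
    (hN : PA s t e a → Q → (∀ p, NN a L p) ∧ ∀ z ∈ Z, CN e a z := by
        intro h q
        refine ⟨fun p => ?_, ?_⟩
        · simp (decide := true) only [NN3, NN4, NN5, NN6, zero_mul, and_self, q, h.z, NN0, neg_mul, sub_mul, neg_zero, sub_self]
        · simp (decide := true) only [CN, List.forall_mem_cons, fa2, fa3, fa4, fa5, fa6, mul_add, add_mul, mul_sub, sub_mul, ← mul_assoc, zero_mul, mul_zero, and_self, q, h.z, h.ea, h.ae,
            add_zero, zero_add, sub_zero, zero_sub, if_true, if_false, implies_true, sub_self, true_and, and_true, neg_mul, mul_neg, neg_zero, neg_neg, List.not_mem_nil, false_imp_iff]) : ((∀ p, NN a L p) ∧ ∀ z ∈ Z, CN e a z) ∧ ((∀ z ∈ Z, z = 0) → Q') := ⟨hN h q, hz⟩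
end A1
section A1
variable {K : Type} [Field K]
theorem FL {n m c : ℕ} {s t : Fin m → Fin n} {Q : Rp K n m → Prop} (pv : Fin c → Fin 6 → Option (Fin n)) (pa : Fin c → Fin 10 → Option (Fin m))
    (hP : ∀ M, Brick M.op → QC s t M → Q M → ∃ x, (∀ b : Fin 10 → End K M.E, (∀ k, b k = (pa x k).elim 0 M.a) →
      b 1 * b 0 = 0 ∧ b 0 * b 1 + b 3 * b 2 = 0 ∧ b 2 * b 3 + b 5 * b 4 = 0 ∧ b 4 * b 5 + b 7 * b 6 + b 9 * b 8 = 0 ∧ b 6 * b 7 = 0 ∧ b 8 * b 9 = 0) ∧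
      ∀ l, (∃ k, pa x k = some l) ∨ M.a l = 0)
    (hv : ∀ x i, ∃ j, ∀ j', pv x j' = some i ↔ j' = j := by decide) (ha : ∀ x k l, pa x k = some l → pv x (s6 k) = some (s l) ∧ pv x (t6 k) = some (t l) := by decide) :
    FB (fun M => QC s t M ∧ Q M) := (FB.union fun x => FB_sub6 s t (pv x) (pa x) (hv x) (ha x) fun _ _ h => h).mono fun M hb h =>
      (hP M hb h.1 h.2).imp fun _ => And.intro h.1
theorem Tt.az {n m : ℕ} {s t : Fin m → Fin n} {M : Rp K n m} {i} (T : Tt t M i) (h : QC s t M) (l) (hl : s l = i) (hg : ∀ k, t k = i → M.a l * M.a k = 0) : M.a l = 0 := by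
  rw [← h.se l, hl]; exact T.zero _ hg
theorem Ss.az {n m : ℕ} {s t : Fin m → Fin n} {M : Rp K n m} {i} (T : Ss s M i) (h : QC s t M) (l) (hl : t l = i) (hg : ∀ k, s k = i → M.a k * M.a l = 0) : M.a l = 0 := by
  rw [← h.te l, hl]; exact T.zero h _ hg
theorem FB_W {n m N : ℕ} {s t : Fin m → Fin n} {P : Rp K n m → Prop} (ι : Fin N → Fin 6) (pv : Fin N → Fin n) (g : Fin m → Fin N → Option (Fin N))
    (hP : ∀ M, Brick M.op → QC s t M → P M → ∃ W : Fin N → Submodule K M.E, (∀ j, ∀ x ∈ W j, M.e (pv j) x = x) ∧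
      (∀ U : Submodule K M.E, (∀ j, ∀ x ∈ W j, x ∈ U) → ∀ i x, M.e i x ∈ U) ∧ (∀ w : Fin N → M.E, (∀ j, w j ∈ W j) → (∀ i, ∑ j with pv j = i, w j = 0) → ∀ j, w j = 0) ∧
      ∀ k j, s k = pv j → ∀ x ∈ W j, (g k j).elim (M.a k x = 0) fun j' => M.a k x ∈ W j')
    (hι : ∀ j j', ι j = ι j' → j = j' := by decide) (hc1 : ∀ k j j', g k j = some j' → adj6 (ι j') (ι j) := by decide)
    (hc2 : ∀ k j j', g k j = some j' → ∀ k', g k' j' ≠ some j ∧ (g k' j = some j' → k' = k) := by decide) : FB (fun M => QC s t M ∧ P M) := by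
  refine FB_gen ι pv (fun k => Finset.univ.filter fun x => g k x.2 = some x.1) hι (fun k x hx => hc1 k _ _ (by simpa using hx)) (fun k x hx k' y hy => ?_) ?_
  · simp only [Finset.mem_filter, Finset.mem_univ, true_and] at hx hy
    refine ⟨?_, ?_⟩
    · rintro rfl; exact (hc2 k _ _ hx k').1 hy
    · rintro rfl; exact (hc2 k _ _ hx k').2 hy
  rintro M hb ⟨h, hM⟩
  obtain ⟨W, w1, w2, w3, w4⟩ := hP M hb h hM
  have e0 : ∀ j i, ∀ x ∈ W j, M.e i x = if pv j = i then x else 0 := fun j i x hx => by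
    conv_lhs => rw [← w1 j x hx, h.e_x]
    split_ifs with h1 h2 h2
    exacts [by rw [h1, w1 j x hx], absurd h1.symm h2, absurd h2.symm h1, rfl]
  let Φ : (∀ j, W j) →ₗ[K] M.E := ∑ j, (W j).subtype ∘ₗ LinearMap.proj j
  have Φx : ∀ w, Φ w = ∑ j, (w j : M.E) := fun w => by simp [Φ]
  have hΦ : Function.Bijective Φ := by
    refine ⟨(injective_iff_map_eq_zero _).mpr fun w hw => funext fun j => Subtype.ext (w3 (fun j => w j) (fun j => (w j).2) (fun i => ?_) j), fun x => ?_⟩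
    · have := congrArg (M.e i) hw
      rw [Φx, map_sum, map_zero, Finset.sum_congr rfl fun j _ => e0 j i _ (w j).2] at this
      rw [← this, Finset.sum_filter]
    · have : x = ∑ i, M.e i x := by
        have := LinearMap.congr_fun h.sm x
        simpa using this.symm
      rw [this]
      exact Submodule.sum_mem (range Φ) fun i _ => w2 (range Φ) (fun j x hx => ⟨Pi.single j ⟨x, hx⟩, by
        rw [Φx, Finset.sum_eq_single j (fun b _ hb => by rw [Pi.single_eq_of_ne hb]; rfl) (by simp), Pi.single_eq_same]⟩) i x
  let Ψ := LinearEquiv.ofBijective Φ hΦ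
  let f : Fin N → End K M.E := fun j => (W j).subtype ∘ₗ LinearMap.proj j ∘ₗ Ψ.symm.toLinearMap
  have f1 : ∀ x, ∑ j, f j x = x := fun x => by
    have := Ψ.apply_symm_apply x
    exact (Φx _).symm.trans this
  have fm : ∀ j x, f j x ∈ W j := fun j x => ((Ψ.symm x) j).2
  have f2 : ∀ j j', ∀ x ∈ W j, f j' x = if j' = j then x else 0 := fun j j' x hx => by
    have : Ψ.symm x = Pi.single j ⟨x, hx⟩ := by
      rw [LinearEquiv.symm_apply_eq]
      change _ = Φ _
      rw [Φx, Finset.sum_eq_single j (fun b _ hb => by rw [Pi.single_eq_of_ne hb]; rfl) (by simp), Pi.single_eq_same]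
    change ((Ψ.symm x) j' : M.E) = _
    rw [this]
    split_ifs with hj
    · subst hj; rw [Pi.single_eq_same]
    · rw [Pi.single_eq_of_ne hj]; rfl
  refine ⟨f, fun a b => LinearMap.ext fun x => ?_, LinearMap.ext fun x => by simp [f1], fun i => LinearMap.ext fun x => ?_, fun k => LinearMap.ext fun x => ?_⟩
  · rw [Module.End.mul_apply, f2 b a _ (fm b x)]; split_ifs with hab
    exacts [by rw [hab], rfl]
  · conv_lhs => rw [← f1 x]
    rw [map_sum, Finset.sum_congr rfl fun j _ => e0 j i _ (fm j x), LinearMap.sum_apply, Finset.sum_filter]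
  · conv_lhs => rw [← f1 x]
    rw [map_sum, LinearMap.sum_apply, Finset.sum_filter, Fintype.sum_prod_type, Finset.sum_comm]
    refine Finset.sum_congr rfl fun j _ => ?_
    simp only [Module.End.mul_apply]
    have hy := fm j x
    generalize f j x = y at hy
    have key : (g k j).elim (M.a k y = 0) fun j' => M.a k y ∈ W j' := by
      by_cases hs : s k = pv j
      · exact w4 k j hs y hy
      · have : M.a k y = 0 := by rw [← w1 j y hy, h.ae_x, if_neg (Ne.symm hs)]
        rw [this]; cases g k j <;> simp
    cases hg : g k j with
    | none => rw [hg] at key; simp [show M.a k y = 0 from key]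
    | some j' => rw [hg] at key; simp [f2 j' _ _ key]
theorem QC.ro {n m : ℕ} {s t : Fin m → Fin n} {M : Rp K n m} (h : QC s t M) (hb : Brick M.op) (v : Fin n → M.E) (f : Fin n → Dual K M.E)
    (hv : ∀ i, M.e i (v i) = v i) (hf : ∀ k x, f (t k) (M.a k x) • v (t k) = f (s k) (M.e (s k) x) • M.a k (v (s k)))
    (i u) (hu : M.e i u = u) (u0 : u ≠ 0) (h0 : f i u = 0) (j y) (hy : f j (M.e j y) ≠ 0) : v j = 0 := by
  have e0 : ∀ i j, M.e i (v j) = if i = j then v i else 0 := fun i j => by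
    rw [← hv j, h.e_x]; split_ifs with e
    exacts [by rw [← e, hv], rfl]
  have a0 : ∀ k j, M.a k (v j) = if j = s k then M.a k (v j) else 0 := fun k j => by
    conv_lhs => rw [← hv j, h.ae_x]
  have := rk hb (∑ i, (f i).smulRight (v i) * M.e i) (fun i x => ?_) (fun k x => ?_) u u0 ?_ (M.e j y)
  · simp [LinearMap.sum_apply, h.e_x, apply_ite, ite_smul] at this
    simpa [hy] using this
  · simp [LinearMap.sum_apply, h.e_x, e0, apply_ite, ite_smul]
  · simp [LinearMap.sum_apply, h.ea_x, apply_ite, ite_smul]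
    rw [hf, Finset.sum_eq_single (s k) (fun b _ hb => by rw [a0, if_neg hb, smul_zero]) (by simp)]
  · have eu : ∀ l, M.e l u = if l = i then u else 0 := fun l => by
      conv_lhs => rw [← hu, h.e_x]
      split_ifs with e
      exacts [by rw [e, hu], rfl]
    simp [LinearMap.sum_apply, eu, apply_ite, ite_smul, h0]
theorem QC.mr {n m : ℕ} {s t : Fin m → Fin n} {M : Rp K n m} (h : QC s t M) (k x i) (hi : t k = i) : ∃ y, M.e i y = M.a k x :=
  ⟨M.a k x, by rw [h.ea_x, if_pos hi.symm]⟩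
theorem add0 {E : Type} [AddCommGroup E] [Module K E] {A B : Submodule K E} (h : ∀ x ∈ A, x ∈ B → x = 0) {x y : E} (hx : x ∈ A) (hy : y ∈ B) (hxy : x + y = 0) : x = 0 ∧ y = 0 := by
  have : x = 0 := h x hx (by rw [eq_neg_of_add_eq_zero_left hxy]; exact B.neg_mem hy)
  exact ⟨this, by simpa [this] using hxy⟩
theorem ax {E : Type} [AddCommGroup E] [Module K E] {a b : End K E} (h : a * b = 0) (x) : a (b x) = 0 := LinearMap.congr_fun h x
theorem tr_mul {E : Type} [AddCommGroup E] [Module K E] (a b : End K E) : tr (a * b) = tr b * tr a := rfl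
theorem LX : FB (fun M : Rp K 3 3 => QC sE tE M ∧ M.a 2 * M.a 1 * M.a 2 = 0 ∧ (∀ v, M.e 2 v = v → M.a 1 v = 0 → v = 0)) := by
  have L : FB (fun M : Rp K 3 3 => QC sE tE M ∧ M.a 2 = 0) := by
    refine FL ![![some 0, some 1, some 2, none, none, none]] ![![some 0, none, none, some 1, none, none, none, none, none, none]] fun M hb h r => ⟨0, ?_⟩
    exact ⟨fun b hb => by simp [hb], fun l => by fin_cases l <;> first | exact .inl (by decide) | exact .inr r⟩
  have W : FB (fun M : Rp K 3 3 => QC sE tE M ∧ M.a 2 * M.a 1 * M.a 2 = 0 ∧ (∀ v, M.e 2 v = v → M.a 1 v = 0 → v = 0) ∧ M.a 2 ≠ 0) := by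
    refine FB_W ![4, 3, 1, 2, 5] ![0, 1, 1, 2, 2] ![![some 1, none, none, none, none], ![none, none, none, some 2, some 1], ![none, some 3, none, none, none]] fun M hb h ⟨r, c0, h0⟩ => ?_
    have r' := ax r
    simp only [Module.End.mul_apply] at r'
    have I : ∀ x ∈ range (M.a 0), x ∈ range (M.a 1 * M.a 2) → x = 0 := by
      rintro _ ⟨w, rfl⟩ ⟨w', hw'⟩
      by_contra hv
      obtain ⟨y, hy⟩ := DFunLike.ne_iff.mp h0
      obtain ⟨f, hf, hf'⟩ := exists_dual (ker (M.a 2)) (M.e 1 y) (by simpa [h.ae_x] using hy)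
      have f1 : ∀ x, f (M.a 1 (M.a 2 x)) = 0 := fun x => hf' _ (r' x)
      rw [Module.End.mul_apply] at hw'
      refine hv (h.ro hb ![M.e 0 w, M.a 0 w, M.a 2 w'] ![f ∘ₗ M.a 0, f, f ∘ₗ M.a 1] (fun i => by fin_cases i <;> simp [h.e_x, h.ea_x]) (fun k x => ?_) 1 (M.a 0 w) (by simp [h.ea_x]) hv (by simp [← hw', f1]) 1 y hf)
      fin_cases k <;> simp [h.ae_x, h.e_x, f1, ← hw', r']
    have J : ∀ x, M.e 1 x ∈ range (M.a 0) ⊔ range (M.a 1 * M.a 2) := by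
      intro y
      by_contra hy
      obtain ⟨f, hf, hf'⟩ := exists_dual _ _ hy
      have f0 : ∀ x, f (M.a 0 x) = 0 := fun x => hf' _ (Submodule.mem_sup_left ⟨x, rfl⟩)
      have f1 : ∀ x, f (M.a 1 (M.a 2 x)) = 0 := fun x => hf' _ (Submodule.mem_sup_right ⟨x, rfl⟩)
      obtain ⟨w, hw⟩ := DFunLike.ne_iff.mp h0
      have hv : M.a 1 (M.a 2 w) ≠ 0 := fun h2 => hw (c0 _ (by simp [h.ea_x]) h2)
      refine hv (h.ro hb ![0, M.a 1 (M.a 2 w), M.a 2 w] ![0, f, f ∘ₗ M.a 1] (fun i => by fin_cases i <;> simp [h.e_x, h.ea_x]) (fun k x => ?_) 1 _ (by simp [h.ea_x]) hv (f1 _) 1 y hf)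
      fin_cases k <;> simp [h.ae_x, h.e_x, f1, f0, r']
    refine ⟨![range (M.e 0), range (M.a 0), range (M.a 1 * M.a 2), range (M.a 2), (range (M.a 0)).comap (M.a 1) ⊓ range (M.e 2)], fun j x hx => ?_, fun U hU => ?_, fun w hw hs => ?_, fun k j hk x hx => ?_⟩
    · fin_cases j
      on_goal 5 => obtain ⟨y, rfl⟩ := hx.2
      rotate_left 1
      all_goals (try obtain ⟨y, rfl⟩ := hx); simp [h.e_x, h.ea_x]
    · refine (fa3 _).mpr ⟨fun x => hU 0 _ ⟨x, rfl⟩, fun x => ?_, fun x => ?_⟩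
      · exact (sup_le (hU 1) (hU 2) : range (M.a 0) ⊔ range (M.a 1 * M.a 2) ≤ U) (J x)
      · obtain ⟨_, ⟨w, rfl⟩, _, ⟨y, rfl⟩, hwy⟩ := Submodule.mem_sup.mp (J (M.a 1 x))
        have : M.e 2 x = M.a 2 y + (M.e 2 x - M.a 2 y) := by abel
        rw [this]
        refine U.add_mem (hU 3 _ ⟨y, rfl⟩) (hU 4 _ ⟨⟨w, ?_⟩, x - M.a 2 y, by simp [h.ea_x]⟩)
        simp [h.ea_x] at hwy
        simp [h.ae_x, ← hwy]
    · simp [fa3, Finset.sum_filter, Fin.sum_univ_succ] at hs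
      have A := add0 I (hw 1) (hw 2) hs.2.1
      have B := add0 (A := range (M.a 2)) (B := (range (M.a 0)).comap (M.a 1) ⊓ range (M.e 2)) (by
        rintro _ ⟨x, rfl⟩ ⟨hx, -⟩
        exact c0 _ (by simp [h.ea_x]) (I _ hx ⟨x, rfl⟩)) (hw 3) (hw 4) hs.2.2
      exact (fa5 _).mpr ⟨hs.1, A.1, A.2, B.1, B.2⟩
    · fin_cases k <;> fin_cases j <;> (try exact absurd hk (by decide)) <;>
      first | exact hx.1 | exact ⟨x, rfl⟩ | (obtain ⟨y, rfl⟩ := hx; first | exact ⟨y, rfl⟩ | exact r' y)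
  exact (L.or W).mono fun M hb ⟨h, r, c⟩ => (em (M.a 2 = 0)).imp (fun h0 => ⟨h, h0⟩) fun h0 => ⟨h, r, c, h0⟩
theorem LY : FB (fun M : Rp K 3 3 => QC sE tE M ∧ M.a 1 * M.a 2 * M.a 1 = 0 ∧ (∀ U : Submodule K M.E, (∀ x, M.a 2 x ∈ U) → ∀ x, M.e 2 x ∈ U) ∧ finrank K M.E ≠ 1) := by
  have L : FB (fun M : Rp K 3 3 => QC sE tE M ∧ M.a 1 = 0) := by
    refine FL ![![some 0, some 1, some 2, none, none, none]] ![![some 0, none, some 2, none, none, none, none, none, none, none]] fun M hb h r => ⟨0, ?_⟩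
    exact ⟨fun b hb => by simp [hb], fun l => by fin_cases l <;> first | exact .inl (by decide) | exact .inr r⟩
  have W : FB (fun M : Rp K 3 3 => QC sE tE M ∧ M.a 1 * M.a 2 * M.a 1 = 0 ∧ (∀ U : Submodule K M.E, (∀ x, M.a 2 x ∈ U) → ∀ x, M.e 2 x ∈ U) ∧ M.a 1 ≠ 0 ∧ (Tt ![1, 1, 2] M 1 ∨ Ss ![0, 2, 1] M 1)) := by
    refine FB_W ![0, 1, 3, 2, 4] ![0, 1, 1, 2, 2] ![![some 1, none, none, none, none], ![none, none, none, some 2, none], ![none, some 3, some 4, none, none]] fun M hb h ⟨r, c0, h0, TS⟩ => ?_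
    have r' := ax r
    simp only [Module.End.mul_apply] at r'
    obtain ⟨w0, hw0⟩ := DFunLike.ne_iff.mp h0
    have I : ∀ x ∈ range (M.a 0), x ∈ range (M.a 1) → x = 0 := by
      rintro _ ⟨w, rfl⟩ ⟨w', hw'⟩
      by_contra hv
      obtain ⟨y, hy⟩ : ∃ y, M.a 1 (M.a 2 y) ≠ 0 := by
        by_contra! hy
        have := c0 (ker (M.a 1)) hy w0
        simp [h.ae_x] at this
        exact hw0 this
      obtain ⟨f, hf, hf'⟩ := exists_dual (ker (M.a 1 * M.a 2)) (M.e 1 y) (by simpa [h.ae_x] using hy)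
      obtain ⟨g, hg⟩ := factor (M.a 2) f fun x hx => hf' x (by simp [hx])
      have f1 : ∀ x, f (M.a 1 x) = 0 := fun x => hf' _ (r' x)
      have fe : ∀ x, f (M.e 1 x) = f x := fun x => by rw [← hg, ← hg, h.ae_x]; rfl
      refine hv (h.ro hb ![M.e 0 w, M.a 0 w, M.a 2 (M.a 0 w)] ![f ∘ₗ M.a 0, f, g] (fun i => by fin_cases i <;> simp [h.e_x, h.ea_x]) (fun k x => ?_) 1 (M.a 0 w) (by simp [h.ea_x]) hv (by simp [← hw', f1]) 1 y hf)
      fin_cases k <;> simp [h.ae_x, h.e_x, f1, ← hw', r', fe, hg]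
    have J : ∀ x, M.e 1 x ∈ range (M.a 0) ⊔ range (M.a 1) := by
      intro y
      rcases TS with T | S
      · exact T _ (fun k hk x => by
          fin_cases k
          exacts [Submodule.mem_sup_left ⟨x, rfl⟩, Submodule.mem_sup_right ⟨x, rfl⟩, absurd hk (by decide)]) y
      by_contra hy
      obtain ⟨f, hf, hf'⟩ := exists_dual _ _ hy
      obtain ⟨g, hg⟩ := factor (M.a 2) (f ∘ₗ M.e 1) fun x hx => by
        have := S (M.e 1 x) (by simp [h.e_x]) fun k hk => by
          fin_cases k
          exacts [absurd hk (by decide), absurd hk (by decide), by simpa [h.ae_x] using hx]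
        simp [this]
      have f0 : ∀ x, f (M.a 0 x) = 0 := fun x => hf' _ (Submodule.mem_sup_left ⟨x, rfl⟩)
      have f1 : ∀ x, f (M.a 1 x) = 0 := fun x => hf' _ (Submodule.mem_sup_right ⟨x, rfl⟩)
      refine hw0 (h.ro hb ![0, M.a 1 w0, M.a 2 (M.a 1 w0)] ![0, f, g] (fun i => by fin_cases i <;> simp [h.e_x, h.ea_x]) (fun k x => ?_) 1 _ (by simp [h.ea_x]) hw0 (f1 _) 1 y hf)
      fin_cases k <;> simp [h.ae_x, h.e_x, f1, f0, r', hg]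
    have I' : ∀ x ∈ range (M.a 2 * M.a 0), x ∈ range (M.a 2 * M.a 1) → x = 0 := by
      rintro _ ⟨w, rfl⟩ ⟨w', hw'⟩
      simp only [Module.End.mul_apply] at hw' ⊢
      by_contra hv
      obtain ⟨f, hf, hf'⟩ := exists_dual (ker (M.a 1)) (M.e 2 w0) (by simpa [h.ae_x] using hw0)
      have f1 : ∀ x, f (M.a 2 (M.a 1 x)) = 0 := fun x => hf' _ (r' x)
      refine hv (h.ro hb ![M.e 0 w, M.a 0 w, M.a 2 (M.a 0 w)] ![f ∘ₗ M.a 2 ∘ₗ M.a 0, f ∘ₗ M.a 2, f] (fun i => by fin_cases i <;> simp [h.e_x, h.ea_x]) (fun k x => ?_) 2 (M.a 2 (M.a 0 w)) (by simp [h.ea_x]) hv (by simp [← hw', f1]) 2 w0 hf)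
      fin_cases k <;> simp [h.ae_x, h.e_x, f1, ← hw', r']
    refine ⟨![range (M.e 0), range (M.a 0), range (M.a 1), range (M.a 2 * M.a 0), range (M.a 2 * M.a 1)], fun j x hx => ?_, fun U hU => ?_, fun w hw hs => ?_, fun k j hk x hx => ?_⟩
    · fin_cases j <;> obtain ⟨y, rfl⟩ := hx <;> simp [h.e_x, h.ea_x]
    · refine (fa3 _).mpr ⟨fun x => hU 0 _ ⟨x, rfl⟩, fun x => ?_, c0 U fun x => ?_⟩
      · exact (sup_le (hU 1) (hU 2) : range (M.a 0) ⊔ range (M.a 1) ≤ U) (J x)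
      · obtain ⟨_, ⟨w, rfl⟩, _, ⟨y, rfl⟩, hwy⟩ := Submodule.mem_sup.mp (J x)
        have : M.a 2 x = M.a 2 (M.e 1 x) := by simp [h.ae_x]
        rw [this, ← hwy, map_add]
        exact U.add_mem (hU 3 _ ⟨w, rfl⟩) (hU 4 _ ⟨y, rfl⟩)
    · simp [fa3, Finset.sum_filter, Fin.sum_univ_succ] at hs
      have A := add0 I (hw 1) (hw 2) hs.2.1
      have B := add0 I' (hw 3) (hw 4) hs.2.2
      exact (fa5 _).mpr ⟨hs.1, A.1, A.2, B.1, B.2⟩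
    · fin_cases k <;> fin_cases j <;> (try exact absurd hk (by decide)) <;>
      first | exact ⟨x, rfl⟩ | (obtain ⟨y, rfl⟩ := hx; first | exact ⟨y, rfl⟩ | exact r' y)
  exact (L.or W).mono fun M hb ⟨h, r, c, h1⟩ => (em (M.a 1 = 0)).imp (fun h0 => ⟨h, h0⟩) fun h0 => ⟨h, r, c, h0, h.TS hb h1 1⟩
theorem FB_A8 : FB (fun M : Rp K 4 6 => QC ![1, 2, 3, 0, 2, 0] ![0, 1, 2, 3, 0, 2] M ∧ (M.a 4 * M.a 5 = 0 ∧ M.a 5 * M.a 4 = 0 ∧ M.a 0 * M.a 1 = 0 ∧ M.a 2 * M.a 3 = 0) ∧ finrank K M.E ≠ 1) := by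
  refine FL ![![some 1, some 2, some 0, some 3, none, none], ![none, none, some 1, some 2, some 3, some 0], ![none, none, some 1, some 0, some 3, some 2], ![some 1, some 0, some 2, some 3, none, none]] ![![none, some 1, some 4, some 5, some 3, none, none, none, none, none], ![none, none, none, none, none, some 1, none, some 2, some 4, some 5], ![none, none, none, none, some 0, none, some 3, none, some 5, some 4], ![some 0, none, some 5, some 4, none, some 2, none, none, none, none]] fun M hb h ⟨r, h1⟩ => ?_
  rcases h.dich hb h1 1 0 1 (by decide) (by decide) r.2.2.1 rfl rfl with u | u <;>
  rcases h.dich hb h1 3 2 3 (by decide) (by decide) r.2.2.2 rfl rfl with v | v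
  on_goal 1 => use 0
  on_goal 2 => use 1
  on_goal 3 => use 2
  on_goal 4 => use 3
  all_goals exact ⟨fun b hb => by simp [hb, r, u, v], fun l => by fin_cases l <;> first | exact .inl (by decide) | exact .inr u | exact .inr v⟩
theorem FB_A9 : FB (fun M : Rp K 4 6 => QC ![1, 2, 1, 3, 2, 0] ![0, 1, 2, 2, 3, 3] M ∧ (M.a 5 * M.a 0 = M.a 4 * M.a 2 ∧ M.a 1 * M.a 2 = 0 ∧ M.a 2 * M.a 1 = 0 ∧ M.a 3 * M.a 4 = 0 ∧ M.a 4 * M.a 3 = 0) ∧ finrank K M.E ≠ 1) := by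
  have L (k : Fin 6) (hk : k = 0 ∨ k = 5) : FB (fun M : Rp K 4 6 => QC ![1, 2, 1, 3, 2, 0] ![0, 1, 2, 2, 3, 3] M ∧ (M.a 1 * M.a 2 = 0 ∧ M.a 2 * M.a 1 = 0 ∧ M.a 3 * M.a 4 = 0 ∧ M.a 4 * M.a 3 = 0) ∧ M.a k = 0) := by
    refine FL ![![some 1, some 2, some 3, some 0, none, none], ![some 0, some 1, some 2, some 3, none, none]] ![![some 2, some 1, some 4, some 3, none, some 5, none, none, none, none], ![none, some 0, some 2, some 1, some 4, some 3, none, none, none, none]] fun M hb h ⟨r, h0⟩ => ?_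
    rcases hk with rfl | rfl
    on_goal 1 => use 0
    on_goal 2 => use 1
    all_goals exact ⟨fun b hb => by simp [hb, r], fun l => by fin_cases l <;> first | exact .inl (by decide) | exact .inr h0⟩
  refine FB.split (fun M hb h => h.1.TS hb h.2.2 0) (FB_drop 5 (fun M N φ hM hN he ha x => ?_) (fun M h => ⟨h.1.1.drop 5, h.1.2.1.2, Function.update_self 5 0 M.a⟩) (L 5 (by decide)))
    (FB_drop 0 (fun M N φ hM hN he ha x => ?_) (fun M h => ⟨h.1.1.drop 0, h.1.2.1.2, Function.update_self 0 0 M.a⟩) (L 0 (by decide)))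
  all_goals
    have q1 := fun x => LinearMap.congr_fun hM.1.2.1.1 x
    have q2 := fun x => LinearMap.congr_fun hN.1.2.1.1 x
    simp only [Module.End.mul_apply] at q1 q2
  · have := hM.2 (ker (φ ∘ₗ M.a 5 - N.a 5 ∘ₗ φ)) (fun k hk x => by
      fin_cases k <;> revert hk <;> simp
      rw [q1, ha 4 (by decide), ha 2 (by decide), ha 0 (by decide), q2, sub_self]) x
    simpa [hM.1.1.ae_x, hN.1.1.ae_x, he, sub_eq_zero] using this
  · have := hN.2 (N.a 0 (φ x) - φ (M.a 0 x)) (by rw [map_sub, ← he, hN.1.1.ea_x, hM.1.1.ea_x]; rfl) (fun k hk => by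
      fin_cases k <;> revert hk <;> simp
      rw [q2, ← ha 5 (by decide), q1, ha 4 (by decide), ha 2 (by decide), sub_self])
    exact (sub_eq_zero.mp this).symm
theorem X10 : FB (fun M : Rp K 4 5 => QC sF tF M ∧ (M.a 0 = 0 ∧ M.a 4 * M.a 2 * M.a 3 = 0) ∧ finrank K M.E ≠ 1) := by
  have L : FB (fun M : Rp K 4 5 => QC sF tF M ∧ M.a 0 = 0 ∧ (M.a 2 = 0 ∨ M.a 4 = 0 ∨ M.a 3 = 0)) := by
    refine FL ![![some 0, some 1, some 3, some 2, none, none], ![some 0, some 1, some 2, some 3, none, none], ![none, none, some 0, some 1, some 2, some 3]] ![![some 1, none, some 4, none, some 3, none, none, none, none, none], ![some 1, none, none, some 2, none, some 3, none, none, none, none], ![none, none, none, none, some 1, none, none, some 2, some 4, none]] fun M hb h ⟨r, hu⟩ => ?_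
    rcases hu with u | u | u
    on_goal 1 => use 0
    on_goal 2 => use 1
    on_goal 3 => use 2
    all_goals exact ⟨fun b hb => by simp [hb, r, u, h.z], fun l => by fin_cases l <;> first | exact .inl (by decide) | exact .inr u | exact .inr r⟩
  have Y : FB (fun M : Rp K 4 5 => QC sF tF M ∧ M.a 0 = 0 ∧ M.a 4 * M.a 2 = 0 ∧ M.a 4 ≠ 0 ∧ Tt ![0, 1, 1, 2, 3] M 1) := by
    refine FB_W ![0, 1, 4, 3, 2] ![0, 1, 1, 2, 3] ![![none, none, none, none, none], ![some 1, none, none, none, none], ![none, none, none, some 2, none], ![none, none, none, none, some 3], ![none, some 4, none, none, none]] fun M hb h ⟨r0, r2, h0, T⟩ => ?_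
    have I : ∀ x ∈ range (M.a 1), x ∈ range (M.a 2) → x = 0 := by
      rintro _ ⟨w, rfl⟩ ⟨w', hw'⟩
      by_contra hv
      obtain ⟨y, hy⟩ := DFunLike.ne_iff.mp h0
      obtain ⟨f, hf, hf'⟩ := exists_dual (ker (M.a 4)) (M.e 1 y) (by simpa [h.ae_x] using hy)
      have f1 : ∀ x, f (M.a 2 x) = 0 := fun x => hf' _ (ax r2 x)
      refine hv (h.ro hb ![M.e 0 w, M.a 1 w, 0, 0] ![f ∘ₗ M.a 1, f, 0, 0] (fun i => by fin_cases i <;> simp [h.e_x, h.ea_x]) (fun k x => ?_) 1 (M.a 1 w) (by simp [h.ea_x]) hv (by simp [← hw', f1]) 1 y hf)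
      fin_cases k <;> simp [r0, h.ae_x, h.e_x, f1, ← hw', ax r2]
    refine ⟨![range (M.e 0), range (M.a 1), range (M.a 2), range (M.e 2), range (M.e 3)], fun j x hx => ?_, fun U hU i x => ?_, fun w hw hs => ?_, fun k j hk x hx => ?_⟩
    · fin_cases j <;> obtain ⟨y, rfl⟩ := hx <;> simp [h.e_x, h.ea_x]
    · fin_cases i
      exacts [hU 0 _ ⟨x, rfl⟩, T _ (fun k hk x => by fin_cases k <;> first | exact absurd hk (by decide) | exact hU 1 _ ⟨x, rfl⟩ | exact hU 2 _ ⟨x, rfl⟩) x, hU 3 _ ⟨x, rfl⟩, hU 4 _ ⟨x, rfl⟩]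
    · simp [fa4, Finset.sum_filter, Fin.sum_univ_succ] at hs
      have := add0 I (hw 1) (hw 2) hs.2.1
      exact (fa5 _).mpr ⟨hs.1, this.1, this.2, hs.2.2.1, hs.2.2.2⟩
    · fin_cases k <;> fin_cases j <;> try exact absurd hk (by decide)
      all_goals
        obtain ⟨y, rfl⟩ := hx
        first | simp [r0, ax r2, h.ae_x]; done | (simp; exact h.mr _ _ _ rfl)
  have Z : FB (fun M : Rp K 4 5 => QC sF tF M ∧ M.a 0 = 0 ∧ M.a 4 * M.a 2 * M.a 3 = 0 ∧ M.a 4 ≠ 0 ∧ M.a 3 ≠ 0 ∧ ∀ v, M.e 2 v = v → M.a 2 v = 0 → v = 0) := by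
    refine FB_W ![4, 3, 0, 1, 5, 2] ![0, 1, 1, 2, 2, 3] ![![none, none, none, none, none, none], ![some 1, none, none, none, none, none], ![none, none, none, some 2, some 1, none], ![none, none, none, none, none, some 3], ![none, some 5, none, none, none, none]] fun M hb h ⟨r0, r, h4, h3, c0⟩ => ?_
    have r' := ax r
    simp only [Module.End.mul_apply] at r'
    have I : ∀ x ∈ range (M.a 1), x ∈ range (M.a 2 * M.a 3) → x = 0 := by
      rintro _ ⟨w, rfl⟩ ⟨w', hw'⟩
      by_contra hv
      obtain ⟨y, hy⟩ := DFunLike.ne_iff.mp h4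
      obtain ⟨f, hf, hf'⟩ := exists_dual (ker (M.a 4)) (M.e 1 y) (by simpa [h.ae_x] using hy)
      have f1 : ∀ x, f (M.a 2 (M.a 3 x)) = 0 := fun x => hf' _ (r' x)
      rw [Module.End.mul_apply] at hw'
      refine hv (h.ro hb ![M.e 0 w, M.a 1 w, M.a 3 w', 0] ![f ∘ₗ M.a 1, f, f ∘ₗ M.a 2, 0] (fun i => by fin_cases i <;> simp [h.e_x, h.ea_x]) (fun k x => ?_) 1 (M.a 1 w) (by simp [h.ea_x]) hv (by simp [← hw', f1]) 1 y hf)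
      fin_cases k <;> simp [r0, h.ae_x, h.e_x, f1, ← hw', r']
    have J : ∀ x, M.e 1 x ∈ range (M.a 1) ⊔ range (M.a 2 * M.a 3) := by
      intro y
      by_contra hy
      obtain ⟨f, hf, hf'⟩ := exists_dual _ _ hy
      have f0 : ∀ x, f (M.a 1 x) = 0 := fun x => hf' _ (Submodule.mem_sup_left ⟨x, rfl⟩)
      have f1 : ∀ x, f (M.a 2 (M.a 3 x)) = 0 := fun x => hf' _ (Submodule.mem_sup_right ⟨x, rfl⟩)
      obtain ⟨w, hw⟩ := DFunLike.ne_iff.mp h3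
      have hv : M.a 2 (M.a 3 w) ≠ 0 := fun h2 => hw (c0 _ (by simp [h.ea_x]) h2)
      refine hv (h.ro hb ![0, M.a 2 (M.a 3 w), M.a 3 w, 0] ![0, f, f ∘ₗ M.a 2, 0] (fun i => by fin_cases i <;> simp [h.e_x, h.ea_x]) (fun k x => ?_) 1 _ (by simp [h.ea_x]) hv (f1 _) 1 y hf)
      fin_cases k <;> simp [r0, h.ae_x, h.e_x, f1, f0, r']
    refine ⟨![range (M.e 0), range (M.a 1), range (M.a 2 * M.a 3), range (M.a 3), (range (M.a 1)).comap (M.a 2) ⊓ range (M.e 2), range (M.e 3)], fun j x hx => ?_, fun U hU => ?_, fun w hw hs => ?_, fun k j hk x hx => ?_⟩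
    · fin_cases j
      on_goal 5 => obtain ⟨y, rfl⟩ := hx.2
      all_goals (try obtain ⟨y, rfl⟩ := hx); simp [h.e_x, h.ea_x]
    · refine (fa4 _).mpr ⟨fun x => hU 0 _ ⟨x, rfl⟩, fun x => ?_, fun x => ?_, fun x => hU 5 _ ⟨x, rfl⟩⟩
      · exact (sup_le (hU 1) (hU 2) : range (M.a 1) ⊔ range (M.a 2 * M.a 3) ≤ U) (J x)
      · obtain ⟨_, ⟨w, rfl⟩, _, ⟨y, rfl⟩, hwy⟩ := Submodule.mem_sup.mp (J (M.a 2 x))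
        have : M.e 2 x = M.a 3 y + (M.e 2 x - M.a 3 y) := by abel
        rw [this]
        refine U.add_mem (hU 3 _ ⟨y, rfl⟩) (hU 4 _ ⟨⟨w, ?_⟩, x - M.a 3 y, by simp [h.ea_x]⟩)
        simp [h.ea_x] at hwy
        simp [h.ae_x, ← hwy]
    · simp [fa4, Finset.sum_filter, Fin.sum_univ_succ] at hs
      have A := add0 I (hw 1) (hw 2) hs.2.1
      have B := add0 (A := range (M.a 3)) (B := (range (M.a 1)).comap (M.a 2) ⊓ range (M.e 2)) (by
        rintro _ ⟨x, rfl⟩ ⟨hx, -⟩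
        exact c0 _ (by simp [h.ea_x]) (I _ hx ⟨x, rfl⟩)) (hw 3) (hw 4) hs.2.2.1
      exact (fa6 _).mpr ⟨hs.1, A.1, A.2, B.1, B.2, hs.2.2.2⟩
    · fin_cases k <;> fin_cases j <;> (try exact absurd hk (by decide)) <;>
      first | exact hx.1 | exact ⟨x, rfl⟩ | exact h.mr _ _ _ rfl | exact LinearMap.congr_fun r0 _ | (obtain ⟨y, rfl⟩ := hx; first | exact ⟨y, rfl⟩ | exact r' y)
  refine (L.or (Y.or Z)).mono fun M hb ⟨h, ⟨r0, r⟩, h1⟩ => ?_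
  by_cases h4 : M.a 4 = 0
  · exact .inl ⟨h, r0, .inr (.inl h4)⟩
  rcases h.TS hb h1 2 with T | S
  · have ec : M.a 4 * M.a 2 = 0 := LinearMap.ext fun x => by
      simpa [h.ae_x] using T (ker (M.a 4 * M.a 2)) (fun k hk x => by
        fin_cases k <;> first | exact absurd hk (by decide) | exact ax r x) x
    refine (h.TS hb h1 1).elim (fun T => .inr (.inl ⟨h, r0, ec, h4, T⟩)) fun S => .inl ⟨h, r0, .inl (S.az h 2 rfl fun k hk => by
      fin_cases k <;> revert hk <;> simp [r0, ec])⟩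
  · by_cases h3 : M.a 3 = 0
    · exact .inl ⟨h, r0, .inr (.inr h3)⟩
    exact .inr (.inr ⟨h, r0, r, h4, h3, fun v hv h2 => S v hv fun k hk => by fin_cases k <;> first | exact absurd hk (by decide) | exact h2⟩)
theorem FB_A10 : FB (fun M : Rp K 4 5 => QC sF tF M ∧ (M.a 0 * M.a 1 = 0 ∧ M.a 1 * M.a 0 = 0 ∧ M.a 3 * M.a 4 * M.a 2 = 0 ∧ M.a 4 * M.a 2 * M.a 3 = 0 ∧ M.a 0 * M.a 2 * M.a 3 * M.a 4 * M.a 1 = 0) ∧ finrank K M.E ≠ 1) := by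
  refine (X10.or (FB_dual (s := ![1, 0, 2, 3, 1]) (t := ![0, 1, 1, 2, 3]) (Q' := fun M => M.a 1 = 0 ∧ M.a 3 * M.a 4 * M.a 2 = 0) X10 ![0, 1, 3, 2] ![1, 0, 4, 3, 2] (by decide) (by decide) (by decide) (by decide) fun M h => ⟨?_, ?_⟩)).mono fun M hb ⟨h, r, h1⟩ => ?_
  · exact (congrArg tr h.1).trans (LinearMap.ext fun f => LinearMap.comp_zero f)
  · have := tr_z h.2
    rw [tr_mul, ← mul_assoc] at this
    exact this
  · exact (h.dich hb h1 0 1 0 (by decide) (by decide) r.2.1 rfl rfl).elim (fun u => .inr ⟨h, ⟨u, r.2.2.1⟩, h1⟩) fun u => .inl ⟨h, ⟨u, r.2.2.2.1⟩, h1⟩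
theorem X11 : FB (fun M : Rp K 4 6 => QC sD tD M ∧ (M.a 0 = 0 ∧ M.a 2 * M.a 4 = 0 ∧ M.a 3 * M.a 2 = 0 ∧ M.a 4 * M.a 5 = 0 ∧ M.a 5 * M.a 3 = 0 ∧ M.a 5 * M.a 4 = 0) ∧ finrank K M.E ≠ 1) := by
  have L : FB (fun M : Rp K 4 6 => QC sD tD M ∧ M.a 0 = 0 ∧ (M.a 2 = 0 ∨ M.a 3 = 0) ∧ (M.a 4 = 0 ∨ M.a 5 = 0)) := by
    refine FL ![![some 0, some 1, some 2, some 3, none, none], ![some 0, some 1, some 2, some 3, none, none], ![some 0, some 1, some 2, some 3, none, none], ![some 0, some 1, some 2, some 3, none, none]] ![![some 1, none, some 3, none, some 5, none, none, none, none, none], ![some 1, none, some 3, none, none, some 4, none, none, none, none], ![some 1, none, none, some 2, some 5, none, none, none, none, none], ![some 1, none, none, some 2, none, some 4, none, none, none, none]] fun M hb h ⟨r, hu, hv⟩ => ?_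
    rcases hu with u | u <;> rcases hv with v | v
    on_goal 1 => use 0
    on_goal 2 => use 1
    on_goal 3 => use 2
    on_goal 4 => use 3
    all_goals exact ⟨fun b hb => by simp [hb, r, u, v, h.z], fun l => by fin_cases l <;> first | exact .inl (by decide) | exact .inr u | exact .inr v | exact .inr r⟩
  have Y : ∀ z : Fin 2, FB (fun M : Rp K 4 6 => QC sD tD M ∧ (M.a 0 = 0 ∧ M.a 2 * M.a 4 = 0 ∧ M.a 3 * M.a 2 = 0 ∧ M.a 4 * M.a 5 = 0 ∧ M.a 5 * M.a 3 = 0 ∧ M.a 5 * M.a 4 = 0) ∧ M.a (![5, 4] z) = 0 ∧ M.a 3 ≠ 0 ∧ Tt ![0, 1, 1, 2, 2, 3] M 1) := by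
    intro z
    fin_cases z
    on_goal 1 => refine FB_W ![1, 2, 4, 3, 5] ![0, 1, 1, 2, 3] ![![none, none, none, none, none], ![some 1, none, none, none, none], ![none, none, none, some 2, none], ![none, some 3, none, none, none], ![none, none, none, none, some 3], ![none, none, none, none, none]] fun M hb h ⟨⟨r0, r1, r2, r3, r4, r5⟩, u, h0, T⟩ => ?_
    on_goal 2 => refine FB_W ![1, 2, 4, 3, 5] ![0, 1, 1, 2, 3] ![![none, none, none, none, none], ![some 1, none, none, none, none], ![none, none, none, some 2, none], ![none, some 3, none, none, none], ![none, none, none, none, none], ![none, none, none, some 4, none]] fun M hb h ⟨⟨r0, r1, r2, r3, r4, r5⟩, u, h0, T⟩ => ?_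
    all_goals
      have I : ∀ x ∈ range (M.a 1), x ∈ range (M.a 2) → x = 0 := by
        rintro _ ⟨w, rfl⟩ ⟨w', hw'⟩
        by_contra hv
        obtain ⟨y, hy⟩ := DFunLike.ne_iff.mp h0
        obtain ⟨f, hf, hf'⟩ := exists_dual (ker (M.a 3)) (M.e 1 y) (by simpa [h.ae_x] using hy)
        have f1 : ∀ x, f (M.a 2 x) = 0 := fun x => hf' _ (ax r2 x)
        refine hv (h.ro hb ![M.e 0 w, M.a 1 w, 0, 0] ![f ∘ₗ M.a 1, f, 0, 0] (fun i => by fin_cases i <;> simp [h.e_x, h.ea_x]) (fun k x => ?_) 1 (M.a 1 w) (by simp [h.ea_x]) hv (by simp [← hw', f1]) 1 y hf)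
        fin_cases k <;> simp [r0, h.ae_x, h.e_x, f1, ← hw', ax r2]
      refine ⟨![range (M.e 0), range (M.a 1), range (M.a 2), range (M.e 2), range (M.e 3)], fun j x hx => ?_, fun U hU i x => ?_, fun w hw hs => ?_, fun k j hk x hx => ?_⟩
      · fin_cases j <;> obtain ⟨y, rfl⟩ := hx <;> simp [h.e_x, h.ea_x]
      · fin_cases i
        exacts [hU 0 _ ⟨x, rfl⟩, T _ (fun k hk x => by fin_cases k <;> first | exact absurd hk (by decide) | exact hU 1 _ ⟨x, rfl⟩ | exact hU 2 _ ⟨x, rfl⟩) x, hU 3 _ ⟨x, rfl⟩, hU 4 _ ⟨x, rfl⟩]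
      · simp [fa4, Finset.sum_filter, Fin.sum_univ_succ] at hs
        have := add0 I (hw 1) (hw 2) hs.2.1
        exact (fa5 _).mpr ⟨hs.1, this.1, this.2, hs.2.2.1, hs.2.2.2⟩
      · fin_cases k <;> fin_cases j <;> try exact absurd hk (by decide)
        all_goals
          obtain ⟨y, rfl⟩ := hx
          first | simp [r0, ax r2, h.ae_x]; done | exact LinearMap.congr_fun u _ | (simp; exact h.mr _ _ _ rfl)
  refine (L.or (FB.union Y)).mono fun M hb ⟨h, r, h1⟩ => ?_
  have ⟨r0, r1, r2, r3, r4, r5⟩ := r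
  have D := h.dich hb h1 3 4 5 (by decide) (by decide) r3 rfl rfl
  rcases h.TS hb h1 1 with T | S
  · by_cases h0 : M.a 3 = 0
    · exact .inl ⟨h, r0, .inr h0, D⟩
    · exact .inr (D.elim (fun D => ⟨1, h, r, D, h0, T⟩) fun D => ⟨0, h, r, D, h0, T⟩)
  · exact .inl ⟨h, r0, .inl (S.az h 2 rfl fun k hk => by fin_cases k <;> revert hk <;> simp [r0, r2]), D⟩
theorem FB_A11 : FB (fun M : Rp K 4 6 => QC sD tD M ∧ (M.a 0 * M.a 1 = 0 ∧ M.a 1 * M.a 0 = 0 ∧ M.a 2 * M.a 4 = 0 ∧ M.a 3 * M.a 2 = 0 ∧ M.a 4 * M.a 5 = 0 ∧ M.a 5 * M.a 3 = 0 ∧ M.a 5 * M.a 4 = 0 ∧ M.a 0 * M.a 2 * M.a 3 * M.a 1 = 0) ∧ finrank K M.E ≠ 1) := by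
  refine (X11.or (FB_dual (s := ![1, 0, 2, 1, 3, 2]) (t := ![0, 1, 1, 2, 2, 3]) (Q' := fun M => M.a 1 = 0 ∧ M.a 5 * M.a 3 = 0 ∧ M.a 3 * M.a 2 = 0 ∧ M.a 4 * M.a 5 = 0 ∧ M.a 2 * M.a 4 = 0 ∧ M.a 5 * M.a 4 = 0) X11 id ![1, 0, 3, 2, 5, 4] Function.bijective_id (by decide) (by decide) (by decide) fun M h => ⟨?_, tr_z h.2.1, tr_z h.2.2.1, tr_z h.2.2.2.1, tr_z h.2.2.2.2.1, tr_z h.2.2.2.2.2⟩)).mono fun M hb ⟨h, r, h1⟩ => ?_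
  · exact (congrArg tr h.1).trans (LinearMap.ext fun f => LinearMap.comp_zero f)
  · have ⟨s1, s2, s3, s4, s5, s6, s7, s8⟩ := r
    exact (h.dich hb h1 0 1 0 (by decide) (by decide) s2 rfl rfl).elim (fun u => .inr ⟨h, ⟨u, s6, s4, s5, s3, s7⟩, h1⟩) fun u => .inl ⟨h, ⟨u, s3, s4, s5, s6, s7⟩, h1⟩
theorem X12 : FB (fun M : Rp K 3 4 => QC sC tC M ∧ (M.a 0 * M.a 1 * M.a 2 = 0 ∧ M.a 3 * M.a 2 * M.a 3 = M.a 0 * M.a 1 ∧ ∀ v, M.e 1 v = v → M.a 0 v = 0 → v = 0) ∧ finrank K M.E ≠ 1) := by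
  have hX := FB_sub (P := fun M : Rp K 3 4 => QC sC tC M ∧ M.a 1 = 0 ∧ M.a 2 * M.a 3 * M.a 2 = 0 ∧ (∀ v, M.e 2 v = v → M.a 3 v = 0 → v = 0)) sC tC LX ![some 1, some 0, some 2] ![some 0, some 3, some 2] (by decide) (by decide) fun M h => ⟨h.1, h.2.2, fun l => by
      fin_cases l <;> first | exact .inl (by decide) | exact .inr h.2.1⟩
  have hX' := FB_drop (P := fun M : Rp K 3 4 => QC sC tC M ∧ (M.a 3 * M.a 2 * M.a 3 = M.a 0 * M.a 1 ∧ ∀ v, M.e 1 v = v → M.a 0 v = 0 → v = 0) ∧ M.a 2 * M.a 3 * M.a 2 = 0 ∧ (∀ v, M.e 2 v = v → M.a 3 v = 0 → v = 0)) 1 (fun M N φ ⟨h, ⟨r, _⟩, _⟩ ⟨h', ⟨r', i⟩, _⟩ he ha x => by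
      rw [← sub_eq_zero]
      refine i _ (by rw [map_sub, ← he, h.ea_x, h'.ea_x]; rfl) ?_
      rw [map_sub, ← ha 0 (by decide), ← Module.End.mul_apply, ← Module.End.mul_apply, ← r, ← r']
      simp only [Module.End.mul_apply]
      rw [ha 3 (by decide), ha 2 (by decide), ha 3 (by decide), sub_self]) (fun M h => ⟨h.1.drop 1, rfl, h.2.2⟩) hX
  have hY := FB_sub (P := fun M : Rp K 3 4 => QC sC tC M ∧ M.a 1 = 0 ∧ M.a 3 * M.a 2 * M.a 3 = 0 ∧ (∀ U : Submodule K M.E, (∀ x, M.a 2 x ∈ U) → ∀ x, M.e 2 x ∈ U) ∧ finrank K M.E ≠ 1) sC tC LY ![some 1, some 0, some 2] ![some 0, some 3, some 2] (by decide) (by decide) fun M h => ⟨h.1, h.2.2, fun l => by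
      fin_cases l <;> first | exact .inl (by decide) | exact .inr h.2.1⟩
  refine (hY.or hX').mono fun M hb ⟨h, ⟨r, r2, i⟩, h1⟩ => ?_
  have bc : M.a 1 * M.a 2 = 0 := LinearMap.ext fun x => i _ (by simp [h.ea_x]) (ax r x)
  refine (h.TS hb h1 2).imp (fun T => ?_) fun S => ?_
  · have T' : ∀ U : Submodule K M.E, (∀ x, M.a 2 x ∈ U) → ∀ x, M.e 2 x ∈ U := fun U hU => T U fun k hk => by
      fin_cases k <;> first | exact absurd hk (by decide) | exact hU
    have b0 : M.a 1 = 0 := LinearMap.ext fun x => by simpa [h.ae_x] using T' (ker (M.a 1)) (ax bc) x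
    exact ⟨h, b0, by rw [r2, b0, mul_zero], T', h1⟩
  · have S' : ∀ v, M.e 2 v = v → M.a 3 v = 0 → v = 0 := fun v hv h2 => S v hv fun k hk => by
      fin_cases k <;> first | exact absurd hk (by decide) | exact h2 | skip
      refine i _ (by simp [h.ea_x]) ?_
      have := LinearMap.congr_fun r2 v
      simpa [h2] using this.symm
    refine ⟨h, ⟨r2, i⟩, LinearMap.ext fun x => S' _ (by simp [h.ea_x]) ?_, S'⟩
    have : M.a 3 * M.a 2 * M.a 3 * M.a 2 = 0 := by rw [r2, r]
    exact ax this x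
theorem FB_A12 : FB (fun M : Rp K 3 4 => QC sC tC M ∧ (M.a 0 * M.a 1 * M.a 2 = 0 ∧ M.a 1 * M.a 2 * M.a 0 = 0 ∧ M.a 2 * M.a 0 * M.a 1 = 0 ∧ M.a 3 * M.a 2 * M.a 3 = M.a 0 * M.a 1 ∧ M.a 1 * M.a 2 * M.a 3 * M.a 2 * M.a 0 = 0) ∧ finrank K M.E ≠ 1) := by
  refine (X12.or (FB_dual (s := ![1, 2, 0, 2]) (t := ![0, 1, 2, 0]) (Q' := fun M => M.a 2 * M.a 0 * M.a 1 = 0 ∧ M.a 3 * M.a 2 * M.a 3 = M.a 0 * M.a 1 ∧ Tt ![0, 1, 2, 0] M 1) X12 ![2, 1, 0] ![1, 0, 2, 3] (by decide) (by decide) (by decide) (by decide) fun M h => ⟨?_, ?_, fun f hf h2 => ?_⟩)).mono fun M hb ⟨h, r, h1⟩ => ?_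
  · have := tr_z h.1
    rw [tr_mul, ← mul_assoc] at this
    exact this
  · have := congrArg tr h.2.1
    rw [tr_mul, tr_mul, ← mul_assoc, tr_mul] at this
    exact this
  · refine LinearMap.ext fun x => ?_
    rw [← hf]
    exact h.2.2 (ker f) (fun k hk x => by
      fin_cases k <;> first | exact absurd hk (by decide) | exact LinearMap.congr_fun h2 x) x
  · have ⟨s1, s2, s3, s4, s5⟩ := r
    exact (h.TS hb h1 1).elim (fun T => .inr ⟨h, ⟨s3, s4, T⟩, h1⟩) fun S => .inl ⟨h, ⟨s1, s4, fun v hv h2 => S v hv fun k hk => by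
      fin_cases k <;> first | exact absurd hk (by decide) | exact h2⟩, h1⟩
theorem FB_A13 : FB (fun M : Rp K 3 5 => QC sH tH M ∧ (M.a 0 * M.a 0 = 0 ∧ M.a 0 * M.a 3 = 0 ∧ M.a 1 * M.a 2 = 0 ∧ M.a 1 * M.a 3 = 0 ∧ M.a 2 * M.a 1 = 0 ∧ M.a 3 * M.a 4 = 0 ∧ M.a 4 * M.a 0 = 0 ∧ M.a 4 * M.a 2 = 0 ∧ M.a 4 * M.a 3 = 0 ∧ M.a 1 * M.a 0 * M.a 2 = 0) ∧ finrank K M.E ≠ 1) := by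
  have X1 : FB (fun M : Rp K 3 5 => QC sH tH M ∧ (M.a 0 * M.a 0 = 0 ∧ M.a 0 * M.a 3 = 0) ∧ finrank K M.E ≠ 1 ∧ M.a 1 = 0 ∧ M.a 4 = 0) :=
    FB_sub _ _ L13 ![some 0, some 1, some 2] ![some 0, some 2, some 3] (by decide) (by decide) fun M h => ⟨h.1, ⟨h.2.1, h.2.2.1⟩, fun l => by
      fin_cases l <;> first | exact .inl (by decide) | exact .inr h.2.2.2.1 | exact .inr h.2.2.2.2⟩
  have X2 : FB (fun M : Rp K 3 5 => QC sH tH M ∧ (M.a 0 * M.a 0 = 0 ∧ M.a 4 * M.a 0 = 0) ∧ finrank K M.E ≠ 1 ∧ M.a 2 = 0 ∧ M.a 3 = 0) :=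
    FB_sub _ _ L13' ![some 0, some 1, some 2] ![some 0, some 1, some 4] (by decide) (by decide) fun M h => ⟨h.1, ⟨h.2.1, h.2.2.1⟩, fun l => by
      fin_cases l <;> first | exact .inl (by decide) | exact .inr h.2.2.2.1 | exact .inr h.2.2.2.2⟩
  have X3 : FB (fun M : Rp K 3 5 => QC sH tH M ∧ M.a 0 = 0 ∧ (M.a 1 = 0 ∧ M.a 3 = 0 ∨ M.a 2 = 0 ∧ M.a 4 = 0)) := by
    refine FL ![![some 0, some 1, some 2, none, none, none], ![some 0, some 1, some 2, none, none, none]] ![![some 2, none, some 4, none, none, none, none, none, none, none], ![none, some 1, none, some 3, none, none, none, none, none, none]] fun M hb h ⟨r, h0⟩ => ?_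
    rcases h0 with ⟨u, v⟩ | ⟨u, v⟩
    on_goal 1 => use 0
    on_goal 2 => use 1
    all_goals exact ⟨fun b hb => by simp [hb], fun l => by fin_cases l <;> first | exact .inl (by decide) | exact .inr u | exact .inr v | exact .inr r⟩
  refine ((X1.or X2).or X3).mono fun M hb ⟨h, r, h1⟩ => ?_
  have ⟨r1, r2, r3, r4, r5, r6, r7, r8, r9, r10⟩ := r
  rcases h.dich hb h1 0 2 1 (by decide) (by decide) r5 rfl rfl with u | u <;>
  rcases h.dich hb h1 2 3 4 (by decide) (by decide) r6 rfl rfl with v | v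
  · exact .inl (.inr ⟨h, ⟨r1, r7⟩, h1, u, v⟩)
  · rcases h.TS hb h1 1 with T | S
    · exact .inr ⟨h, T.az h 0 rfl fun k hk => by fin_cases k <;> revert hk <;> simp [r, u, v], .inr ⟨u, v⟩⟩
    · exact .inl (.inr ⟨h, ⟨r1, r7⟩, h1, u, S.az h 3 rfl fun k hk => by fin_cases k <;> revert hk <;> simp [r, u, v]⟩)
  · rcases h.TS hb h1 1 with T | S
    · exact .inl (.inl ⟨h, ⟨r1, r2⟩, h1, u, T.az h 4 rfl fun k hk => by fin_cases k <;> revert hk <;> simp [r, u, v]⟩)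
    · exact .inr ⟨h, S.az h 0 rfl fun k hk => by fin_cases k <;> revert hk <;> simp [r, u, v], .inl ⟨u, v⟩⟩
  · exact .inl (.inl ⟨h, ⟨r1, r2⟩, h1, u, v⟩)
theorem X14 : FB (fun M : Rp K 3 4 => QC sB tB M ∧ (M.a 0 = 0 ∧ M.a 2 * M.a 3 * M.a 2 * M.a 3 = 0) ∧ finrank K M.E ≠ 1) := by
  have hX := FB_sub (P := fun M : Rp K 3 4 => QC sB tB M ∧ M.a 0 = 0 ∧ M.a 3 * M.a 2 * M.a 3 = 0 ∧ (∀ v, M.e 2 v = v → M.a 2 v = 0 → v = 0)) sB tB LX ![some 0, some 1, some 2] ![some 1, some 2, some 3] (by decide) (by decide) fun M h => ⟨h.1, h.2.2, fun l => by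
      fin_cases l <;> first | exact .inl (by decide) | exact .inr h.2.1⟩
  have hY := FB_sub (P := fun M : Rp K 3 4 => QC sB tB M ∧ M.a 0 = 0 ∧ M.a 2 * M.a 3 * M.a 2 = 0 ∧ (∀ U : Submodule K M.E, (∀ x, M.a 3 x ∈ U) → ∀ x, M.e 2 x ∈ U) ∧ finrank K M.E ≠ 1) sB tB LY ![some 0, some 1, some 2] ![some 1, some 2, some 3] (by decide) (by decide) fun M h => ⟨h.1, h.2.2, fun l => by
      fin_cases l <;> first | exact .inl (by decide) | exact .inr h.2.1⟩
  refine (hY.or hX).mono fun M hb ⟨h, ⟨r0, r⟩, h1⟩ => (h.TS hb h1 2).imp (fun T => ?_) fun S => ?_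
  · have T' : ∀ U : Submodule K M.E, (∀ x, M.a 3 x ∈ U) → ∀ x, M.e 2 x ∈ U := fun U hU => T U fun k hk => by
      fin_cases k <;> first | exact absurd hk (by decide) | exact hU
    refine ⟨h, r0, LinearMap.ext fun x => ?_, T', h1⟩
    simpa [h.ae_x] using T' (ker (M.a 2 * M.a 3 * M.a 2)) (ax r) x
  · have S' : ∀ v, M.e 2 v = v → M.a 2 v = 0 → v = 0 := fun v hv h2 => S v hv fun k hk => by
      fin_cases k <;> first | exact absurd hk (by decide) | exact h2
    exact ⟨h, r0, LinearMap.ext fun x => S' _ (by simp [h.ea_x]) (ax r x), S'⟩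
theorem FB_A14 : FB (fun M : Rp K 3 4 => QC sB tB M ∧ (M.a 0 * M.a 1 = 0 ∧ M.a 1 * M.a 0 = 0 ∧ M.a 0 * M.a 2 * M.a 3 * M.a 1 = 0 ∧ M.a 0 * M.a 2 * M.a 3 * M.a 2 = 0 ∧ M.a 2 * M.a 3 * M.a 2 * M.a 3 = 0 ∧ M.a 3 * M.a 2 * M.a 3 * M.a 1 = 0 ∧ M.a 3 * M.a 2 * M.a 3 * M.a 2 = 0) ∧ finrank K M.E ≠ 1) := by
  refine (X14.or (FB_dual (s := ![1, 0, 2, 1]) (t := ![0, 1, 1, 2]) (Q' := fun M => M.a 1 = 0 ∧ M.a 2 * M.a 3 * M.a 2 * M.a 3 = 0) X14 id ![1, 0, 3, 2] Function.bijective_id (by decide) (by decide) (by decide) fun M h => ⟨?_, ?_⟩)).mono fun M hb ⟨h, r, h1⟩ => ?_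
  · exact (congrArg tr h.1).trans (LinearMap.ext fun f => LinearMap.comp_zero f)
  · have := tr_z h.2
    rw [tr_mul, tr_mul, ← mul_assoc, ← mul_assoc] at this
    exact this
  · exact (h.dich hb h1 0 1 0 (by decide) (by decide) r.2.1 rfl rfl).elim (fun u => .inr ⟨h, ⟨u, r.2.2.2.2.1⟩, h1⟩) fun u => .inl ⟨h, ⟨u, r.2.2.2.2.1⟩, h1⟩
theorem X15 : FB (fun M : Rp K 3 5 => QC sA tA M ∧ M.a 1 = 0 ∧ M.a 3 = 0 ∧ M.a 0 * M.a 0 = 0 ∧ M.a 0 ≠ 0 ∧ (∀ v, M.a 2 v = 0 → M.a 0 (M.a 4 v) = 0) ∧ (∀ x, M.e 0 x ∈ range (M.a 4) ⊔ range (M.a 0)) ∧ (∀ U : Submodule K M.E, (∀ x, M.a 2 x ∈ U) → ∀ x, M.e 1 x ∈ U) ∧ (∀ v, M.e 2 v = v → M.a 2 v = 0 → M.a 4 v = 0 → v = 0)) := by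
  refine FB_W ![1, 0, 2, 3] ![2, 1, 0, 0] ![![none, none, some 3, none], ![none, none, none, none], ![some 1, none, none, none], ![none, none, none, none], ![some 2, none, none, none]] fun M hb h ⟨b0, d0, r, h0, C, J, T, N⟩ => ?_
  have r' := ax r
  obtain ⟨y, hy⟩ := DFunLike.ne_iff.mp h0
  obtain ⟨f, hf, hf'⟩ := exists_dual (ker (M.a 0)) (M.e 0 y) (by simpa [h.ae_x] using hy)
  have f1 : ∀ x, f (M.a 0 x) = 0 := fun x => hf' _ (r' x)
  have kc : ∀ v, M.a 2 v = 0 → M.a 4 v = 0 := fun v hv => h.ro hb ![M.a 4 v, 0, M.e 2 v] ![f, 0, f ∘ₗ M.a 4] (fun i => by fin_cases i <;> simp [h.e_x, h.ea_x]) (fun k x => by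
    fin_cases k <;> simp [b0, d0, h.ae_x, h.e_x, f1, C v hv, hv]) 0 (M.a 0 y) (by simp [h.ea_x]) hy (f1 _) 0 y hf
  obtain ⟨g, hg⟩ := factor (M.a 2) (f ∘ₗ M.a 4) fun x hx => by simp [kc x hx]
  have I : ∀ x ∈ range (M.a 4), x ∈ range (M.a 0) → x = 0 := by
    rintro _ ⟨w, rfl⟩ ⟨w', hw'⟩
    by_contra hv
    refine hv (h.ro hb ![M.a 4 w, M.a 2 w, M.e 2 w] ![f, g, f ∘ₗ M.a 4] (fun i => by fin_cases i <;> simp [h.e_x, h.ea_x]) (fun k x => ?_) 0 (M.a 4 w) (by simp [h.ea_x]) hv (by simp [← hw', f1]) 0 y hf)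
    fin_cases k <;> simp [b0, d0, h.ae_x, h.e_x, f1, ← hw', r', hg]
  refine ⟨![range (M.e 2), range (M.e 1), range (M.a 4), range (M.a 0)], fun j x hx => ?_, fun U hU => ?_, fun w hw hs => ?_, fun k j hk x hx => ?_⟩
  · fin_cases j <;> obtain ⟨y, rfl⟩ := hx <;> simp [h.e_x, h.ea_x]
  · exact (fa3 _).mpr ⟨fun x => (sup_le (hU 2) (hU 3) : range (M.a 4) ⊔ range (M.a 0) ≤ U) (J x), fun x => hU 1 _ ⟨x, rfl⟩, fun x => hU 0 _ ⟨x, rfl⟩⟩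
  · simp [fa3, Finset.sum_filter, Fin.sum_univ_succ] at hs
    have A := add0 I (hw 2) (hw 3) hs.1
    exact (fa4 _).mpr ⟨hs.2.2, hs.2.1, A.1, A.2⟩
  · fin_cases k <;> fin_cases j <;> (try exact absurd hk (by decide)) <;>
    first | exact ⟨x, rfl⟩ | exact h.mr _ _ _ rfl | exact LinearMap.congr_fun b0 _ | exact LinearMap.congr_fun d0 _ | (obtain ⟨y, rfl⟩ := hx; exact r' y)
theorem Y15 : FB (fun M : Rp K 3 5 => QC sA tA M ∧ M.a 2 = 0 ∧ M.a 4 = 0 ∧ M.a 0 * M.a 0 = 0 ∧ M.a 0 * M.a 1 = 0 ∧ Ss ![0, 1, 2, 0, 2] M 0) := by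
  refine FB_W ![2, 3, 4, 5] ![0, 0, 1, 2] ![![some 1, none, none, none], ![none, none, some 1, none], ![none, none, none, none], ![none, some 3, none, none], ![none, none, none, none]] fun M hb h ⟨c0, e0, r, r1, S⟩ => ?_
  have r' := ax r
  have r1' := ax r1
  have I : ∀ x ∈ ker (M.a 3) ⊓ range (M.e 0), x ∈ ker (M.a 0) ⊓ range (M.e 0) → x = 0 := by
    rintro _ ⟨h1, x, rfl⟩ ⟨h2, -⟩
    exact S _ (by simp [h.e_x]) fun k hk => by fin_cases k <;> first | exact absurd hk (by decide) | exact h1 | exact h2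
  have J : ∀ x, M.e 0 x ∈ ker (M.a 3) ⊔ ker (M.a 0) := by
    intro y
    by_contra hy
    obtain ⟨f, hf, hf'⟩ := exists_dual _ _ hy
    obtain ⟨g, hg⟩ := factor (M.a 3) f fun x hx => hf' x (Submodule.mem_sup_left hx)
    have f1 : ∀ x, M.a 0 x = 0 → f x = 0 := fun x hx => hf' _ (Submodule.mem_sup_right hx)
    have fe : ∀ x, f (M.e 0 x) = f x := fun x => by rw [← hg, ← hg, h.ae_x]; rfl
    have hv : M.a 0 y ≠ 0 := fun h2 => hf (f1 _ (by simp [h.ae_x, h2]))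
    refine hv (h.ro hb ![M.a 0 y, 0, M.a 3 (M.a 0 y)] ![f, 0, g] (fun i => by fin_cases i <;> simp [h.e_x, h.ea_x]) (fun k x => ?_) 0 _ (by simp [h.ea_x]) hv (f1 _ (r' _)) 0 y hf)
    fin_cases k <;> simp [c0, e0, h.ae_x, h.e_x, f1, r', r1', fe, hg]
  refine ⟨![ker (M.a 3) ⊓ range (M.e 0), ker (M.a 0) ⊓ range (M.e 0), range (M.e 1), range (M.e 2)], fun j x hx => ?_, fun U hU => ?_, fun w hw hs => ?_, fun k j hk x hx => ?_⟩
  · fin_cases j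
    iterate 2 obtain ⟨y, rfl⟩ := hx.2; simp [h.e_x]
    all_goals obtain ⟨y, rfl⟩ := hx; simp [h.e_x]
  · refine (fa3 _).mpr ⟨fun x => ?_, fun x => hU 2 _ ⟨x, rfl⟩, fun x => hU 3 _ ⟨x, rfl⟩⟩
    obtain ⟨u, hu, v, hv, hx⟩ := Submodule.mem_sup.mp (J x)
    have : M.e 0 x = M.e 0 u + M.e 0 v := by rw [← map_add, hx, h.e_x]; rfl
    rw [this]
    exact U.add_mem (hU 0 _ ⟨by simpa [h.ae_x] using hu, u, rfl⟩) (hU 1 _ ⟨by simpa [h.ae_x] using hv, v, rfl⟩)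
  · simp [fa3, Finset.sum_filter, Fin.sum_univ_succ] at hs
    have A := add0 I (hw 0) (hw 1) hs.1
    exact (fa4 _).mpr ⟨A.1, A.2, hs.2.1, hs.2.2⟩
  · fin_cases k <;> fin_cases j <;> (try exact absurd hk (by decide)) <;>
    first | exact hx.1 | exact h.mr _ _ _ rfl | exact LinearMap.congr_fun c0 _ | exact LinearMap.congr_fun e0 _ | exact ⟨r' x, h.mr _ _ _ rfl⟩ | exact ⟨r1' x, h.mr _ _ _ rfl⟩
theorem FB_A15 : FB (fun M : Rp K 3 5 => QC sA tA M ∧ (M.a 0 * M.a 0 = 0 ∧ M.a 0 * M.a 1 = 0 ∧ M.a 3 * M.a 4 = 0 ∧ M.a 4 * M.a 3 = 0 ∧ M.a 2 * M.a 3 * M.a 0 = 0 ∧ M.a 2 * M.a 3 * M.a 1 = 0 ∧ M.a 3 * M.a 0 * M.a 4 = 0 ∧ M.a 0 * M.a 4 = M.a 1 * M.a 2) ∧ finrank K M.E ≠ 1) := by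
  have L : FB (fun M : Rp K 3 5 => QC sA tA M ∧ M.a 0 = 0 ∧ (M.a 1 = 0 ∧ M.a 4 = 0 ∨ M.a 2 = 0 ∧ M.a 4 = 0 ∨ M.a 1 = 0 ∧ M.a 3 = 0)) := by
    refine FL ![![some 0, some 2, some 1, none, none, none], ![some 1, some 0, some 2, none, none, none], ![some 1, some 2, some 0, none, none, none]] ![![some 3, none, some 2, none, none, none, none, none, none, none], ![some 1, none, some 3, none, none, none, none, none, none, none], ![none, some 2, some 4, none, none, none, none, none, none, none]] fun M hb h ⟨r, hu⟩ => ?_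
    rcases hu with u | u | u
    on_goal 1 => use 0
    on_goal 2 => use 1
    on_goal 3 => use 2
    all_goals exact ⟨fun b hb => by simp [hb], fun l => by fin_cases l <;> first | exact .inl (by decide) | exact .inr u.1 | exact .inr u.2 | exact .inr r⟩
  have D := FB_sub (P := fun M : Rp K 3 5 => QC sA tA M ∧ M.a 2 = 0 ∧ M.a 3 = 0 ∧ (M.a 0 * M.a 0 = 0 ∧ M.a 0 * M.a 1 = 0) ∧ finrank K M.E ≠ 1) sA tA L13 ![some 2, some 0, some 1] ![some 0, some 4, some 1] (by decide) (by decide) fun M h => ⟨h.1, h.2.2.2, fun l => by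
      fin_cases l <;> first | exact .inl (by decide) | exact .inr h.2.1 | exact .inr h.2.2.1⟩
  have D1 := FB_drop (P := fun M : Rp K 3 5 => QC sA tA M ∧ (M.a 0 * M.a 4 = M.a 1 * M.a 2 ∧ ∀ v, M.e 1 v = v → M.a 1 v = 0 → v = 0) ∧ M.a 3 = 0 ∧ (M.a 0 * M.a 0 = 0 ∧ M.a 0 * M.a 1 = 0) ∧ finrank K M.E ≠ 1) 2 (fun M N φ ⟨h, ⟨r, _⟩, _⟩ ⟨h', ⟨r', i⟩, _⟩ he ha x => by
      rw [← sub_eq_zero]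
      refine i _ (by rw [map_sub, ← he, h.ea_x, h'.ea_x]; rfl) ?_
      rw [map_sub, ← ha 1 (by decide), ← Module.End.mul_apply, ← Module.End.mul_apply, ← r, ← r']
      simp only [Module.End.mul_apply]
      rw [ha 0 (by decide), ha 4 (by decide), sub_self]) (fun M h => ⟨h.1.drop 2, rfl, h.2.2⟩) D
  have E := (L.or X15).mono (P := fun M : Rp K 3 5 => QC sA tA M ∧ M.a 1 = 0 ∧ M.a 3 = 0 ∧ M.a 0 * M.a 0 = 0 ∧ (∀ v, M.a 2 v = 0 → M.a 0 (M.a 4 v) = 0) ∧ (∀ x, M.e 0 x ∈ range (M.a 4) ⊔ range (M.a 0)) ∧ (∀ U : Submodule K M.E, (∀ x, M.a 2 x ∈ U) → ∀ x, M.e 1 x ∈ U) ∧ (∀ v, M.e 2 v = v → M.a 2 v = 0 → M.a 4 v = 0 → v = 0)) fun M hb h => (em (M.a 0 = 0)).imp (fun h0 => ⟨h.1, h0, .inr (.inr ⟨h.2.1, h.2.2.1⟩)⟩) fun h0 => ⟨h.1, h.2.1, h.2.2.1, h.2.2.2.1, h0, h.2.2.2.2⟩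
  have E1 := FB_drop (P := fun M : Rp K 3 5 => QC sA tA M ∧ M.a 0 * M.a 4 = M.a 1 * M.a 2 ∧ M.a 3 = 0 ∧ M.a 0 * M.a 0 = 0 ∧ (∀ x, M.e 0 x ∈ range (M.a 4) ⊔ range (M.a 0)) ∧ (∀ U : Submodule K M.E, (∀ x, M.a 2 x ∈ U) → ∀ x, M.e 1 x ∈ U) ∧ (∀ v, M.e 2 v = v → M.a 2 v = 0 → M.a 4 v = 0 → v = 0)) 1 (fun M N φ hM hN he ha x => by
      have := hM.2.2.2.2.2.1 (ker (φ ∘ₗ M.a 1 - N.a 1 ∘ₗ φ)) (fun x => by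
        have e1 := LinearMap.congr_fun hM.2.1 x
        have e2 := LinearMap.congr_fun hN.2.1 (φ x)
        simp only [Module.End.mul_apply] at e1 e2
        simp [← e1, ha 2, ← e2, ha 0, ha 4]) x
      simpa [hM.1.ae_x, he, hN.1.ae_x, sub_eq_zero] using this) (fun M h => ⟨h.1.drop 1, rfl, h.2.2.1, h.2.2.2.1, fun v hv => by
        have this : M.a 0 (M.a 4 v) = M.a 1 (M.a 2 v) := LinearMap.congr_fun h.2.1 v
        rw [show M.a 2 v = 0 from hv, map_zero] at this
        exact this, h.2.2.2.2⟩) E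
  refine ((L.or Y15).or (D1.or E1)).mono fun M hb ⟨h, r, h1⟩ => ?_
  have ⟨r1, r2, r3, r4, r5, r6, r7, r8⟩ := r
  rcases h.TS hb h1 2 with T | S
  · refine .inl ?_
    have e0 : M.a 4 = 0 := T.az h 4 rfl fun k hk => by fin_cases k <;> revert hk <;> simp [r4]
    by_cases a0 : M.a 0 = 0
    · exact .inl ⟨h, a0, (h.dich hb h1 1 1 2 (by decide) (by decide) (by rw [← r8, e0, mul_zero]) rfl rfl).imp (fun u => ⟨u, e0⟩) fun u => .inl ⟨u, e0⟩⟩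
    have c0 : M.a 2 = 0 := by
      refine (h.dich hb h1 1 1 2 (by decide) (by decide) (by rw [← r8, e0, mul_zero]) rfl rfl).elim (fun b0 => ?_) id
      have r1' := ax r1
      have r5' := ax r5
      simp only [Module.End.mul_apply] at r5'
      obtain ⟨w, hw⟩ := DFunLike.ne_iff.mp a0
      have J : ∀ x, M.e 0 x ∈ range (M.a 0) ⊔ ker (M.a 3) := by
        intro y
        by_contra hy
        obtain ⟨f, hf, hf'⟩ := exists_dual _ _ hy
        obtain ⟨g, hg⟩ := factor (M.a 3) f fun x hx => hf' x (Submodule.mem_sup_right hx)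
        have f1 : ∀ x, f (M.a 0 x) = 0 := fun x => hf' _ (Submodule.mem_sup_left ⟨x, rfl⟩)
        have fe : ∀ x, f (M.e 0 x) = f x := fun x => by rw [← hg, ← hg, h.ae_x]; rfl
        refine hw (h.ro hb ![M.a 0 w, 0, M.a 3 (M.a 0 w)] ![f, 0, g] (fun i => by fin_cases i <;> simp [h.e_x, h.ea_x]) (fun k x => ?_) 0 _ (by simp [h.ea_x]) hw (f1 _) 0 y hf)
        fin_cases k <;> simp [b0, e0, h.ae_x, h.e_x, f1, r1', r5', fe, hg]
      have cd : M.a 2 * M.a 3 = 0 := LinearMap.ext fun x => by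
        obtain ⟨_, ⟨y, rfl⟩, v, hv, hx⟩ := Submodule.mem_sup.mp (J x)
        have := congrArg (M.a 2 * M.a 3) hx
        simpa [h.ae_x, r5', LinearMap.mem_ker.mp hv] using this.symm
      exact T.az h 2 rfl fun k hk => by fin_cases k <;> revert hk <;> simp [cd]
    refine .inr ⟨h, c0, e0, r1, r2, (h.TS hb h1 0).resolve_left fun T => a0 (T.az h 0 rfl fun k hk => by fin_cases k <;> revert hk <;> simp [r1, r2, e0])⟩
  · have da : M.a 3 * M.a 0 = 0 := LinearMap.ext fun x => S _ (by simp [h.ea_x]) fun k hk => by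
      fin_cases k <;> first | exact absurd hk (by decide) | exact ax r5 x | exact ax r4 (M.a 0 x)
    have db : M.a 3 * M.a 1 = 0 := LinearMap.ext fun x => S _ (by simp [h.ea_x]) fun k hk => by
      fin_cases k <;> first | exact absurd hk (by decide) | exact ax r6 x | exact ax r4 (M.a 1 x)
    rcases h.TS hb h1 0 with T | S0
    · refine .inr ?_
      have d0 : M.a 3 = 0 := T.az h 3 rfl fun k hk => by fin_cases k <;> revert hk <;> simp [da, db, r3]
      rcases h.TS hb h1 1 with T1 | S1
      · have T1' : ∀ U : Submodule K M.E, (∀ x, M.a 2 x ∈ U) → ∀ x, M.e 1 x ∈ U := fun U hU => T1 U fun k hk => by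
          fin_cases k <;> first | exact absurd hk (by decide) | exact hU
        refine .inr ⟨h, r8, d0, r1, T _ fun k hk x => ?_, T1', fun v hv h2 h4 => S v hv fun k hk => by
          fin_cases k <;> first | exact absurd hk (by decide) | exact h2 | exact h4⟩
        fin_cases k
        · exact Submodule.mem_sup_right ⟨x, rfl⟩
        · have := T1' ((range (M.a 4) ⊔ range (M.a 0)).comap (M.a 1)) (fun x => Submodule.mem_sup_right ⟨M.a 4 x, LinearMap.congr_fun r8 x⟩) x
          simpa [h.ae_x] using this
        · exact absurd hk (by decide)
        · exact absurd hk (by decide)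
        · exact Submodule.mem_sup_left ⟨x, rfl⟩
      · exact .inl ⟨h, ⟨r8, fun v hv h2 => S1 v hv fun k hk => by fin_cases k <;> first | exact absurd hk (by decide) | exact h2⟩, d0, ⟨r1, r2⟩, h1⟩
    · have a0 : M.a 0 = 0 := S0.az h 0 rfl fun k hk => by fin_cases k <;> revert hk <;> simp [r1, da]
      have b0 : M.a 1 = 0 := S0.az h 1 rfl fun k hk => by fin_cases k <;> revert hk <;> simp [r2, db]
      have e0 : M.a 4 = 0 := S0.az h 4 rfl fun k hk => by fin_cases k <;> revert hk <;> simp [r3, a0]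
      exact .inl (.inl ⟨h, a0, .inl ⟨b0, e0⟩⟩)
theorem FB_A16 : FB (fun M : Rp K 3 5 => QC ![0, 0, 1, 2, 0] ![0, 1, 2, 0, 2] M ∧ (M.a 0 * M.a 0 = 0 ∧ M.a 1 * M.a 0 = 0 ∧ M.a 4 * M.a 3 = 0 ∧ M.a 3 * M.a 4 = 0 ∧ M.a 0 * M.a 3 * M.a 2 = 0 ∧ M.a 1 * M.a 3 * M.a 2 = 0 ∧ M.a 4 * M.a 0 * M.a 3 = 0 ∧ M.a 4 * M.a 0 = M.a 2 * M.a 1) ∧ finrank K M.E ≠ 1) := by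
  refine (FB_dual (s := ![0, 0, 1, 2, 0]) (t := ![0, 1, 2, 0, 2]) (Q' := fun M => _) FB_A15 id id Function.bijective_id Function.surjective_id (by decide) (by decide) fun M h => ⟨tr_z h.1, tr_z h.2.1, tr_z h.2.2.1, tr_z h.2.2.2.1, ?_, ?_, ?_, ?_⟩)
  · have := tr_z h.2.2.2.2.1
    rw [tr_mul, ← mul_assoc] at this
    exact this
  · have := tr_z h.2.2.2.2.2.1
    rw [tr_mul, ← mul_assoc] at this
    exact this
  · have := tr_z h.2.2.2.2.2.2.1
    rw [tr_mul, ← mul_assoc] at this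
    exact this
  · exact congrArg tr h.2.2.2.2.2.2.2
local infixr:35 " +: " => And.intro
theorem A1t (l : K) (hl : l ≠ 0) (hl1 : l ≠ 1) : IsTauTiltingFinite (A1 K l) := by
  refine bridge2 (n := 3) (m := 4) sB tB (fun B _ _ a => a 0 * a 1 * a 0 = a 0 * a 2 * a 3 ∧ a 3 * a 1 * a 0 = l • (a 3 * a 2 * a 3) ∧
      a 1 * a 0 * a 1 = a 2 * a 3 * a 1 ∧ a 1 * a 0 * a 2 = l • (a 2 * a 3 * a 2))
    (fun B _ _ a => (∀ p, p * a 0 * a 2 * a 3 = p * a 0 * a 1 * a 0) ∧ (∀ p, p * a 3 * a 2 * a 3 = l⁻¹ • (p * a 3 * a 1 * a 0)) ∧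
     (∀ p, p * a 2 * a 3 * a 1 = p * a 1 * a 0 * a 1) ∧ (∀ p, p * a 2 * a 3 * a 2 = l⁻¹ • (p * a 1 * a 0 * a 2)) ∧
     (∀ p, p * a 0 * a 1 * a 0 * a 2 = 0) ∧ (∀ p, p * a 3 * a 1 * a 0 * a 1 = 0) ∧ (∀ p, p * a 0 * a 1 * a 0 * a 1 * a 0 = 0) ∧ (∀ p, p * a 1 * a 0 * a 1 * a 0 * a 1 = 0))
    (fun B _ _ a => a 0 * a 1 = 0 ∧ a 1 * a 0 = 0 ∧ a 2 * a 3 = 0 ∧ a 3 * a 2 = 0)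
    (fun B _ _ a => [a 0 * a 1 + a 1 * a 0 + l • (a 3 * a 2), l • (a 2 * a 3) - a 1 * a 0 + (l - 1) • (a 0 * a 1)]) ?_ ?_ 5 ?_ ?_ ?_
  · intro B _ _ g H
    have H' := fun p : _ × _ => H p.1 p.2
    simp only [A1Rel, List.forall_mem_cons, map_mul, FreeAlgebra.lift_ι_apply, map_add, map_one, map_zero, AlgHom.commutes, ← Algebra.smul_def, map_smul] at H'
    refine ⟨⟨?_, ?_, ?_⟩, ?_⟩
    all_goals simp [Fin.forall_fin_succ, Fin.sum_univ_succ]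
    all_goals grind
  · rintro B _ _ e a h ⟨h1, h2, h3, h4⟩
    have h1 := pf h1
    have h2 := pf h2
    have h3 := pf h3
    have h4 := pf h4
    simp only [← mul_assoc, mul_smul_comm] at h1 h2 h3 h4
    have aux : ∀ x : B, x = l • x → x = 0 := fun x hx => by
      have : (1 - l) • x = 0 := by rw [sub_smul, one_smul, ← hx, sub_self]
      exact (smul_eq_zero.mp this).resolve_left (sub_ne_zero.mpr hl1.symm)
    have h5 : ∀ p, p * a 0 * a 1 * a 0 * a 2 = 0 := fun p => aux _ (by conv_lhs => rw [h4]
                                                                       rw [h1])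
    have h6 : ∀ p, p * a 3 * a 1 * a 0 * a 1 = 0 := fun p => aux _ (by conv_lhs => rw [h2, smul_mul_assoc, ← h3])
    exact ⟨fun p => (h1 p).symm, fun p => by rw [h2, inv_smul_smul₀ hl], fun p => (h3 p).symm, fun p => by rw [h4, inv_smul_smul₀ hl], h5, h6,
      fun p => by rw [h1 (p * a 0 * a 1), h5, zero_mul], fun p => by rw [h3 p, h6]⟩
  · rintro B _ _ e a h ⟨h1, h2, h3, h4, h5, h6, h7, h8⟩
    refine ⟨fun p => ?_, ?_⟩
    · simp (decide := true) only [NN4, zero_mul, and_self, h1, h2, h3, h4, h5, h6, h7, h8, h.z, NN0, smul_mul_assoc, smul_zero]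
    · simp (decide := true) only [CN, List.forall_mem_cons, fa3, fa4, mul_add, add_mul, mul_sub, sub_mul, ← mul_assoc, zero_mul, mul_zero, and_self, h1, h2, h3, h4, h5, h6, h7, h8, h.z, h.ea, h.ae,
        smul_mul_assoc, mul_smul_comm, smul_zero, add_zero, zero_add, sub_zero, zero_sub, if_true, if_false, smul_smul, mul_inv_cancel₀ hl, one_smul, implies_true, sub_self, true_and, and_true, neg_mul, mul_neg, neg_zero, smul_neg, List.not_mem_nil, false_imp_iff, sub_smul]
  · intro B _ _ e a h _ _ hz
    simp only [List.forall_mem_cons] at hz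
    have z := fun i => pf hz.1 (e i)
    have z' := pf hz.2.1 (e 1)
    simp (decide := true) only [fa3, mul_add, mul_sub, mul_smul_comm, ← mul_assoc, h.ea0, if_true, if_false, zero_mul, smul_zero, add_zero, zero_add, sub_zero, mul_zero, smul_eq_zero, hl, false_or] at z z'
    rw [z.2.1, sub_zero] at z'
    exact ⟨z.1, z.2.1, (smul_eq_zero.mp z').resolve_left hl, z.2.2⟩
  · refine FB_sub6 sB tB ![some 0, some 1, some 2, none, none, none] ![some 1, some 0, some 3, some 2, none, none, none, none, none, none] (by decide) (by decide) ?_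
    rintro M hb ⟨h, ⟨h1, h2, h3, h4⟩, -⟩
    exact ⟨h, fun b hb => by simp [hb, h1, h2, h3, h4], fun l => Or.inl (by revert l; decide)⟩
theorem A2t (l : K) (hl : l ≠ 0) (hl1 : l ≠ 1) : IsTauTiltingFinite (A2 K l) := by
  refine bridge2 (n := 2) (m := 4) ![0, 1, 1, 0] ![0, 1, 0, 1]
    (fun _ _ _ a => a 0 * a 0 = a 2 * a 3 ∧ l • (a 1 * a 1) = a 3 * a 2 ∧ a 3 * a 0 = a 1 * a 3 ∧ a 2 * a 1 = a 0 * a 2)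
    (fun _ _ _ a => (∀ p, p * a 2 * a 1 = p * a 0 * a 2) ∧ (∀ p, p * a 2 * a 3 = p * a 0 * a 0) ∧ (∀ p, p * a 3 * a 0 = p * a 1 * a 3) ∧
      (∀ p, p * a 3 * a 2 = l • (p * a 1 * a 1)) ∧ (∀ p, p * a 0 * a 0 * a 2 = 0) ∧ (∀ p, p * a 1 * a 1 * a 3 = 0) ∧ (∀ p, p * a 0 * a 0 * a 0 * a 0 = 0) ∧
      ∀ p, p * a 1 * a 1 * a 1 * a 1 = 0)
    (fun _ _ _ a => a 0 = 0 ∧ a 1 = 0 ∧ a 2 * a 3 = 0 ∧ a 3 * a 2 = 0)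
    (fun _ _ _ a => [a 0 + a 1]) ?_ ?_ 4 ?_ ?_ ?_
  · intro B _ _ g H
    have H' := fun p : _ × _ => H p.1 p.2
    simp only [A2Rel, List.forall_mem_cons, map_mul, FreeAlgebra.lift_ι_apply, map_add, map_one, map_zero, AlgHom.commutes, ← Algebra.smul_def, map_smul] at H'
    refine ⟨⟨?_, ?_, ?_⟩, ?_⟩
    all_goals simp [Fin.forall_fin_succ, Fin.sum_univ_succ]
    all_goals grind
  · rintro B _ _ e a h ⟨h1, h2, h3, h4⟩
    have h1 := pf h1
    have h2 := pf h2
    have h3 := pf h3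
    have h4 := pf h4
    simp only [← mul_assoc, mul_smul_comm] at h1 h2 h3 h4
    have aux : ∀ x : B, x = l • x → x = 0 := fun x hx => by
      have : (1 - l) • x = 0 := by rw [sub_smul, one_smul, ← hx, sub_self]
      exact (smul_eq_zero.mp this).resolve_left (sub_ne_zero.mpr hl1.symm)
    have h5 : ∀ p, p * a 0 * a 0 * a 2 = 0 := fun p => aux _ (by conv_lhs => rw [h1, ← h2, h4, h4])
    have h6 : ∀ p, p * a 1 * a 1 * a 3 = 0 := fun p => aux _ (by rw [← smul_mul_assoc, h2, ← h1, h3, h3])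
    exact ⟨h4, fun p => (h1 p).symm, h3, fun p => (h2 p).symm, h5, h6, fun p => by rw [h1 (p * a 0 * a 0), h5, zero_mul],
      fun p => (smul_eq_zero.mp (by rw [h2 (p * a 1 * a 1), h6, zero_mul])).resolve_left hl⟩
  · rintro B _ _ e a h ⟨h1, h2, h3, h4, h5, h6, h7, h8⟩
    refine ⟨fun p => ?_, ?_⟩
    · simp (decide := true) only [NN4, zero_mul, and_self, h1, h2, h3, h4, h5, h6, h7, h8, h.z, NN0, smul_mul_assoc, smul_zero]
    · simp (decide := true) only [CN, List.forall_mem_cons, fa2, fa4, mul_add, add_mul, mul_sub, sub_mul, ← mul_assoc, zero_mul, mul_zero, and_self, h1, h2, h3, h4, h5, h6, h7, h8, h.z, h.ea, h.ae,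
        smul_mul_assoc, mul_smul_comm, smul_zero, add_zero, zero_add, if_true, if_false, implies_true, true_and, and_true, List.not_mem_nil, false_imp_iff]
  · rintro B _ _ e a h ⟨q1, q2, -, -⟩ _ hz
    simp only [List.forall_mem_cons] at hz
    have z := fun i => pf hz.1 (e i)
    simp (decide := true) only [fa2, mul_add, h.ea0, if_true, if_false, add_zero, zero_add, mul_zero] at z
    rw [z.1, mul_zero] at q1
    rw [z.2, mul_zero, smul_zero] at q2
    exact ⟨z.1, z.2, q1.symm, q2.symm⟩
  · refine FB_sub6 ![0, 1, 1, 0] ![0, 1, 0, 1] ![some 0, some 1, none, none, none, none] ![some 3, some 2, none, none, none, none, none, none, none, none] (by decide) (by decide) ?_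
    rintro M hb ⟨h, ⟨h1, h2, h3, h4⟩, -⟩
    exact ⟨h, fun b hb => by simp [hb, h1, h2, h3, h4], fun l => by fin_cases l; exacts [Or.inr h1, Or.inr h2, Or.inl ⟨1, rfl⟩, Or.inl ⟨0, rfl⟩]⟩
theorem A3t : IsTauTiltingFinite (A3 K) := by
  refine bridge4 (n := 4) (m := 6) sI tI
    (fun _ _ _ a => a 1 * a 0 + a 2 * a 3 + a 4 * a 5 = 0 ∧ a 0 * a 1 = 0 ∧ a 3 * a 2 = 0 ∧ a 5 * a 4 = 0)
    (fun _ _ _ a => a 1 * a 0 + a 2 * a 3 + a 4 * a 5 = 0 ∧ a 0 * a 1 = 0 ∧ a 3 * a 2 = 0 ∧ a 5 * a 4 = 0)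
    (fun _ _ _ a => []) 5 ?_ ?_
  · rintro B _ _ e a h ⟨q1, q2, q3, q4⟩
    have h1 := pf q1
    have h2 := pf q2
    have h3 := pf q3
    have h4 := pf q4
    simp only [← mul_assoc, mul_zero, mul_add, mul_sub, mul_neg] at h1 h2 h3 h4
    have g4 : ∀ p, p * a 4 * a 5 = -(p * a 2 * a 3) - p * a 1 * a 0 := fun p => by grind
    have g5 : ∀ p, p * a 2 * a 3 * a 4 = -(p * a 1 * a 0 * a 4) := fun p => by 
      have u := congrArg (· * a 4) (g4 p)
      simp only [h4, mul_add, add_mul, sub_mul, neg_mul, zero_mul, neg_zero, sub_zero, zero_sub, zero_add, add_zero, neg_neg] at u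
      grind
    have g6 : ∀ p, p * a 5 * a 2 * a 3 = -(p * a 5 * a 1 * a 0) := fun p => by 
      have u := g4 (p * a 5)
      simp only [h4, mul_add, add_mul, sub_mul, neg_mul, zero_mul, neg_zero, sub_zero, zero_sub, zero_add, add_zero, neg_neg] at u
      grind
    have g7 : ∀ p, p * a 2 * a 3 * a 1 * a 0 = -(p * a 1 * a 0 * a 2 * a 3) := fun p => by 
      have u := congrArg (· * a 5) (g5 p)
      simp only [g4, h2, h3, mul_add, add_mul, sub_mul, neg_mul, zero_mul, neg_zero, sub_zero, zero_sub, zero_add, add_zero, neg_neg] at u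
      grind
    have g8 : ∀ p, p * a 3 * a 1 * a 0 * a 4 = 0 := fun p => by 
      have u := g5 (p * a 3)
      simp only [h3, mul_add, add_mul, sub_mul, neg_mul, zero_mul, neg_zero, sub_zero, zero_sub, zero_add, add_zero, neg_neg] at u
      grind
    have g9 : ∀ p, p * a 5 * a 1 * a 0 * a 2 = 0 := fun p => by 
      have u := congrArg (· * a 2) (g6 p)
      simp only [h3, mul_add, add_mul, sub_mul, neg_mul, zero_mul, neg_zero, sub_zero, zero_sub, zero_add, add_zero, neg_neg] at u
      grind
    have g10 : ∀ p, p * a 1 * a 0 * a 2 * a 3 * a 1 = 0 := fun p => by 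
      have u := congrArg (· * a 1) (g7 p)
      simp only [h2, mul_add, add_mul, sub_mul, neg_mul, zero_mul, neg_zero, sub_zero, zero_sub, zero_add, add_zero, neg_neg] at u
      grind
    have g11 : ∀ p, p * a 3 * a 1 * a 0 * a 2 * a 3 = 0 := fun p => by 
      have u := g7 (p * a 3)
      simp only [h3, mul_add, add_mul, sub_mul, neg_mul, zero_mul, neg_zero, sub_zero, zero_sub, zero_add, add_zero, neg_neg] at u
      grind
    refine bq h (h2 +: h3 +: h4 +: g4 +: g5 +: g6 +: g7 +: g8 +: g9 +: g10 +: g11) fun hz => ?_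
    exact ⟨q1, q2, q3, q4⟩
  · refine FB_sub6 sI tI ![none, none, some 0, some 1, some 2, some 3] ![none, none, none, none, some 1, some 0, some 3, some 2, some 5, some 4] (by decide) (by decide) ?_
    rintro M hb ⟨h, ⟨h1, h2, h3, h4⟩, -⟩
    exact ⟨h, fun b hb => by simp [hb, h1, h2, h3, h4], fun l => Or.inl (by revert l; decide)⟩
theorem A4t : IsTauTiltingFinite (A4 K) := by
  refine bridge4 (n := 4) (m := 6) sI tI
    (fun _ _ _ a => a 1 * a 0 + a 2 * a 3 + a 4 * a 5 = 0 ∧ a 0 * a 1 = 0 ∧ a 3 * a 4 = 0 ∧ a 5 * a 2 = 0)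
    (fun _ _ _ a => a 2 * a 3 + a 4 * a 5 = 0 ∧ a 0 * a 1 = 0 ∧ a 1 * a 0 = 0 ∧ a 3 * a 2 = 0 ∧ a 5 * a 4 = 0)
    (fun _ _ _ a => [a 5 * a 4 + a 3 * a 2 - a 1 * a 0]) 5 ?_ ?_
  · rintro B _ _ e a h ⟨q1, q2, q3, q4⟩
    have h1 := pf q1
    have h2 := pf q2
    have h3 := pf q3
    have h4 := pf q4
    simp only [← mul_assoc, mul_zero, mul_add, mul_sub, mul_neg] at h1 h2 h3 h4
    have g4 : ∀ p, p * a 4 * a 5 = -(p * a 2 * a 3) - p * a 1 * a 0 := fun p => by grind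
    have g5 : ∀ p, p * a 2 * a 3 * a 2 = -(p * a 1 * a 0 * a 2) := fun p => by 
      have u := congrArg (· * a 2) (g4 p)
      simp only [h4, mul_add, add_mul, sub_mul, neg_mul, zero_mul, neg_zero, sub_zero, zero_sub, zero_add, add_zero, neg_neg] at u
      grind
    have g6 : ∀ p, p * a 3 * a 2 * a 3 = -(p * a 3 * a 1 * a 0) := fun p => by 
      have u := g4 (p * a 3)
      simp only [h3, mul_add, add_mul, sub_mul, neg_mul, zero_mul, neg_zero, sub_zero, zero_sub, zero_add, add_zero, neg_neg] at u
      grind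
    have g7 : ∀ p, p * a 2 * a 3 * a 1 * a 0 = p * a 1 * a 0 * a 2 * a 3 := fun p => by 
      have u := congrArg (· * a 3) (g5 p)
      simp only [g6 (p * a 2), mul_add, add_mul, sub_mul, neg_mul, zero_mul, neg_zero, sub_zero, zero_sub, zero_add, add_zero, neg_neg] at u
      grind
    have g8 : ∀ p, p * a 3 * a 1 * a 0 * a 4 = 0 := fun p => by 
      have u := congrArg (· * a 4) (g6 p)
      simp only [h3, mul_add, add_mul, sub_mul, neg_mul, zero_mul, neg_zero, sub_zero, zero_sub, zero_add, add_zero, neg_neg] at u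
      grind
    have g9 : ∀ p, p * a 5 * a 1 * a 0 * a 2 = 0 := fun p => by 
      have u := g5 (p * a 5)
      simp only [h4, mul_add, add_mul, sub_mul, neg_mul, zero_mul, neg_zero, sub_zero, zero_sub, zero_add, add_zero, neg_neg] at u
      grind
    have g10 : ∀ p, p * a 1 * a 0 * a 2 * a 3 * a 1 = 0 := fun p => by 
      have u := congrArg (· * a 1) (g7 p)
      simp only [h2, mul_add, add_mul, sub_mul, neg_mul, zero_mul, neg_zero, sub_zero, zero_sub, zero_add, add_zero, neg_neg] at u
      grind
    have g11 : ∀ p, p * a 3 * a 1 * a 0 * a 2 * a 3 = 0 := fun p => by 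
      have u := g7 (p * a 3)
      simp only [g6, h2, mul_add, add_mul, sub_mul, neg_mul, zero_mul, neg_zero, sub_zero, zero_sub, zero_add, add_zero, neg_neg] at u
      grind
    refine bq h (h2 +: h3 +: h4 +: g4 +: g5 +: g6 +: g7 +: g8 +: g9 +: g10 +: g11) fun hz => ?_
    simp only [List.forall_mem_cons] at hz
    have z := fun i => pf hz.1 (e i)
    simp (decide := true) only [fa4, mul_add, mul_sub, ← mul_assoc, h.ea0, if_true, if_false, zero_mul, add_zero, zero_add, sub_zero, zero_sub, mul_zero, neg_eq_zero] at z
    rw [z.2.1, zero_add] at q1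
    exact ⟨q1, q2, z.2.1, z.2.2.1, z.2.2.2⟩
  · refine FB_sub6 sI tI ![none, none, some 0, some 1, some 2, some 3] ![none, none, none, none, some 1, some 0, some 3, some 2, some 5, some 4] (by decide) (by decide) ?_
    rintro M hb ⟨h, ⟨h1, h2, h3, h4, h5⟩, -⟩
    exact ⟨h, fun b hb => by simp [hb, h1, h2, h3, h4, h5], fun l => Or.inl (by revert l; decide)⟩
theorem A5t : IsTauTiltingFinite (A5 K) := by
  refine bridge4 (n := 2) (m := 3) sG tG
    (fun _ _ _ a => a 0 * a 0 = a 1 * a 2 ∧ a 2 * a 0 * a 1 = 0)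
    (fun _ _ _ a => a 0 * a 0 = 0 ∧ a 1 * a 2 = 0 ∧ a 2 * a 1 = 0 ∧ a 2 * a 0 * a 1 = 0)
    (fun _ _ _ a => [a 2 * a 1 + a 0 * a 0]) 5 ?_ ?_
  · rintro B _ _ e a h ⟨q1, q2⟩
    have h1 := pf q1
    have h2 := pf q2
    simp only [← mul_assoc, mul_zero, mul_add, mul_sub, mul_neg] at h1 h2
    have g3 : ∀ p, p * a 0 * a 0 * a 0 * a 1 = 0 := fun p => by rw [h1 p, h2 (p * a 1)]
    have g4 : ∀ p, p * a 2 * a 0 * a 0 * a 0 = 0 := fun p => by rw [h1 (p * a 2 * a 0), h2 p]; simp only [zero_mul]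
    have g5 : ∀ p, p * a 0 * a 0 * a 0 * a 0 * a 0 = 0 := fun p => by rw [h1 p, g4 (p * a 1)]
    refine bq h ((fun p => (h1 p).symm) +: h2 +: g3 +: g4 +: g5) fun hz => ?_
    simp only [List.forall_mem_cons] at hz
    have z := fun i => pf hz.1 (e i)
    simp (decide := true) only [fa2, mul_add, mul_sub, ← mul_assoc, h.ea0, if_true, if_false, zero_mul, add_zero, zero_add, sub_zero, zero_sub, mul_zero, neg_eq_zero] at z
    exact ⟨z.1, by rw [← q1, z.1], z.2, q2⟩
  · exact FB56
theorem A6t : IsTauTiltingFinite (A6 K) := by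
  refine bridge4 (n := 2) (m := 3) sG tG
    (fun _ _ _ a => a 0 * a 0 * a 0 = a 1 * a 2 ∧ a 2 * a 1 = 0 ∧ a 2 * a 0 * a 0 = 0 ∧ a 0 * a 0 * a 1 = 0)
    (fun _ _ _ a => a 0 * a 0 = 0 ∧ a 1 * a 2 = 0 ∧ a 2 * a 1 = 0 ∧ a 2 * a 0 * a 1 = 0)
    (fun _ _ _ a => [a 0 * a 0, a 2 * a 0 * a 1]) 5 ?_ ?_
  · rintro B _ _ e a h ⟨q1, q2, q3, q4⟩
    have h1 := pf q1
    have h2 := pf q2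
    have h3 := pf q3
    have h4 := pf q4
    simp only [← mul_assoc, mul_zero, mul_add, mul_sub, mul_neg] at h1 h2 h3 h4
    have g5 : ∀ p, p * a 1 * a 2 * a 0 = p * a 0 * a 1 * a 2 := fun p => by rw [← h1 p, h1 (p * a 0)]
    have g6 : ∀ p, p * a 2 * a 0 * a 1 * a 2 = 0 := fun p => by rw [← h1 (p * a 2 * a 0), h3 p]; simp only [zero_mul]
    have g7 : ∀ p, p * a 0 * a 1 * a 2 * a 0 = 0 := fun p => by rw [g5 (p * a 0), h4 p]; simp only [zero_mul]
    refine bq h (h1 +: h2 +: h3 +: h4 +: g5 +: g6 +: g7) fun hz => ?_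
    simp only [List.forall_mem_cons] at hz
    exact ⟨hz.1, by rw [← q1, hz.1, zero_mul], q2, hz.2.1⟩
  · exact FB56
theorem A7t : IsTauTiltingFinite (A7 K) := by
  refine bridge4 (n := 4) (m := 6) sD tD
    (fun _ _ _ a => a 1 * a 0 = a 2 * a 3 ∧ a 3 * a 2 = a 4 * a 5 ∧ a 0 * a 2 * a 4 = 0 ∧ a 5 * a 3 * a 1 = 0)
    (fun _ _ _ a => a 0 * a 1 = 0 ∧ a 1 * a 0 = 0 ∧ a 2 * a 3 = 0 ∧ a 3 * a 2 = 0 ∧ a 4 * a 5 = 0 ∧ a 5 * a 4 = 0)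
    (fun _ _ _ a => [a 5 * a 4 + a 3 * a 2 + a 1 * a 0 + a 0 * a 1]) 5 ?_ ?_
  · rintro B _ _ e a h ⟨q1, q2, q3, q4⟩
    have h1 := pf q1
    have h2 := pf q2
    have h3 := pf q3
    have h4 := pf q4
    simp only [← mul_assoc, mul_zero, mul_add, mul_sub, mul_neg] at h1 h2 h3 h4
    have g5 : ∀ p, p * a 0 * a 1 * a 0 * a 2 = 0 := fun p => by rw [h1 (p * a 0), h2 (p * a 0 * a 2), h3 p]; simp only [zero_mul]
    have g6 : ∀ p, p * a 3 * a 1 * a 0 * a 1 = 0 := fun p => by rw [h1 (p * a 3), h2 p, h4 (p * a 4)]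
    have g7 : ∀ p, p * a 0 * a 1 * a 0 * a 1 * a 0 = 0 := fun p => by rw [h1 (p * a 0 * a 1 * a 0), g5 p]; simp only [zero_mul]
    have g8 : ∀ p, p * a 1 * a 0 * a 1 * a 0 * a 1 = 0 := fun p => by rw [h1 p, g6 (p * a 2)]
    refine bq h ((fun p => (h1 p).symm) +: (fun p => (h2 p).symm) +: h3 +: h4 +: g5 +: g6 +: g7 +: g8) fun hz => ?_
    simp only [List.forall_mem_cons] at hz
    have z := fun i => pf hz.1 (e i)
    simp (decide := true) only [fa4, mul_add, mul_sub, ← mul_assoc, h.ea0, if_true, if_false, zero_mul, add_zero, zero_add, sub_zero, zero_sub, mul_zero, neg_eq_zero] at z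
    exact ⟨z.1, z.2.1, by rw [← q1, z.2.1], z.2.2.1, by rw [← q2, z.2.2.1], z.2.2.2⟩
  · refine FB_sub6 sD tD ![some 0, some 1, some 2, some 3, none, none] ![some 1, some 0, some 3, some 2, some 5, some 4, none, none, none, none] (by decide) (by decide) ?_
    rintro M hb ⟨h, ⟨h1, h2, h3, h4, h5, h6⟩, -⟩
    exact ⟨h, fun b hb => by simp [hb, h1, h2, h3, h4, h5, h6], fun l => Or.inl (by revert l; decide)⟩
theorem A8t : IsTauTiltingFinite (A8 K) := by
  refine bridge4 (n := 4) (m := 6) ![1, 2, 3, 0, 2, 0] ![0, 1, 2, 3, 0, 2]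
    (fun _ _ _ a => a 4 * a 5 * a 4 = a 0 * a 1 ∧ a 5 * a 4 * a 5 = a 2 * a 3 ∧ a 1 * a 5 * a 4 = 0 ∧ a 3 * a 4 * a 5 = 0 ∧ a 5 * a 4 * a 2 = 0 ∧ a 4 * a 5 * a 0 = 0 ∧ a 1 * a 2 = 0 ∧ a 3 * a 0 = 0)
    (fun _ _ _ a => a 4 * a 5 = 0 ∧ a 5 * a 4 = 0 ∧ a 0 * a 1 = 0 ∧ a 2 * a 3 = 0)
    (fun _ _ _ a => [a 5 * a 4 + a 4 * a 5]) 7 ?_ ?_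
  · rintro B _ _ e a h ⟨q1, q2, q3, q4, q5, q6, q7, q8⟩
    have h1 := pf q1
    have h2 := pf q2
    have h3 := pf q3
    have h4 := pf q4
    have h5 := pf q5
    have h6 := pf q6
    have h7 := pf q7
    have h8 := pf q8
    simp only [← mul_assoc, mul_zero, mul_add, mul_sub, mul_neg] at h1 h2 h3 h4 h5 h6 h7 h8
    have g9 : ∀ p, p * a 4 * a 2 * a 3 = p * a 0 * a 1 * a 5 := fun p => by rw [← h2 (p * a 4), h1 p]
    have g10 : ∀ p, p * a 5 * a 0 * a 1 = p * a 2 * a 3 * a 4 := fun p => by rw [← h1 (p * a 5), h2 p]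
    have g11 : ∀ p, p * a 0 * a 1 * a 5 * a 0 = 0 := fun p => by rw [← h1 p, h6 (p * a 4 * a 5)]
    have g12 : ∀ p, p * a 2 * a 3 * a 4 * a 2 = 0 := fun p => by rw [← h2 p, h5 (p * a 5 * a 4)]
    refine bq h (h7 +: h8 +: h3 +: h4 +: h6 +: h5 +: h1 +: h2 +: g9 +: g10 +: g11 +: g12) fun hz => ?_
    simp only [List.forall_mem_cons] at hz
    have z := fun i => pf hz.1 (e i)
    simp (decide := true) only [fa4, mul_add, ← mul_assoc, h.ea0, if_true, if_false, zero_mul, add_zero, zero_add, mul_zero, true_and, and_true] at z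
    exact ⟨z.1, z.2, by rw [← q1, z.1, zero_mul], by rw [← q2, z.2, zero_mul]⟩
  · exact FB_A8
theorem A9t : IsTauTiltingFinite (A9 K) := by
  refine bridge4 (n := 4) (m := 6) ![1, 2, 1, 3, 2, 0] ![0, 1, 2, 2, 3, 3]
    (fun _ _ _ a => a 5 * a 0 = a 4 * a 2 ∧ a 3 * a 4 = a 2 * a 1 ∧ a 0 * a 1 * a 2 = 0 ∧ a 4 * a 3 * a 5 = 0 ∧ a 1 * a 3 * a 4 * a 3 = 0)
    (fun _ _ _ a => a 5 * a 0 = a 4 * a 2 ∧ a 1 * a 2 = 0 ∧ a 2 * a 1 = 0 ∧ a 3 * a 4 = 0 ∧ a 4 * a 3 = 0)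
    (fun _ _ _ a => [a 4 * a 3 + a 2 * a 1 + a 1 * a 2]) 7 ?_ ?_
  · rintro B _ _ e a h ⟨q1, q2, q3, q4, q5⟩
    have h1 := pf q1
    have h2 := pf q2
    have h3 := pf q3
    have h4 := pf q4
    have h5 := pf q5
    simp only [← mul_assoc, mul_zero, mul_add, mul_sub, mul_neg] at h1 h2 h3 h4 h5
    have g5 : ∀ p, p * a 1 * a 2 * a 1 * a 3 = 0 := fun p => by rw [← h2 (p * a 1), h5 p]
    have g6 : ∀ p, p * a 2 * a 1 * a 3 * a 5 = 0 := fun p => by rw [← h2 p, h4 (p * a 3)]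
    have g7 : ∀ p, p * a 4 * a 2 * a 1 * a 2 = 0 := fun p => by rw [← h1 p, h3 (p * a 5)]
    have g8 : ∀ p, p * a 1 * a 2 * a 1 * a 2 * a 1 = 0 := fun p => by rw [← h2 (p * a 1 * a 2 * a 1), g5 p]; simp only [zero_mul]
    have g9 : ∀ p, p * a 2 * a 1 * a 2 * a 1 * a 2 = 0 := fun p => by rw [← h2 p, g7 (p * a 3)]
    refine bq h (h2 +: h1 +: h3 +: h4 +: g5 +: g6 +: g7 +: g8 +: g9) fun hz => ?_
    simp only [List.forall_mem_cons] at hz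
    have z := fun i => pf hz.1 (e i)
    simp (decide := true) only [fa4, mul_add, ← mul_assoc, h.ea0, if_true, if_false, zero_mul, add_zero, zero_add, mul_zero, true_and, and_true] at z
    exact ⟨q1, z.1, z.2.1, by rw [q2, z.2.1], z.2.2⟩
  · exact FB_A9
theorem A10t : IsTauTiltingFinite (A10 K) := by
  refine bridge4 (n := 4) (m := 5) sF tF
    (fun _ _ _ a => a 4 * a 1 * a 0 = a 4 * a 2 * a 3 * a 4 ∧ a 1 * a 0 * a 2 = a 2 * a 3 * a 4 * a 2 ∧ a 0 * a 1 = 0 ∧ a 3 * a 4 * a 2 * a 3 * a 4 * a 2 * a 3 = 0)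
    (fun _ _ _ a => a 0 * a 1 = 0 ∧ a 1 * a 0 = 0 ∧ a 3 * a 4 * a 2 = 0 ∧ a 4 * a 2 * a 3 = 0 ∧ a 0 * a 2 * a 3 * a 4 * a 1 = 0)
    (fun _ _ _ a => [a 4 * a 2 * a 3 + a 3 * a 4 * a 2 + a 1 * a 0, a 0 * a 2 * a 3 * a 4 * a 1]) 10 ?_ ?_
  · rintro B _ _ e a h ⟨q1, q2, q3, q4⟩
    have h1 := pf q1
    have h2 := pf q2
    have h3 := pf q3
    have h4 := pf q4
    simp only [← mul_assoc, mul_zero, mul_add, mul_sub, mul_neg] at h1 h2 h3 h4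
    have g4 : ∀ p, p * a 2 * a 3 * a 4 * a 1 * a 0 = p * a 1 * a 0 * a 2 * a 3 * a 4 := fun p => by rw [h1 (p * a 2 * a 3), ← h2 p]
    have g5 : ∀ p, p * a 1 * a 0 * a 2 * a 3 * a 4 * a 1 = 0 := fun p => by rw [← g4 p, h3 (p * a 2 * a 3 * a 4 * a 1)]
    have g6 : ∀ p, p * a 3 * a 4 * a 1 * a 0 * a 2 * a 3 = 0 := fun p => by rw [h1 (p * a 3), h4 p]
    have g7 : ∀ p, p * a 4 * a 1 * a 0 * a 2 * a 3 * a 4 = 0 := fun p => by rw [← g4 (p * a 4), ← h1 p, h3 (p * a 4 * a 1)]; simp only [zero_mul]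
    refine bq h (h3 +: (fun p => (h2 p).symm) +: (fun p => (h1 p).symm) +: g4 +: g5 +: g6 +: g7) fun hz => ?_
    simp only [List.forall_mem_cons] at hz
    have z := fun i => pf hz.1 (e i)
    simp (decide := true) only [fa4, mul_add, ← mul_assoc, h.ea0, if_true, if_false, zero_mul, add_zero, zero_add, mul_zero, true_and, and_true] at z
    exact ⟨q3, z.1, z.2.1, z.2.2, hz.2.1⟩
  · exact FB_A10
theorem A11t : IsTauTiltingFinite (A11 K) := by
  refine bridge4 (n := 4) (m := 6) sD tD
    (fun _ _ _ a => a 3 * a 1 * a 0 = a 3 * a 2 * a 3 ∧ a 1 * a 0 * a 2 = a 2 * a 3 * a 2 ∧ a 0 * a 1 = 0 ∧ a 5 * a 3 = 0 ∧ a 2 * a 4 = 0 ∧ a 3 * a 2 * a 3 * a 2 = a 4 * a 5)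
    (fun _ _ _ a => a 0 * a 1 = 0 ∧ a 1 * a 0 = 0 ∧ a 2 * a 4 = 0 ∧ a 3 * a 2 = 0 ∧ a 4 * a 5 = 0 ∧ a 5 * a 3 = 0 ∧ a 5 * a 4 = 0 ∧ a 0 * a 2 * a 3 * a 1 = 0)
    (fun _ _ _ a => [a 3 * a 2 + a 1 * a 0, a 5 * a 4, a 0 * a 2 * a 3 * a 1]) 9 ?_ ?_
  · rintro B _ _ e a h ⟨q1, q2, q3, q4, q5, q6⟩
    have h1 := pf q1
    have h2 := pf q2
    have h3 := pf q3
    have h4 := pf q4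
    have h5 := pf q5
    have h6 := pf q6
    simp only [← mul_assoc, mul_zero, mul_add, mul_sub, mul_neg] at h1 h2 h3 h4 h5 h6
    have g6 : ∀ p, p * a 4 * a 5 * a 4 = 0 := fun p => by rw [← h6 p, h5 (p * a 3 * a 2 * a 3)]
    have g7 : ∀ p, p * a 5 * a 4 * a 5 = 0 := fun p => by rw [← h6 (p * a 5), h4 p]; simp only [zero_mul]
    have g8 : ∀ p, p * a 2 * a 3 * a 1 * a 0 = p * a 1 * a 0 * a 2 * a 3 := fun p => by rw [h1 (p * a 2), ← h2 p]
    have g9 : ∀ p, p * a 3 * a 1 * a 0 * a 2 = p * a 4 * a 5 := fun p => by rw [h1 p, h6 p]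
    have g10 : ∀ p, p * a 1 * a 0 * a 2 * a 3 * a 1 = 0 := fun p => by rw [← g8 p, h3 (p * a 2 * a 3 * a 1)]
    refine bq h (h3 +: h5 +: h4 +: (fun p => (h2 p).symm) +: (fun p => (h1 p).symm) +: g6 +: g7 +: g8 +: g9 +: g10) fun hz => ?_
    simp only [List.forall_mem_cons] at hz
    have z := fun i => pf hz.1 (e i)
    simp (decide := true) only [fa4, mul_add, ← mul_assoc, h.ea0, if_true, if_false, zero_mul, add_zero, zero_add, mul_zero, true_and, and_true] at z
    exact ⟨q3, z.1, q5, z.2, by rw [← q6, z.2]; simp, q4, hz.2.1, hz.2.2.1⟩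
  · exact FB_A11
theorem A12t : IsTauTiltingFinite (A12 K) := by
  refine bridge4 (n := 3) (m := 4) sC tC
    (fun _ _ _ a => a 3 * a 2 * a 3 = a 0 * a 1 ∧ a 1 * a 2 * a 0 = 0 ∧ a 2 * a 3 * a 2 * a 3 * a 2 * a 3 * a 2 = 0)
    (fun _ _ _ a => a 0 * a 1 * a 2 = 0 ∧ a 1 * a 2 * a 0 = 0 ∧ a 2 * a 0 * a 1 = 0 ∧ a 3 * a 2 * a 3 = a 0 * a 1 ∧ a 1 * a 2 * a 3 * a 2 * a 0 = 0)
    (fun _ _ _ a => [a 2 * a 0 * a 1 + a 0 * a 1 * a 2, a 1 * a 2 * a 3 * a 2 * a 0]) 9 ?_ ?_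
  · rintro B _ _ e a h ⟨q1, q2, q3⟩
    have h1 := pf q1
    have h2 := pf q2
    have h3 := pf q3
    simp only [← mul_assoc, mul_zero, mul_add, mul_sub, mul_neg] at h1 h2 h3
    have g3 : ∀ p, p * a 3 * a 2 * a 0 * a 1 = p * a 0 * a 1 * a 2 * a 3 := fun p => by rw [← h1 (p * a 3 * a 2), h1 p]
    have g4 : ∀ p, p * a 0 * a 1 * a 2 * a 3 * a 2 * a 0 = 0 := fun p => by rw [← g3 p, h2 (p * a 3 * a 2 * a 0)]
    have g5 : ∀ p, p * a 2 * a 0 * a 1 * a 2 * a 3 * a 2 = 0 := fun p => by rw [← h1 (p * a 2), h3 p]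
    refine bq h (h2 +: h1 +: g3 +: g4 +: g5) fun hz => ?_
    simp only [List.forall_mem_cons] at hz
    have z := fun i => pf hz.1 (e i)
    simp (decide := true) only [fa3, mul_add, ← mul_assoc, h.ea0, if_true, if_false, zero_mul, add_zero, zero_add, mul_zero, true_and, and_true] at z
    exact ⟨z.1, q2, z.2, q1, hz.2.1⟩
  · exact FB_A12
theorem A13t : IsTauTiltingFinite (A13 K) := by
  refine bridge4 (n := 3) (m := 5) sH tH
    (fun _ _ _ a => a 0 * a 0 = a 2 * a 1 ∧ a 1 * a 3 = 0 ∧ a 1 * a 2 = 0 ∧ a 4 * a 2 = 0 ∧ a 4 * a 0 = 0 ∧ a 0 * a 3 = 0 ∧ a 0 * a 0 * a 0 = a 3 * a 4)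
    (fun _ _ _ a => a 0 * a 0 = 0 ∧ a 0 * a 3 = 0 ∧ a 1 * a 2 = 0 ∧ a 1 * a 3 = 0 ∧ a 2 * a 1 = 0 ∧ a 3 * a 4 = 0 ∧ a 4 * a 0 = 0 ∧ a 4 * a 2 = 0 ∧ a 4 * a 3 = 0 ∧ a 1 * a 0 * a 2 = 0)
    (fun _ _ _ a => [a 0 * a 0, a 4 * a 3, a 1 * a 0 * a 2]) 7 ?_ ?_
  · rintro B _ _ e a h ⟨q1, q2, q3, q4, q5, q6, q7⟩
    have h1 := pf q1
    have h2 := pf q2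
    have h3 := pf q3
    have h4 := pf q4
    have h5 := pf q5
    have h6 := pf q6
    have h7 := pf q7
    simp only [← mul_assoc, mul_zero, mul_add, mul_sub, mul_neg] at h1 h2 h3 h4 h5 h6 h7
    have g8 : ∀ p, p * a 0 * a 0 * a 2 = 0 := fun p => by rw [h1 p, h3 (p * a 2)]
    have g9 : ∀ p, p * a 1 * a 0 * a 0 = 0 := fun p => by rw [h1 (p * a 1), h3 p]; simp only [zero_mul]
    have g10 : ∀ p, p * a 3 * a 4 * a 3 = 0 := fun p => by rw [← h7 p, h6 (p * a 0 * a 0)]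
    have g11 : ∀ p, p * a 4 * a 3 * a 4 = 0 := fun p => by rw [← h7 (p * a 4), h5 p]; simp only [zero_mul]
    refine bq h ((fun p => (h1 p).symm) +: h6 +: h3 +: h2 +: h5 +: h4 +: h7 +: g8 +: g9 +: g10 +: g11) fun hz => ?_
    simp only [List.forall_mem_cons] at hz
    exact ⟨hz.1, q6, q3, q2, by rw [← q1, hz.1], by rw [← q7, hz.1, zero_mul], q5, q4, hz.2.1, hz.2.2.1⟩
  · exact FB_A13
theorem A14t : IsTauTiltingFinite (A14 K) := by
  refine bridge4 (n := 3) (m := 4) sB tB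
    (fun _ _ _ a => a 1 * a 0 = a 2 * a 3 * a 2 * a 3 ∧ a 0 * a 2 * a 3 * a 2 = 0 ∧ a 3 * a 2 * a 3 * a 1 = 0 ∧ a 0 * a 1 = 0)
    (fun _ _ _ a => a 0 * a 1 = 0 ∧ a 1 * a 0 = 0 ∧ a 0 * a 2 * a 3 * a 1 = 0 ∧ a 0 * a 2 * a 3 * a 2 = 0 ∧ a 2 * a 3 * a 2 * a 3 = 0 ∧ a 3 * a 2 * a 3 * a 1 = 0 ∧ a 3 * a 2 * a 3 * a 2 = 0)
    (fun _ _ _ a => [a 3 * a 2 * a 3 * a 2 + a 1 * a 0, a 0 * a 2 * a 3 * a 1]) 9 ?_ ?_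
  · rintro B _ _ e a h ⟨q1, q2, q3, q4⟩
    have h1 := pf q1
    have h2 := pf q2
    have h3 := pf q3
    have h4 := pf q4
    simp only [← mul_assoc, mul_zero, mul_add, mul_sub, mul_neg] at h1 h2 h3 h4
    have g3 : ∀ p, p * a 2 * a 3 * a 1 * a 0 = p * a 1 * a 0 * a 2 * a 3 := fun p => by rw [h1 (p * a 2 * a 3), ← h1 p]
    have g6 : ∀ p, p * a 1 * a 0 * a 2 * a 3 * a 1 = 0 := fun p => by rw [h1 p, h3 (p * a 2 * a 3 * a 2)]
    have g7 : ∀ p, p * a 3 * a 1 * a 0 * a 2 * a 3 = 0 := fun p => by rw [← g3 (p * a 3), h3 p]; simp only [zero_mul]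
    refine bq h (h4 +: h2 +: g3 +: (fun p => (h1 p).symm) +: h3 +: g6 +: g7) fun hz => ?_
    simp only [List.forall_mem_cons] at hz
    have z := fun i => pf hz.1 (e i)
    simp (decide := true) only [fa3, mul_add, ← mul_assoc, h.ea0, if_true, if_false, zero_mul, add_zero, zero_add, mul_zero, true_and, and_true] at z
    exact ⟨q4, z.1, hz.2.1, q2, by rw [← q1, z.1], q3, z.2⟩
  · exact FB_A14
theorem A15t : IsTauTiltingFinite (A15 K) := by
  refine bridge4 (n := 3) (m := 5) sA tA
    (fun _ _ _ a => a 2 * a 3 * a 0 = 0 ∧ a 0 * a 0 = a 4 * a 3 ∧ a 3 * a 4 = 0 ∧ a 0 * a 1 = 0 ∧ a 0 * a 4 = a 1 * a 2)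
    (fun _ _ _ a => a 0 * a 0 = 0 ∧ a 0 * a 1 = 0 ∧ a 3 * a 4 = 0 ∧ a 4 * a 3 = 0 ∧ a 2 * a 3 * a 0 = 0 ∧ a 2 * a 3 * a 1 = 0 ∧ a 3 * a 0 * a 4 = 0 ∧ a 0 * a 4 = a 1 * a 2)
    (fun _ _ _ a => [a 0 * a 0, a 2 * a 3 * a 1, a 3 * a 0 * a 4]) 6 ?_ ?_
  · rintro B _ _ e a h ⟨q1, q2, q3, q4, q5⟩
    have h1 := pf q1
    have h2 := pf q2
    have h3 := pf q3
    have h4 := pf q4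
    have h5 := pf q5
    simp only [← mul_assoc, mul_zero, mul_add, mul_sub, mul_neg] at h1 h2 h3 h4 h5
    have g5 : ∀ p, p * a 0 * a 0 * a 4 = 0 := fun p => by rw [h2 p, h3 (p * a 4)]
    have g7 : ∀ p, p * a 3 * a 0 * a 0 = 0 := fun p => by rw [h2 (p * a 3), h3 p]; simp only [zero_mul]
    have g8 : ∀ p, p * a 0 * a 0 * a 0 * a 0 = 0 := fun p => by rw [h2 p, g7 (p * a 4)]
    refine bq h (h4 +: h3 +: (fun p => (h5 p).symm) +: (fun p => (h2 p).symm) +: g5 +: h1 +: g7 +: g8) fun hz => ?_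
    simp only [List.forall_mem_cons] at hz
    exact ⟨hz.1, q4, q3, by rw [← q2, hz.1], q1, hz.2.1, hz.2.2.1, q5⟩
  · exact FB_A15
theorem A16t : IsTauTiltingFinite (A16 K) := by
  refine bridge4 (n := 3) (m := 5) ![0, 0, 1, 2, 0] ![0, 1, 2, 0, 2]
    (fun _ _ _ a => a 0 * a 3 * a 2 = 0 ∧ a 0 * a 0 = a 3 * a 4 ∧ a 4 * a 3 = 0 ∧ a 1 * a 0 = 0 ∧ a 4 * a 0 = a 2 * a 1)
    (fun _ _ _ a => a 0 * a 0 = 0 ∧ a 1 * a 0 = 0 ∧ a 4 * a 3 = 0 ∧ a 3 * a 4 = 0 ∧ a 0 * a 3 * a 2 = 0 ∧ a 1 * a 3 * a 2 = 0 ∧ a 4 * a 0 * a 3 = 0 ∧ a 4 * a 0 = a 2 * a 1)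
    (fun _ _ _ a => [a 0 * a 0, a 1 * a 3 * a 2, a 2 * a 1 * a 3]) 6 ?_ ?_
  · rintro B _ _ e a h ⟨q1, q2, q3, q4, q5⟩
    have h1 := pf q1
    have h2 := pf q2
    have h3 := pf q3
    have h4 := pf q4
    have h5 := pf q5
    simp only [← mul_assoc, mul_zero, mul_add, mul_sub, mul_neg] at h1 h2 h3 h4 h5
    have g5 : ∀ p, p * a 0 * a 0 * a 3 = 0 := fun p => by rw [h2 p, h3 (p * a 3)]
    have g7 : ∀ p, p * a 3 * a 2 * a 1 = p * a 0 * a 0 * a 0 := fun p => by rw [← h5 (p * a 3), ← h2 p]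
    have g8 : ∀ p, p * a 0 * a 0 * a 0 * a 0 = 0 := fun p => by rw [h2 (p * a 0 * a 0), g5 p]; simp only [zero_mul]
    have g9 : ∀ p, p * a 2 * a 1 * a 3 * a 2 = 0 := fun p => by rw [← h5 p, h1 (p * a 4)]
    refine bq h (h4 +: h3 +: (fun p => (h2 p).symm) +: h5 +: g5 +: h1 +: g7 +: g8 +: g9) fun hz => ?_
    simp only [List.forall_mem_cons] at hz
    exact ⟨hz.1, q4, q3, by rw [← q2, hz.1], q1, hz.2.1, by rw [q5, hz.2.2.1], q5⟩
  · exact FB_A16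
end A1
theorem weakly_symmetric_tubular_algebras_tau_tilting_finite
    (K : Type) [Field K] [IsAlgClosed K] :
    (∀ l : K, l ≠ 0 → l ≠ 1 → IsTauTiltingFinite (A1 K l)) ∧
    (∀ l : K, l ≠ 0 → l ≠ 1 → IsTauTiltingFinite (A2 K l)) ∧
    IsTauTiltingFinite (A3 K) ∧ IsTauTiltingFinite (A4 K) ∧ IsTauTiltingFinite (A5 K) ∧
    IsTauTiltingFinite (A6 K) ∧ IsTauTiltingFinite (A7 K) ∧ IsTauTiltingFinite (A8 K) ∧
    IsTauTiltingFinite (A9 K) ∧ IsTauTiltingFinite (A10 K) ∧ IsTauTiltingFinite (A11 K) ∧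
    IsTauTiltingFinite (A12 K) ∧ IsTauTiltingFinite (A13 K) ∧ IsTauTiltingFinite (A14 K) ∧
    IsTauTiltingFinite (A15 K) ∧ IsTauTiltingFinite (A16 K) :=
  ⟨A1t, A2t, A3t, A4t, A5t, A6t, A7t, A8t, A9t, A10t, A11t, A12t, A13t, A14t, A15t, A16t⟩
end PaperSilting
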